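/- Generalized Cherednik–Macdonald identity for Σ of type C_n, case (i): let n ≥ 2, ω₊,ω₋ ∈ ℂ₊ with Im(ω₊ω₋) < 0, and k_s, k_l ∈ ℂ₋ ∩ ω₊ω₋ℂ₊. Then ∫_{ℝⁿ} ∏_{α∈R_s} G(2⟨α,v⟩+iω)/G(2⟨α,v⟩+i(k_l+ω)) · ∏_{β∈R_l} G(⟨β,v⟩+iω)/G(⟨β,v⟩+i(k_s+ω)) d′v converges absolutely and equals N_BC(ω₊,ω₋; γ = (k_l/2, k_l/2−ω₊/2, k_l/2−ω₋/2, k_l/2−ω), κ = k_s). -/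

import Mathlib

open MeasureTheory Set
open scoped BigOperators Classical

noncomputable section

/-- Ruijsenaars' hyperbolic gamma function `G(ω₊,ω₋;z)`, defined by the integral
representation, valid on the strip `|Im z| < Re((ω₊+ω₋)/2)`. -/
def hypGammaInt (op om z : ℂ) : ℂ :=
  Complex.exp (Complex.I * ∫ y in Set.Ioi (0:ℝ),
    (1/(y:ℂ)) * (Complex.sin (2*(y:ℂ)*z) /
        (2 * Complex.sinh (op*(y:ℂ)) * Complex.sinh (om*(y:ℂ)))
      - z/(op*om*(y:ℂ))))

/-- The locus `-iω - Λ` (with `ω = (ω₊+ω₋)/2`, `Λ = ℤ≥0·iω₊ + ℤ≥0·iω₋`) containing the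
poles of the hyperbolic gamma function; off this set the meromorphic extension is defined. -/
def hypGammaPoles (op om : ℂ) : Set ℂ :=
  {z | ∃ m n : ℕ, z = -Complex.I*(op+om)/2 - (m:ℂ)*Complex.I*op - (n:ℂ)*Complex.I*om}

/-- Predicate expressing that `G : ℂ → ℂ` is the meromorphic extension in `z` of
Ruijsenaars' hyperbolic gamma function with quasi-periods `ω₊ = op`, `ω₋ = om`:
it agrees with the integral representation on the strip `|Im z| < Re((ω₊+ω₋)/2)`,
satisfies both functional equations (away from the zeros of the `cosh` factor, where
the two sides have poles), and is continuous away from the pole locus. -/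
structure IsHypGamma (op om : ℂ) (G : ℂ → ℂ) : Prop where
  strip : ∀ z : ℂ, |z.im| < ((op+om)/2).re → G z = hypGammaInt op om z
  funEqm : ∀ z : ℂ, Complex.cosh (Real.pi * z / op) ≠ 0 →
    G (z + Complex.I * om/2) = 2 * Complex.cosh (Real.pi * z / op) * G (z - Complex.I * om/2)
  funEqp : ∀ z : ℂ, Complex.cosh (Real.pi * z / om) ≠ 0 →
    G (z + Complex.I * op/2) = 2 * Complex.cosh (Real.pi * z / om) * G (z - Complex.I * op/2)
  cont : ContinuousOn G (hypGammaPoles op om)ᶜ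

/-- `∏_{α ∈ R_s} f(⟨α,v⟩)` where `R_s = {±ε_j}_{j=1}^n`. -/
def bcShort {n : ℕ} (f : ℝ → ℂ) (v : Fin n → ℝ) : ℂ :=
  ∏ j : Fin n, (f (v j) * f (-v j))

/-- `∏_{β ∈ R_l} f(⟨β,v⟩)` where `R_l = {±(ε_r ± ε_s)}_{1 ≤ r < s ≤ n}` (empty for `n = 1`). -/
def bcLong {n : ℕ} (f : ℝ → ℂ) (v : Fin n → ℝ) : ℂ :=
  ∏ p ∈ Finset.univ.filter (fun p : Fin n × Fin n => p.1 < p.2),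
    (f (v p.1 + v p.2) * f (-(v p.1 + v p.2)) * f (v p.1 - v p.2) * f (v p.2 - v p.1))

/-- The evaluation `N_BC` of the hyperbolic `BC_n` (Koornwinder-type) integral. -/
def NBC (G : ℂ → ℂ → ℂ → ℂ) (n : ℕ) (op om : ℂ) (γ : Fin 4 → ℂ) (κ : ℂ) : ℂ :=
  2^n * (Nat.factorial n : ℂ) * ((op*om) ^ ((1:ℂ)/2))^n *
    ∏ j ∈ Finset.range n,
      (G op om (Complex.I*((op+om)/2 + κ)) *
          G op om (Complex.I*((op+om)/2 + (2*(n:ℂ) - (j:ℂ) - 2)*κ + (γ 0 + γ 1 + γ 2 + γ 3)))) /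
        (G op om (Complex.I*((op+om)/2 + ((j:ℂ)+1)*κ)) *
          ∏ p ∈ Finset.univ.filter (fun p : Fin 4 × Fin 4 => p.1 < p.2),
            G op om (Complex.I*((op+om)/2 + (j:ℂ)*κ + γ p.1 + γ p.2)))

/-- Membership in the parameter space `𝒮_BC`. -/
def inSBC (op om : ℂ) (γ : Fin 4 → ℂ) (κ : ℂ) : Prop :=
  0 < op.re ∧ 0 < om.re ∧ (op*om).im < 0 ∧ (∀ r, (γ r).re < 0) ∧
    (∃ w : ℂ, 0 < w.re ∧ op + om + (γ 0 + γ 1 + γ 2 + γ 3) = op*om*w) ∧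
    κ.re < 0 ∧ ∃ w : ℂ, 0 < w.re ∧ κ = op*om*w

section

open Filter Topology in
/-- An integral depending holomorphically on a parameter, locally dominated, is holomorphic. -/
theorem differentiableAt_integral_of_dominated {α : Type*} [MeasurableSpace α] {μ : Measure α}
    {f : ℂ → α → ℂ} {z₀ : ℂ} {g : α → ℝ} (hg : Integrable g μ)
    (hmeas : ∀ᶠ z in 𝓝 z₀, AEStronglyMeasurable (f z) μ)
    (hdom : ∀ᶠ z in 𝓝 z₀, ∀ y, ‖f z y‖ ≤ g y)
    (hdiff : ∀ᶠ z in 𝓝 z₀, ∀ y, DifferentiableAt ℂ (fun w => f w y) z) :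
    DifferentiableAt ℂ (fun z => ∫ y, f z y ∂μ) z₀ := by
  obtain ⟨r, hr, hball⟩ := Metric.eventually_nhds_iff_ball.1 (hmeas.and (hdom.and hdiff))
  have hderiv : ∀ y, ∀ z ∈ Metric.ball z₀ (r/2), ‖deriv (fun w => f w y) z‖ ≤ g y / (r/4) := by
    intro y z hz
    have hsub : Metric.closedBall z (r/4) ⊆ Metric.ball z₀ r := by
      intro w hw
      rw [Metric.mem_closedBall] at hw
      rw [Metric.mem_ball] at hz ⊢
      calc dist w z₀ ≤ dist w z + dist z z₀ := dist_triangle _ _ _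
        _ < r := by linarith
    apply Complex.norm_deriv_le_of_forall_mem_sphere_norm_le (by positivity)
    · refine DifferentiableOn.diffContOnCl ?_
      intro w hw
      refine ((hball w (hsub ?_)).2.2 y).differentiableWithinAt
      rwa [closure_ball z (by positivity)] at hw
    · intro w hw
      exact (hball w (hsub (Metric.sphere_subset_closedBall hw))).2.1 y
  have hz₀ : z₀ ∈ Metric.ball z₀ r := Metric.mem_ball_self hr
  refine (hasDerivAt_integral_of_dominated_loc_of_deriv_le (F := f)
    (F' := fun z y => deriv (fun w => f w y) z) (bound := fun y => g y / (r/4))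
    (s := Metric.ball z₀ (r/2)) (Metric.ball_mem_nhds _ (by positivity)) hmeas ?_ ?_ ?_ ?_ ?_).2.differentiableAt
  · exact Integrable.mono' hg (hball z₀ hz₀).1 (Eventually.of_forall (hball z₀ hz₀).2.1)
  · have hlim : ∀ y, Tendsto (fun n : ℕ => (((r/2)/((n:ℝ)+1) : ℝ) : ℂ)⁻¹ *
        (f (z₀ + (((r/2)/((n:ℝ)+1) : ℝ) : ℂ)) y - f z₀ y)) atTop
        (𝓝 (deriv (fun w => f w y) z₀)) := by
      intro y
      have h1 := ((hball z₀ hz₀).2.2 y).hasDerivAt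
      rw [hasDerivAt_iff_tendsto_slope] at h1
      have hs : Tendsto (fun n : ℕ => z₀ + (((r/2)/((n:ℝ)+1) : ℝ) : ℂ)) atTop (𝓝[≠] z₀) := by
        refine tendsto_nhdsWithin_iff.2 ⟨?_, Eventually.of_forall fun n => ?_⟩
        · have h2 : Tendsto (fun n : ℕ => (r/2)/((n:ℝ)+1)) atTop (𝓝 0) := by
            have := tendsto_one_div_add_atTop_nhds_zero_nat (𝕜 := ℝ)
            simpa [div_eq_mul_inv] using this.const_mul (r/2)
          have h3 := (Complex.continuous_ofReal.tendsto 0).comp h2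
          simpa using h3.const_add z₀
        · have : ((r/2)/((n:ℝ)+1) : ℝ) ≠ 0 := by positivity
          simp only [mem_compl_iff, mem_singleton_iff, add_eq_left]
          exact_mod_cast this
      have h4 := h1.comp hs
      refine h4.congr fun n => ?_
      simp [slope, Function.comp]
    have hmem : ∀ n : ℕ, z₀ + (((r/2)/((n:ℝ)+1) : ℝ) : ℂ) ∈ Metric.ball z₀ r := by
      intro n
      rw [Metric.mem_ball, dist_eq_norm, add_sub_cancel_left, Complex.norm_real, Real.norm_eq_abs,
        abs_of_pos (by positivity)]
      calc (r/2)/((n:ℝ)+1) ≤ r/2 := div_le_self (by positivity) (by linarith [Nat.cast_nonneg (α := ℝ) n])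
        _ < r := by linarith
    refine aestronglyMeasurable_of_tendsto_ae atTop (f := fun (n : ℕ) y => (((r/2)/((n:ℝ)+1) : ℝ) : ℂ)⁻¹ *
        (f (z₀ + (((r/2)/((n:ℝ)+1) : ℝ) : ℂ)) y - f z₀ y)) (fun n => ?_) (Eventually.of_forall hlim)
    exact (((hball _ (hmem n)).1.sub (hball z₀ hz₀).1).const_mul _)
  · exact Eventually.of_forall hderiv
  · exact hg.div_const _
  · refine Eventually.of_forall fun y z hz => ?_
    exact ((hball z (Metric.ball_subset_ball (by linarith) hz)).2.2 y).hasDerivAt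

/-- The entire function `sinh z / z`. -/
def sinhc : ℂ → ℂ := dslope Complex.sinh 0

/-- The entire function `(sinh z / z - 1) / z ^ 2`. -/
def sinhcc : ℂ → ℂ := dslope (dslope sinhc 0) 0

theorem differentiable_dslope_zero {f : ℂ → ℂ} (hf : Differentiable ℂ f) :
    Differentiable ℂ (dslope f 0) := by
  have := (Complex.differentiableOn_dslope (s := univ) (c := 0) (f := f) Filter.univ_mem).2
    hf.differentiableOn
  exact differentiableOn_univ.1 this

theorem differentiable_sinhc : Differentiable ℂ sinhc :=
  differentiable_dslope_zero Complex.differentiable_sinh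

theorem continuous_sinhc : Continuous sinhc := differentiable_sinhc.continuous

theorem continuous_sinhcc : Continuous sinhcc :=
  (differentiable_dslope_zero (differentiable_dslope_zero differentiable_sinhc)).continuous

theorem mul_sinhc (z : ℂ) : z * sinhc z = Complex.sinh z := by
  have := sub_smul_dslope Complex.sinh 0 z
  simpa [sinhc] using this

theorem sinhc_zero : sinhc 0 = 1 := by
  simp [sinhc, dslope_same]

theorem sinhc_ne_zero {z : ℂ} (h : Complex.sinh z ≠ 0) : sinhc z ≠ 0 := by
  intro h0
  apply h
  rw [← mul_sinhc, h0, mul_zero]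

theorem sinhc_eq (z : ℂ) : sinhc z = 1 + z^2 * sinhcc z := by
  have h1 : ∀ w, w * dslope sinhc 0 w = sinhc w - 1 := by
    intro w
    have := sub_smul_dslope sinhc 0 w
    simpa [sinhc_zero] using this
  have heven : ∀ w, sinhc (-w) = sinhc w := by
    intro w
    rcases eq_or_ne w 0 with rfl | hw
    · simp
    · have h2 := mul_sinhc (-w)
      rw [Complex.sinh_neg, ← mul_sinhc] at h2
      have : w * (sinhc (-w) - sinhc w) = 0 := by linear_combination -h2
      rcases mul_eq_zero.1 this with h | h
      · exact absurd h hw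
      · exact sub_eq_zero.1 h
  have hodd : ∀ w, w ≠ 0 → dslope sinhc 0 w + dslope sinhc 0 (-w) = 0 := by
    intro w hw
    have h2 := h1 w
    have h3 := h1 (-w)
    rw [heven] at h3
    have : w * (dslope sinhc 0 w + dslope sinhc 0 (-w)) = 0 := by linear_combination h2 - h3
    exact (mul_eq_zero.1 this).resolve_left hw
  have hc : Continuous (dslope sinhc 0) := (differentiable_dslope_zero differentiable_sinhc).continuous
  have h0 : dslope sinhc 0 0 = 0 := by
    have hcont : Continuous (fun w => dslope sinhc 0 w + dslope sinhc 0 (-w)) :=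
      hc.add (hc.comp continuous_neg)
    have hall : (fun w => dslope sinhc 0 w + dslope sinhc 0 (-w)) = fun _ => (0:ℂ) := by
      refine Continuous.ext_on (dense_compl_singleton (0:ℂ)) hcont continuous_const ?_
      intro w hw
      exact hodd w hw
    have := congrFun hall 0
    simp only [neg_zero] at this
    linear_combination this / 2
  have h2 : z * sinhcc z = dslope sinhc 0 z := by
    have := sub_smul_dslope (dslope sinhc 0) 0 z
    rw [h0, sub_zero, sub_zero, smul_eq_mul] at this
    exact this
  have h3 := h1 z
  rw [← h2] at h3
  linear_combination -h3

theorem norm_sinh_le (z : ℂ) : ‖Complex.sinh z‖ ≤ Real.exp |z.re| := by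
  rw [Complex.sinh]
  have h1 : ‖Complex.exp z‖ ≤ Real.exp |z.re| := by
    rw [Complex.norm_exp]; exact Real.exp_le_exp.2 (le_abs_self _)
  have h2 : ‖Complex.exp (-z)‖ ≤ Real.exp |z.re| := by
    rw [Complex.norm_exp]; exact Real.exp_le_exp.2 (by simpa using neg_le_abs z.re)
  calc ‖(Complex.exp z - Complex.exp (-z))/2‖ = ‖Complex.exp z - Complex.exp (-z)‖/2 := by
        rw [norm_div]; norm_num
    _ ≤ (Real.exp |z.re| + Real.exp |z.re|)/2 := by
        gcongr
        exact (norm_sub_le _ _).trans (add_le_add h1 h2)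
    _ = _ := by ring

theorem sinh_re_le_norm (z : ℂ) : Real.sinh z.re ≤ ‖Complex.sinh z‖ := by
  rw [Complex.sinh, Real.sinh_eq, norm_div]
  have h1 := norm_sub_norm_le (Complex.exp z) (Complex.exp (-z))
  rw [Complex.norm_exp, Complex.norm_exp, Complex.neg_re] at h1
  norm_num
  linarith

theorem sinh_ne_zero_of_re {z : ℂ} (hz : z.re ≠ 0) : Complex.sinh z ≠ 0 := by
  rcases lt_or_gt_of_ne hz with h | h
  · rw [← neg_ne_zero, ← Complex.sinh_neg]
    have := sinh_re_le_norm (-z)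
    have h2 : 0 < Real.sinh (-z).re := Real.sinh_pos_iff.2 (by simpa using h)
    exact norm_pos_iff.1 (h2.trans_le this)
  · have := sinh_re_le_norm z
    have h2 : 0 < Real.sinh z.re := Real.sinh_pos_iff.2 h
    exact norm_pos_iff.1 (h2.trans_le this)

/-- `sinh` has exponential lower bound away from zero. -/
theorem exp_le_sinh {r t : ℝ} (ht : r ≤ t) :
    (1 - Real.exp (-2*r))/2 * Real.exp t ≤ Real.sinh t := by
  rw [Real.sinh_eq]
  have h1 : Real.exp (-t) ≤ Real.exp (-2*r) * Real.exp t := by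
    rw [← Real.exp_add]; exact Real.exp_le_exp.2 (by linarith)
  linarith

end

section

open Filter Topology

theorem eventually_norm_le_Icc {X : Type*} [TopologicalSpace X] {F : X → ℝ → ℂ} {x₀ : X}
    (h : ∀ y ∈ Icc (0:ℝ) 1, ContinuousAt (fun p : X × ℝ => F p.1 p.2) (x₀, y)) :
    ∃ C, ∀ᶠ x in 𝓝 x₀, ∀ y ∈ Icc (0:ℝ) 1, ‖F x y‖ ≤ C := by
  have hc : ContinuousOn (fun y => ‖F x₀ y‖) (Icc (0:ℝ) 1) := by
    intro y hy
    have h1 : ContinuousAt (fun y : ℝ => (x₀, y)) y := by fun_prop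
    have := ContinuousAt.comp (f := fun y : ℝ => (x₀, y)) (x := y) (h y hy) h1
    exact this.norm.continuousWithinAt
  obtain ⟨C, hC⟩ := (isCompact_Icc.image_of_continuousOn hc).bddAbove
  refine ⟨C + 1, isCompact_Icc.eventually_forall_of_forall_eventually fun y hy => ?_⟩
  have h2 : ‖F x₀ y‖ < C + 1 := by
    have := hC (mem_image_of_mem _ hy)
    linarith
  exact ((h y hy).norm.eventually_lt_const h2).mono fun p hp => hp.le

/-- The regularised integrand in the exponent of the hyperbolic gamma function. -/
def gammaKer (op om b : ℂ) (y : ℝ) : ℂ :=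
  (1/(y:ℂ)) * (Complex.sinh (2*y*b) / (Complex.sinh (op*y) * Complex.sinh (om*y))
    - 2*b/(op*om) / Complex.sinh y)

/-- The kernel controlling the odd part in products of two hyperbolic gamma functions. -/
def gammaKerDiff (op om b₁ b₂ : ℂ) (y : ℝ) : ℂ :=
  (Complex.cosh (2*y*b₁) - Complex.cosh (2*y*b₂)) / (Complex.sinh (op*y) * Complex.sinh (om*y))

theorem sinh_mul_ne_zero {a : ℂ} (ha : 0 < a.re) {y : ℝ} (hy : 0 < y) :
    Complex.sinh (a*y) ≠ 0 := by
  apply sinh_ne_zero_of_re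
  rw [Complex.re_mul_ofReal]
  positivity

theorem sinhc_mul_ne_zero {a : ℂ} (ha : 0 < a.re) (y : ℝ) : sinhc (a*y) ≠ 0 := by
  rcases eq_or_ne y 0 with rfl | hy
  · simp [sinhc_zero]
  · apply sinhc_ne_zero
    apply sinh_ne_zero_of_re
    rw [Complex.re_mul_ofReal]
    exact mul_ne_zero ha.ne' hy

theorem ne_zero_of_re_pos' {a : ℂ} (ha : 0 < a.re) : a ≠ 0 := by
  rintro rfl; simp at ha

theorem gammaKer_eq {op om b : ℂ} (hop : 0 < op.re) (hom : 0 < om.re) {y : ℝ} (hy : 0 < y) :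
    gammaKer op om b y = 2*b/(op*om) *
      (4*b^2*sinhcc (2*y*b) + sinhcc y + 4*b^2*y^2*sinhcc (2*y*b)*sinhcc y
        - op^2*sinhcc (op*y) - om^2*sinhcc (om*y)
        - op^2*om^2*y^2*sinhcc (op*y)*sinhcc (om*y))
      / (sinhc (op*y) * sinhc (om*y) * sinhc y) := by
  have h1 := sinhc_mul_ne_zero hop y
  have h2 := sinhc_mul_ne_zero hom y
  have h3 := sinhc_mul_ne_zero (a := 1) (by simp) y
  rw [one_mul] at h3
  have hop' := ne_zero_of_re_pos' hop
  have hom' := ne_zero_of_re_pos' hom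
  have hy' : (y:ℂ) ≠ 0 := by exact_mod_cast hy.ne'
  rw [gammaKer, ← mul_sinhc (2*y*b), ← mul_sinhc (op*y), ← mul_sinhc (om*y), ← mul_sinhc (y:ℂ)]
  have e1 := sinhc_eq (2*y*b)
  have e2 := sinhc_eq (op*y)
  have e3 := sinhc_eq (om*y)
  have e4 := sinhc_eq y
  have key : sinhc (2*y*b) * sinhc y - sinhc (op*y) * sinhc (om*y) = y^2 *
      (4*b^2*sinhcc (2*y*b) + sinhcc y + 4*b^2*y^2*sinhcc (2*y*b)*sinhcc y
        - op^2*sinhcc (op*y) - om^2*sinhcc (om*y)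
        - op^2*om^2*y^2*sinhcc (op*y)*sinhcc (om*y)) := by
    rw [e1, e2, e3, e4]; ring
  generalize (4*b^2*sinhcc (2*y*b) + sinhcc y + 4*b^2*y^2*sinhcc (2*y*b)*sinhcc y
        - op^2*sinhcc (op*y) - om^2*sinhcc (om*y)
        - op^2*om^2*y^2*sinhcc (op*y)*sinhcc (om*y)) = N at *
  generalize sinhc (op*y) = s1 at *
  generalize sinhc (om*y) = s2 at *
  generalize sinhc (2*y*b) = s0 at *
  generalize sinhc (y:ℂ) = s3 at *
  field_simp
  linear_combination b * key

theorem gammaKerDiff_eq {op om b₁ b₂ : ℂ} (hop : 0 < op.re) (hom : 0 < om.re) {y : ℝ}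
    (hy : 0 < y) :
    gammaKerDiff op om b₁ b₂ y = 2*(b₁+b₂)*(b₁-b₂)/(op*om) *
      (sinhc (y*(b₁+b₂)) * sinhc (y*(b₁-b₂))) / (sinhc (op*y) * sinhc (om*y)) := by
  have h1 := sinhc_mul_ne_zero hop y
  have h2 := sinhc_mul_ne_zero hom y
  have hop' := ne_zero_of_re_pos' hop
  have hom' := ne_zero_of_re_pos' hom
  have hy' : (y:ℂ) ≠ 0 := by exact_mod_cast hy.ne'
  have e : Complex.cosh (2*y*b₁) - Complex.cosh (2*y*b₂) =
      2 * Complex.sinh (y*(b₁+b₂)) * Complex.sinh (y*(b₁-b₂)) := by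
    have a1 : (2:ℂ)*y*b₁ = y*(b₁+b₂) + y*(b₁-b₂) := by ring
    have a2 : (2:ℂ)*y*b₂ = y*(b₁+b₂) - y*(b₁-b₂) := by ring
    rw [a1, a2, Complex.cosh_add, Complex.cosh_sub]; ring
  rw [gammaKerDiff, e, ← mul_sinhc (y*(b₁+b₂)), ← mul_sinhc (y*(b₁-b₂)), ← mul_sinhc (op*y),
    ← mul_sinhc (om*y)]
  field_simp

/-- Local uniform bounds for parameters in the strip. -/
theorem eventually_params {op₀ om b₀ : ℂ} (hop : 0 < op₀.re) (hom : 0 < om.re)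
    (hb : |b₀.re| < (op₀.re + om.re)/2) :
    ∃ r M : ℝ, 0 < r ∧ r ≤ 1 ∧ r ≤ om.re ∧ ∀ᶠ p in 𝓝 (op₀, b₀), r ≤ p.1.re ∧
      2*|p.2.re| ≤ p.1.re + om.re - r ∧ ‖2*p.2/(p.1*om)‖ ≤ M := by
  set r := min (min (op₀.re/2) om.re) (min 1 ((op₀.re + om.re) /2 - |b₀.re|)) with hr
  have hr0 : 0 < r := by
    simp only [hr, lt_min_iff]; refine ⟨⟨by linarith, hom⟩, by norm_num, by linarith⟩
  have h1 : r ≤ op₀.re/2 := (min_le_left _ _).trans (min_le_left _ _)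
  have h4 : r ≤ (op₀.re + om.re) /2 - |b₀.re| := (min_le_right _ _).trans (min_le_right _ _)
  refine ⟨r, ‖2*b₀/(op₀*om)‖ + 1, hr0, (min_le_right _ _).trans (min_le_left _ _),
    (min_le_left _ _).trans (min_le_right _ _), ?_⟩
  refine Filter.Eventually.and ?_ (Filter.Eventually.and ?_ ?_)
  · have : ContinuousAt (fun p : ℂ × ℂ => p.1.re) (op₀, b₀) := by fun_prop
    exact (this.eventually_const_lt (show r < op₀.re by linarith)).mono fun p hp => hp.le
  · have : ContinuousAt (fun p : ℂ × ℂ => p.1.re + om.re - r - 2*|p.2.re|) (op₀, b₀) := by fun_prop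
    refine (this.eventually_const_lt (u := 0) ?_).mono fun p hp => ?_
    · simp only; linarith
    · linarith
  · have : ContinuousAt (fun p : ℂ × ℂ => ‖2*p.2/(p.1*om)‖) (op₀, b₀) := by
      have : op₀ * om ≠ 0 := mul_ne_zero (ne_zero_of_re_pos' hop) (ne_zero_of_re_pos' hom)
      fun_prop (disch := simpa)
    exact (this.eventually_lt_const (u := ‖2*b₀/(op₀*om)‖ + 1) (by simp)).mono fun p hp => hp.le

theorem sinh_mul_lower {r : ℝ} {a : ℂ} (hr : 0 < r) (ha : r ≤ a.re) {y : ℝ} (hy : 1 ≤ y) :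
    (1 - Real.exp (-2*r))/2 * Real.exp (a.re*y) ≤ ‖Complex.sinh (a*y)‖ := by
  refine le_trans (exp_le_sinh (r := r) ?_) ?_
  · nlinarith
  · have := sinh_re_le_norm (a*y)
    rwa [Complex.re_mul_ofReal] at this

theorem one_sub_exp_pos {r : ℝ} (hr : 0 < r) : 0 < (1 - Real.exp (-2*r))/2 := by
  have : Real.exp (-2*r) < 1 := by rw [Real.exp_lt_one_iff]; linarith
  linarith

theorem gammaKer_bound {op₀ om b₀ : ℂ} (hop : 0 < op₀.re) (hom : 0 < om.re)
    (hb : |b₀.re| < (op₀.re + om.re)/2) :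
    ∃ C r : ℝ, 0 < r ∧ ∀ᶠ p in 𝓝 (op₀, b₀), ∀ y : ℝ, 0 < y →
      ‖gammaKer p.1 om p.2 y‖ ≤ C * Real.exp (-r*y) := by
  obtain ⟨r, M, hr, hr1, hrm, hev⟩ := eventually_params hop hom hb
  set c := (1 - Real.exp (-2*r))/2 with hc
  have hc0 : 0 < c := one_sub_exp_pos hr
  obtain ⟨C₀, hC₀⟩ := eventually_norm_le_Icc (x₀ := (op₀, b₀)) (F := fun p : ℂ × ℂ => fun y : ℝ =>
    2*p.2/(p.1*om) *
      (4*p.2^2*sinhcc (2*y*p.2) + sinhcc y + 4*p.2^2*y^2*sinhcc (2*y*p.2)*sinhcc y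
        - p.1^2*sinhcc (p.1*y) - om^2*sinhcc (om*y)
        - p.1^2*om^2*y^2*sinhcc (p.1*y)*sinhcc (om*y))
      / (sinhc (p.1*y) * sinhc (om*y) * sinhc y)) (by
    intro y _
    have h1 := sinhc_mul_ne_zero hop y
    have h2 := sinhc_mul_ne_zero hom y
    have h3 := sinhc_mul_ne_zero (a := 1) (by simp) y
    rw [one_mul] at h3
    have hPne : op₀ * om ≠ 0 := mul_ne_zero (ne_zero_of_re_pos' hop) (ne_zero_of_re_pos' hom)
    have h4 := continuous_sinhc
    have h5 := continuous_sinhcc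
    refine ContinuousAt.div ?_ ?_ ?_
    · refine ContinuousAt.mul ?_ ?_
      · refine ContinuousAt.div (by fun_prop) (by fun_prop) (by simpa using hPne)
      · fun_prop
    · fun_prop
    · exact mul_ne_zero (mul_ne_zero h1 h2) h3)
  have hopev : ∀ᶠ p : ℂ × ℂ in 𝓝 (op₀, b₀), 0 < p.1.re := by
    have : ContinuousAt (fun p : ℂ × ℂ => p.1.re) (op₀, b₀) := by fun_prop
    exact this.eventually_const_lt hop
  have hC₀0 : 0 ≤ C₀ := by
    obtain ⟨p, hp⟩ := hC₀.exists
    exact (norm_nonneg _).trans (hp 0 (by simp))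
  have hM0 : 0 ≤ M := by
    obtain ⟨p, hp⟩ := hev.exists
    exact (norm_nonneg _).trans hp.2.2
  refine ⟨C₀ * Real.exp r + (1/(c*c) + M/c), r, hr, ?_⟩
  filter_upwards [hev, hC₀, hopev] with p hp hpC hp1 y hy
  rcases le_total y 1 with hy1 | hy1
  · rw [gammaKer_eq hp1 hom hy]
    refine (hpC y ⟨hy.le, hy1⟩).trans ?_
    have h1 : 1 ≤ Real.exp r * Real.exp (-r*y) := by
      rw [← Real.exp_add]; apply Real.one_le_exp; nlinarith
    have h2 : 0 ≤ (1/(c*c) + M/c) * Real.exp (-r*y) := by positivity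
    nlinarith [mul_le_mul_of_nonneg_left h1 hC₀0]
  · have hyc : ‖(1/(y:ℂ))‖ ≤ 1 := by
      rw [norm_div, norm_one, Complex.norm_real, Real.norm_eq_abs, abs_of_pos hy]
      exact div_le_one_of_le₀ hy1 hy.le
    have s1 := sinh_mul_lower hr hp.1 hy1
    have s2 := sinh_mul_lower hr hrm hy1
    have s3 := sinh_mul_lower (a := 1) hr (by simpa using hr1) hy1
    rw [one_mul, Complex.one_re, one_mul] at s3
    have t1 : ‖Complex.sinh (2*y*p.2) / (Complex.sinh (p.1*y) * Complex.sinh (om*y))‖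
        ≤ 1/(c*c) * Real.exp (-r*y) := by
      rw [norm_div, norm_mul]
      have : ‖Complex.sinh (2*y*p.2)‖ ≤ Real.exp (2 * |p.2.re| * y) := by
        refine (norm_sinh_le _).trans (le_of_eq ?_)
        have : (2*(y:ℂ)*p.2).re = 2*y*p.2.re := by
          have : 2*(y:ℂ)*p.2 = ((2*y:ℝ):ℂ) * p.2 := by push_cast; ring
          rw [this, Complex.re_ofReal_mul]
        rw [this, abs_mul, abs_of_pos (by positivity)]; congr 1; ring
      rw [div_le_iff₀ (lt_of_lt_of_le (by positivity) (mul_le_mul s1 s2 (by positivity) (norm_nonneg _)))]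
      calc ‖Complex.sinh (2*y*p.2)‖ ≤ Real.exp (2 * |p.2.re| * y) := this
        _ ≤ Real.exp (-r*y) * (Real.exp (p.1.re*y) * Real.exp (om.re*y)) := by
          rw [← Real.exp_add, ← Real.exp_add]
          apply Real.exp_le_exp.2
          nlinarith [hp.2.1]
        _ = 1/(c*c) * Real.exp (-r*y) * ((c * Real.exp (p.1.re*y)) * (c * Real.exp (om.re*y))) := by
          field_simp
        _ ≤ _ := by
          gcongr
    have t2 : ‖2*p.2/(p.1*om) / Complex.sinh y‖ ≤ M/c * Real.exp (-r*y) := by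
      rw [norm_div, div_le_iff₀ (lt_of_lt_of_le (by positivity) s3)]
      calc ‖2*p.2/(p.1*om)‖ ≤ M := hp.2.2
        _ ≤ M * (Real.exp (-r*y) * Real.exp y) := by
          refine le_mul_of_one_le_right hM0 ?_
          rw [← Real.exp_add]; apply Real.one_le_exp; nlinarith
        _ = M/c * Real.exp (-r*y) * (c * Real.exp y) := by field_simp
        _ ≤ _ := by gcongr
    rw [gammaKer, norm_mul]
    have t3 := (norm_sub_le (Complex.sinh (2*y*p.2) / (Complex.sinh (p.1*y) * Complex.sinh (om*y)))
      (2*p.2/(p.1*om) / Complex.sinh y)).trans (add_le_add t1 t2)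
    calc _ ≤ 1 * (1/(c*c) * Real.exp (-r*y) + M/c * Real.exp (-r*y)) :=
          mul_le_mul hyc t3 (norm_nonneg _) zero_le_one
      _ = (1/(c*c) + M/c) * Real.exp (-r*y) := by ring
      _ ≤ _ := by
        have : 0 ≤ C₀ * Real.exp r := by positivity
        exact mul_le_mul_of_nonneg_right (by linarith) (Real.exp_pos _).le

theorem norm_cosh_le (z : ℂ) : ‖Complex.cosh z‖ ≤ Real.exp |z.re| := by
  rw [Complex.cosh]
  have h1 : ‖Complex.exp z‖ ≤ Real.exp |z.re| := by
    rw [Complex.norm_exp]; exact Real.exp_le_exp.2 (le_abs_self _)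
  have h2 : ‖Complex.exp (-z)‖ ≤ Real.exp |z.re| := by
    rw [Complex.norm_exp]; exact Real.exp_le_exp.2 (by simpa using neg_le_abs z.re)
  calc ‖(Complex.exp z + Complex.exp (-z))/2‖ = ‖Complex.exp z + Complex.exp (-z)‖/2 := by
        rw [norm_div]; norm_num
    _ ≤ (Real.exp |z.re| + Real.exp |z.re|)/2 := by
        gcongr
        exact (norm_add_le _ _).trans (add_le_add h1 h2)
    _ = _ := by ring

theorem gammaKerDiff_bound {op₀ om b₁ b₂ : ℂ} (hop : 0 < op₀.re) (hom : 0 < om.re)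
    (hb₁ : |b₁.re| < (op₀.re + om.re)/2) (hb₂ : |b₂.re| < (op₀.re + om.re)/2) :
    ∃ C r : ℝ, 0 < r ∧ ∀ᶠ p in 𝓝 (op₀, b₁, b₂), ∀ y : ℝ, 0 < y →
      ‖gammaKerDiff p.1 om p.2.1 p.2.2 y‖ ≤ C * Real.exp (-r*y) := by
  obtain ⟨r₁, M₁, hr₁, hr11, hrm₁, hev₁⟩ := eventually_params hop hom hb₁
  obtain ⟨r₂, M₂, hr₂, hr12, hrm₂, hev₂⟩ := eventually_params hop hom hb₂
  set r := min r₁ r₂ with hrdef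
  have hr : 0 < r := lt_min hr₁ hr₂
  have hr1 : r ≤ 1 := (min_le_left _ _).trans hr11
  have hrm : r ≤ om.re := (min_le_left _ _).trans hrm₁
  have hev₁' : ∀ᶠ p : ℂ × ℂ × ℂ in 𝓝 (op₀, b₁, b₂), _ :=
    (show ContinuousAt (fun p : ℂ × ℂ × ℂ => (p.1, p.2.1)) (op₀, b₁, b₂) by fun_prop).eventually hev₁
  have hev₂' : ∀ᶠ p : ℂ × ℂ × ℂ in 𝓝 (op₀, b₁, b₂), _ :=
    (show ContinuousAt (fun p : ℂ × ℂ × ℂ => (p.1, p.2.2)) (op₀, b₁, b₂) by fun_prop).eventually hev₂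
  set c := (1 - Real.exp (-2*r))/2 with hc
  have hc0 : 0 < c := one_sub_exp_pos hr
  obtain ⟨C₀, hC₀⟩ := eventually_norm_le_Icc (x₀ := (op₀, b₁, b₂))
    (F := fun p : ℂ × ℂ × ℂ => fun y : ℝ => 2*(p.2.1+p.2.2)*(p.2.1-p.2.2)/(p.1*om) *
      (sinhc (y*(p.2.1+p.2.2)) * sinhc (y*(p.2.1-p.2.2))) / (sinhc (p.1*y) * sinhc (om*y))) (by
    intro y _
    have h1 := sinhc_mul_ne_zero hop y
    have h2 := sinhc_mul_ne_zero hom y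
    have hPne : op₀ * om ≠ 0 := mul_ne_zero (ne_zero_of_re_pos' hop) (ne_zero_of_re_pos' hom)
    have h4 := continuous_sinhc
    refine ContinuousAt.div ?_ ?_ ?_
    · refine ContinuousAt.mul ?_ ?_
      · refine ContinuousAt.div (by fun_prop) (by fun_prop) (by simpa using hPne)
      · fun_prop
    · fun_prop
    · exact mul_ne_zero h1 h2)
  have hopev : ∀ᶠ p : ℂ × ℂ × ℂ in 𝓝 (op₀, b₁, b₂), 0 < p.1.re := by
    have : ContinuousAt (fun p : ℂ × ℂ × ℂ => p.1.re) (op₀, b₁, b₂) := by fun_prop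
    exact this.eventually_const_lt hop
  have hC₀0 : 0 ≤ C₀ := by
    obtain ⟨p, hp⟩ := hC₀.exists
    exact (norm_nonneg _).trans (hp 0 (by simp))
  refine ⟨C₀ * Real.exp r + 2/(c*c), r, hr, ?_⟩
  filter_upwards [hev₁', hev₂', hC₀, hopev] with p hp hp' hpC hp1 y hy
  rcases le_total y 1 with hy1 | hy1
  · rw [gammaKerDiff_eq hp1 hom hy]
    refine (hpC y ⟨hy.le, hy1⟩).trans ?_
    have h1 : 1 ≤ Real.exp r * Real.exp (-r*y) := by
      rw [← Real.exp_add]; apply Real.one_le_exp; nlinarith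
    have h2 : 0 ≤ (2/(c*c)) * Real.exp (-r*y) := by positivity
    nlinarith [mul_le_mul_of_nonneg_left h1 hC₀0]
  · have s1 := sinh_mul_lower hr ((min_le_left _ _).trans hp.1) hy1
    have s2 := sinh_mul_lower hr hrm hy1
    have hcosh : ∀ b : ℂ, 2*|b.re| ≤ p.1.re + om.re - r →
        ‖Complex.cosh (2*y*b)‖ ≤ Real.exp (-r*y) * (Real.exp (p.1.re*y) * Real.exp (om.re*y)) := by
      intro b hb
      refine (norm_cosh_le _).trans ?_
      have : (2*(y:ℂ)*b).re = 2*y*b.re := by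
        have : 2*(y:ℂ)*b = ((2*y:ℝ):ℂ) * b := by push_cast; ring
        rw [this, Complex.re_ofReal_mul]
      rw [this, abs_mul, abs_of_pos (by positivity), ← Real.exp_add, ← Real.exp_add]
      apply Real.exp_le_exp.2
      nlinarith
    have hrr1 : r ≤ r₁ := min_le_left _ _
    have hrr2 : r ≤ r₂ := min_le_right _ _
    have c1 := hcosh p.2.1 (by have := hp.2.1; linarith)
    have c2 := hcosh p.2.2 (by have := hp'.2.1; linarith)
    rw [gammaKerDiff, norm_div, norm_mul, div_le_iff₀ (lt_of_lt_of_le (by positivity)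
      (mul_le_mul s1 s2 (by positivity) (norm_nonneg _)))]
    calc _ ≤ _ := (norm_sub_le _ _).trans (add_le_add c1 c2)
      _ = 2/(c*c) * Real.exp (-r*y) * ((c * Real.exp (p.1.re*y)) * (c * Real.exp (om.re*y))) := by
          field_simp; ring
      _ ≤ (C₀ * Real.exp r + 2/(c*c)) * Real.exp (-r*y) *
          (‖Complex.sinh (p.1*y)‖ * ‖Complex.sinh (om*y)‖) := by
        have : 0 ≤ C₀ * Real.exp r := by positivity
        gcongr
        linarith

end

section

open Filter Topology

/-- The constant splitting off the non-decaying part of the gamma exponent. -/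
def gammaConst : ℂ := ∫ y in Ioi (0:ℝ), (1/(y:ℂ)) * (1/Complex.sinh y - 1/(y:ℂ))

/-- The exponent of the hyperbolic gamma function in the strip. -/
def gammaExp (op om b : ℂ) : ℂ :=
  (1/2) * (∫ y in Ioi (0:ℝ), gammaKer op om b y) + b/(op*om) * gammaConst

theorem measurable_gammaKer (op om b : ℂ) : Measurable (gammaKer op om b) := by
  unfold gammaKer; fun_prop

theorem measurable_gammaKerDiff (op om b₁ b₂ : ℂ) : Measurable (gammaKerDiff op om b₁ b₂) := by
  unfold gammaKerDiff; fun_prop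

theorem integrableOn_exp_neg_mul {r : ℝ} (hr : 0 < r) (C : ℝ) :
    IntegrableOn (fun y : ℝ => C * Real.exp (-r*y)) (Ioi 0) :=
  (integrableOn_exp_mul_Ioi (by linarith) 0).const_mul C

theorem integrableOn_gammaKer {op om b : ℂ} (hop : 0 < op.re) (hom : 0 < om.re)
    (hb : |b.re| < (op.re + om.re)/2) : IntegrableOn (gammaKer op om b) (Ioi 0) := by
  obtain ⟨C, r, hr, h⟩ := gammaKer_bound hop hom hb
  refine Integrable.mono' (integrableOn_exp_neg_mul hr C)
    (measurable_gammaKer op om b).aestronglyMeasurable ?_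
  filter_upwards [ae_restrict_mem measurableSet_Ioi] with y hy
  exact h.self_of_nhds y hy

theorem integrableOn_gammaConst :
    IntegrableOn (fun y : ℝ => (1/(y:ℂ)) * (1/Complex.sinh y - 1/(y:ℂ))) (Ioi 0) := by
  obtain ⟨C, hC⟩ := eventually_norm_le_Icc (x₀ := ()) (F := fun _ : Unit => fun y : ℝ =>
    -sinhcc y / sinhc y) (by
      intro y _
      have h3 := sinhc_mul_ne_zero (a := 1) (by simp) y
      rw [one_mul] at h3
      have h4 := continuous_sinhc
      have h5 := continuous_sinhcc
      exact ContinuousAt.div (by fun_prop) (by fun_prop) h3)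
  have hC' := hC.self_of_nhds
  have hC0 : 0 ≤ C := (norm_nonneg _).trans (hC' 0 (by simp))
  refine Integrable.mono' (g := fun y : ℝ => (2*C+2) * (1+y^2)⁻¹)
    (integrable_inv_one_add_sq.const_mul _).integrableOn ?_ ?_
  · exact Measurable.aestronglyMeasurable (by fun_prop)
  · filter_upwards [ae_restrict_mem measurableSet_Ioi] with y hy
    have hy : 0 < y := hy
    rcases le_total y 1 with hy1 | hy1
    · have h3 := sinhc_mul_ne_zero (a := 1) (by simp) y
      rw [one_mul] at h3
      have hy' : (y:ℂ) ≠ 0 := by exact_mod_cast hy.ne'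
      have e : (1/(y:ℂ)) * (1/Complex.sinh y - 1/(y:ℂ)) = -sinhcc y / sinhc y := by
        rw [← mul_sinhc]
        field_simp
        rw [sinhc_eq]; ring
      rw [e]
      refine (hC' y ⟨hy.le, hy1⟩).trans ?_
      rw [← div_eq_mul_inv, le_div_iff₀ (by positivity)]
      nlinarith [mul_le_mul_of_nonneg_left (show y^2 ≤ 1 by nlinarith) hC0]
    · have hs : y ≤ Real.sinh y := Real.self_le_sinh_iff.2 hy.le
      have hs0 : 0 < Real.sinh y := hy.trans_le hs
      have e : (1/(y:ℂ)) * (1/Complex.sinh y - 1/(y:ℂ)) =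
          (((1/y) * (1/Real.sinh y - 1/y) : ℝ) : ℂ) := by push_cast; ring
      have h1 : 1/Real.sinh y ≤ 1/y := one_div_le_one_div_of_le hy hs
      have h2 : 0 < 1/Real.sinh y := by positivity
      rw [e, Complex.norm_real, Real.norm_eq_abs, abs_mul, abs_of_pos (by positivity : 0 < 1/y),
        abs_of_nonpos (by linarith)]
      calc (1/y) * -(1/Real.sinh y - 1/y) ≤ (1/y) * (1/y) := by
            apply mul_le_mul_of_nonneg_left _ (by positivity); linarith
        _ ≤ (2*C+2) * (1+y^2)⁻¹ := by
          rw [← div_eq_mul_inv, div_mul_div_comm, div_le_div_iff₀ (by positivity) (by positivity)]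
          nlinarith [mul_nonneg hC0 (sq_nonneg y)]

theorem gammaExp_eq {op om b : ℂ} (hop : 0 < op.re) (hom : 0 < om.re)
    (hb : |b.re| < (op.re + om.re)/2) :
    hypGammaInt op om (-Complex.I*b) = Complex.exp (gammaExp op om b) := by
  unfold hypGammaInt gammaExp gammaConst
  congr 1
  rw [← integral_const_mul, ← integral_const_mul, ← integral_const_mul, ← integral_add
    ((integrableOn_gammaKer hop hom hb).const_mul (1/2))
    (integrableOn_gammaConst.const_mul (b/(op*om)))]
  refine setIntegral_congr_fun measurableSet_Ioi fun y hy => ?_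
  have hy : 0 < y := hy
  have h1 := sinh_mul_ne_zero hop hy
  have h2 := sinh_mul_ne_zero hom hy
  have h3 := sinh_mul_ne_zero (a := 1) (by simp) hy
  rw [one_mul] at h3
  have hop' := ne_zero_of_re_pos' hop
  have hom' := ne_zero_of_re_pos' hom
  have hy' : (y:ℂ) ≠ 0 := by exact_mod_cast hy.ne'
  have e : Complex.sin (2*(y:ℂ)*(-Complex.I*b)) = -Complex.I * Complex.sinh (2*y*b) := by
    have : 2*(y:ℂ)*(-Complex.I*b) = -((2*y*b)*Complex.I) := by ring
    rw [this, Complex.sin_neg, Complex.sin_mul_I]; ring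
  simp only [gammaKer]
  rw [e]
  field_simp
  ring_nf
  rw [Complex.I_sq]
  ring

theorem gammaKer_neg (op om b : ℂ) (y : ℝ) : gammaKer op om (-b) y = -gammaKer op om b y := by
  unfold gammaKer
  rw [mul_neg, Complex.sinh_neg]; ring

theorem gammaExp_neg (op om b : ℂ) : gammaExp op om (-b) = -gammaExp op om b := by
  unfold gammaExp
  simp_rw [gammaKer_neg]
  rw [integral_neg]; ring

/-- The universal even exponent; equal to `-log (2 cosh (π x))`. -/
def gammaPsi (x : ℝ) : ℂ :=
  gammaConst + ∫ y in Ioi (0:ℝ), (Complex.cos (2*y*x) - 1)/(y*Complex.sinh y)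

theorem gammaKer_pair {op om : ℂ} (b₁ b₂ : ℂ) (x : ℝ) (y : ℝ) :
    gammaKer op om (b₁ + Complex.I*x) y + gammaKer op om (b₂ - Complex.I*x) y =
      Complex.cos (2*y*x) * (gammaKer op om b₁ y + gammaKer op om b₂ y)
      + 2*(b₁+b₂)/(op*om) * ((Complex.cos (2*y*x) - 1)/(y*Complex.sinh y))
      + Complex.I * (Complex.sin (2*y*x) / y * gammaKerDiff op om b₁ b₂ y) := by
  have e1 : Complex.sinh (2*y*(b₁+Complex.I*x)) = Complex.sinh (2*y*b₁) * Complex.cos (2*y*x)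
      + Complex.I * Complex.cosh (2*y*b₁) * Complex.sin (2*y*x) := by
    have : 2*(y:ℂ)*(b₁+Complex.I*x) = 2*y*b₁ + (2*y*x)*Complex.I := by ring
    rw [this, Complex.sinh_add, Complex.cosh_mul_I, Complex.sinh_mul_I]; ring
  have e2 : Complex.sinh (2*y*(b₂-Complex.I*x)) = Complex.sinh (2*y*b₂) * Complex.cos (2*y*x)
      - Complex.I * Complex.cosh (2*y*b₂) * Complex.sin (2*y*x) := by
    have : 2*(y:ℂ)*(b₂-Complex.I*x) = 2*y*b₂ - (2*y*x)*Complex.I := by ring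
    rw [this, Complex.sinh_sub, Complex.cosh_mul_I, Complex.sinh_mul_I]; ring
  unfold gammaKer gammaKerDiff
  rw [e1, e2]
  ring

theorem gammaKer_half (y : ℝ) : gammaKer 1 1 (1/2) y = 0 := by
  unfold gammaKer
  have : 2*(y:ℂ)*(1/2) = y := by ring
  rw [this, one_mul]
  rcases eq_or_ne (Complex.sinh y) 0 with h | h
  · simp [h]
  · field_simp; ring

theorem integrableOn_cos_sub_one (x : ℝ) :
    IntegrableOn (fun y : ℝ => (Complex.cos (2*y*x) - 1)/(y*Complex.sinh y)) (Ioi 0) := by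
  have h1 : IntegrableOn (gammaKer 1 1 (1/2 + Complex.I*x)) (Ioi 0) :=
    integrableOn_gammaKer (by simp) (by simp) (by norm_num)
  have h2 : IntegrableOn (gammaKer 1 1 (1/2 - Complex.I*x)) (Ioi 0) :=
    integrableOn_gammaKer (by simp) (by simp) (by norm_num)
  refine ((h1.add h2).const_mul (1/2)).congr (Eventually.of_forall fun y => ?_)
  have := gammaKer_pair (op := 1) (om := 1) (1/2) (1/2) x y
  simp only [Pi.add_apply]
  rw [this, gammaKer_half]
  simp only [gammaKerDiff, sub_self, zero_div, mul_zero, add_zero]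
  ring

theorem abs_sin_div_le (x : ℝ) {y : ℝ} (hy : 0 < y) :
    ‖Complex.sin (2*y*x) / y‖ ≤ min (2 * |x|) (1/y) := by
  have e : Complex.sin (2*y*x) / y = ((Real.sin (2*y*x) / y : ℝ) : ℂ) := by push_cast; rfl
  rw [e, Complex.norm_real, Real.norm_eq_abs, abs_div, abs_of_pos hy, le_min_iff]
  constructor
  · rw [div_le_iff₀ hy]
    calc |Real.sin (2*y*x)| ≤ |2*y*x| := Real.abs_sin_le_abs
      _ = 2 * |x| * y := by rw [abs_mul, abs_of_pos (by positivity)]; ring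
  · exact div_le_div_of_nonneg_right (Real.abs_sin_le_one _) hy.le

theorem integrableOn_sin_mul {op om b₁ b₂ : ℂ} (hop : 0 < op.re) (hom : 0 < om.re)
    (hb₁ : |b₁.re| < (op.re + om.re)/2) (hb₂ : |b₂.re| < (op.re + om.re)/2) (x : ℝ) :
    IntegrableOn (fun y : ℝ => Complex.sin (2*y*x) / y * gammaKerDiff op om b₁ b₂ y) (Ioi 0) := by
  obtain ⟨C, r, hr, h⟩ := gammaKerDiff_bound hop hom hb₁ hb₂
  have h := h.self_of_nhds
  refine Integrable.mono' (integrableOn_exp_neg_mul hr (2 * |x| * C)) ?_ ?_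
  · exact Measurable.aestronglyMeasurable (by have := measurable_gammaKerDiff op om b₁ b₂; fun_prop)
  · filter_upwards [ae_restrict_mem measurableSet_Ioi] with y hy
    rw [norm_mul, mul_assoc (2 * |x|) C]
    exact mul_le_mul ((abs_sin_div_le x hy).trans (min_le_left _ _)) (h y hy) (norm_nonneg _)
      (by positivity)

theorem integrableOn_cos_mul {op om b₁ b₂ : ℂ} (hop : 0 < op.re) (hom : 0 < om.re)
    (hb₁ : |b₁.re| < (op.re + om.re)/2) (hb₂ : |b₂.re| < (op.re + om.re)/2) (x : ℝ) :
    IntegrableOn (fun y : ℝ => Complex.cos (2*y*x) * (gammaKer op om b₁ y + gammaKer op om b₂ y))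
      (Ioi 0) := by
  refine Integrable.bdd_mul (c := 1)
    ((integrableOn_gammaKer hop hom hb₁).add (integrableOn_gammaKer hop hom hb₂)) ?_ ?_
  · exact Measurable.aestronglyMeasurable (by fun_prop)
  · refine Eventually.of_forall fun y => ?_
    have e : Complex.cos (2*y*x) = ((Real.cos (2*y*x) : ℝ) : ℂ) := by push_cast; rfl
    rw [e, Complex.norm_real, Real.norm_eq_abs]
    exact Real.abs_cos_le_one _

theorem gammaExp_pair {op om b₁ b₂ : ℂ} (hop : 0 < op.re) (hom : 0 < om.re)
    (hb₁ : |b₁.re| < (op.re + om.re)/2) (hb₂ : |b₂.re| < (op.re + om.re)/2) (x : ℝ) :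
    gammaExp op om (b₁ + Complex.I*x) + gammaExp op om (b₂ - Complex.I*x) =
      (1/2) * (∫ y in Ioi (0:ℝ), Complex.cos (2*y*x) * (gammaKer op om b₁ y + gammaKer op om b₂ y))
      + (b₁+b₂)/(op*om) * gammaPsi x
      + Complex.I/2 * ∫ y in Ioi (0:ℝ), Complex.sin (2*y*x) / y * gammaKerDiff op om b₁ b₂ y := by
  have h1 : IntegrableOn (gammaKer op om (b₁ + Complex.I*x)) (Ioi 0) :=
    integrableOn_gammaKer hop hom (by simpa using hb₁)
  have h2 : IntegrableOn (gammaKer op om (b₂ - Complex.I*x)) (Ioi 0) :=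
    integrableOn_gammaKer hop hom (by simpa using hb₂)
  have key : (∫ y in Ioi (0:ℝ), gammaKer op om (b₁ + Complex.I*x) y)
      + ∫ y in Ioi (0:ℝ), gammaKer op om (b₂ - Complex.I*x) y =
      (∫ y in Ioi (0:ℝ), Complex.cos (2*y*x) * (gammaKer op om b₁ y + gammaKer op om b₂ y))
      + 2*(b₁+b₂)/(op*om) * (∫ y in Ioi (0:ℝ), (Complex.cos (2*y*x) - 1)/(y*Complex.sinh y))
      + Complex.I * ∫ y in Ioi (0:ℝ), Complex.sin (2*y*x) / y * gammaKerDiff op om b₁ b₂ y := by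
    have i1 := integrableOn_cos_mul hop hom hb₁ hb₂ x
    have i2 := (integrableOn_cos_sub_one x).const_mul (2*(b₁+b₂)/(op*om))
    have i3 := (integrableOn_sin_mul hop hom hb₁ hb₂ x).const_mul Complex.I
    have i12 : Integrable (fun y : ℝ => Complex.cos (2*y*x) *
        (gammaKer op om b₁ y + gammaKer op om b₂ y) +
        2*(b₁+b₂)/(op*om) * ((Complex.cos (2*y*x) - 1)/(y*Complex.sinh y)))
        (volume.restrict (Ioi 0)) := i1.add i2
    rw [← integral_add h1 h2, ← integral_const_mul, ← integral_const_mul, ← integral_add i1 i2,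
      ← integral_add i12 i3]
    congr 1
    ext y
    exact gammaKer_pair b₁ b₂ x y
  unfold gammaExp gammaPsi
  linear_combination (1/2) * key

end

section

open Filter Topology

theorem continuousAt_gammaExp {op₀ om b₀ : ℂ} (hop : 0 < op₀.re) (hom : 0 < om.re)
    (hb : |b₀.re| < (op₀.re + om.re)/2) :
    ContinuousAt (fun p : ℂ × ℂ => gammaExp p.1 om p.2) (op₀, b₀) := by
  obtain ⟨C, r, hr, h⟩ := gammaKer_bound hop hom hb
  have hPne : op₀ * om ≠ 0 := mul_ne_zero (ne_zero_of_re_pos' hop) (ne_zero_of_re_pos' hom)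
  have h1 : ContinuousAt (fun p : ℂ × ℂ => ∫ y in Ioi (0:ℝ), gammaKer p.1 om p.2 y) (op₀, b₀) := by
    refine continuousAt_of_dominated (bound := fun y => C * Real.exp (-r*y)) ?_ ?_
      (integrableOn_exp_neg_mul hr C) ?_
    · exact Eventually.of_forall fun p => (measurable_gammaKer _ _ _).aestronglyMeasurable
    · filter_upwards [h] with p hp
      filter_upwards [ae_restrict_mem measurableSet_Ioi] with y hy
      exact hp y hy
    · filter_upwards [ae_restrict_mem measurableSet_Ioi] with y hy
      have h1 := sinh_mul_ne_zero hop hy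
      have h2 := sinh_mul_ne_zero hom hy
      have h3 := sinh_mul_ne_zero (a := 1) (by simp) hy
      rw [one_mul] at h3
      unfold gammaKer
      refine ContinuousAt.mul continuousAt_const (ContinuousAt.sub ?_ ?_)
      · exact ContinuousAt.div (by fun_prop) (by fun_prop) (mul_ne_zero h1 h2)
      · exact ContinuousAt.div (ContinuousAt.div (by fun_prop) (by fun_prop) hPne) (by fun_prop) h3
  unfold gammaExp
  refine ContinuousAt.add (continuousAt_const.mul h1) (ContinuousAt.mul ?_ continuousAt_const)
  exact ContinuousAt.div (by fun_prop) (by fun_prop) hPne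

theorem differentiableAt_gammaExp {op om b₀ : ℂ} (hop : 0 < op.re) (hom : 0 < om.re)
    (hb : |b₀.re| < (op.re + om.re)/2) :
    DifferentiableAt ℂ (gammaExp op om) b₀ := by
  obtain ⟨C, r, hr, h⟩ := gammaKer_bound hop hom hb
  have h := (show ContinuousAt (fun b : ℂ => (op, b)) b₀ by fun_prop).eventually h
  have h1 : DifferentiableAt ℂ (fun b => ∫ y, (Ioi (0:ℝ)).indicator (gammaKer op om b) y) b₀ := by
    refine differentiableAt_integral_of_dominated
      (g := (Ioi (0:ℝ)).indicator (fun y => C * Real.exp (-r*y))) ?_ ?_ ?_ ?_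
    · exact (integrable_indicator_iff measurableSet_Ioi).2 (integrableOn_exp_neg_mul hr C)
    · exact Eventually.of_forall fun b =>
        ((measurable_gammaKer _ _ _).indicator measurableSet_Ioi).aestronglyMeasurable
    · filter_upwards [h] with b hb y
      by_cases hy : y ∈ Ioi (0:ℝ)
      · simp only [indicator_of_mem hy]; exact hb y hy
      · simp [indicator_of_notMem hy]
    · refine Eventually.of_forall fun b y => ?_
      by_cases hy : y ∈ Ioi (0:ℝ)
      · simp only [indicator_of_mem hy]
        unfold gammaKer
        fun_prop
      · simp [indicator_of_notMem hy]
  simp_rw [integral_indicator measurableSet_Ioi] at h1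
  unfold gammaExp
  fun_prop

/-- The hyperbolic gamma function in the variable `a = ω - i z`. -/
def hypH (G : ℂ → ℂ → ℂ → ℂ) (op om a : ℂ) : ℂ := G op om (Complex.I * (a - (op+om)/2))



/-- `G` is a family of hyperbolic gamma functions. -/
def IsHypGammaFamily (G : ℂ → ℂ → ℂ → ℂ) : Prop :=
  ∀ a b : ℂ, 0 < a.re → 0 < b.re → IsHypGamma a b (G a b)

variable {G : ℂ → ℂ → ℂ → ℂ}

theorem strip_abs {op om a : ℂ} (h0 : 0 < a.re) (h1 : a.re < op.re + om.re) :
    |((op+om)/2 - a).re| < (op.re + om.re)/2 := by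
  have : ((op+om)/2 - a).re = (op.re+om.re)/2 - a.re := by simp
  rw [this, abs_lt]; constructor <;> linarith

theorem hypH_strip (hG : IsHypGammaFamily G) {op om a : ℂ} (hop : 0 < op.re) (hom : 0 < om.re)
    (h0 : 0 < a.re) (h1 : a.re < op.re + om.re) :
    hypH G op om a = Complex.exp (gammaExp op om ((op+om)/2 - a)) := by
  rw [← gammaExp_eq hop hom (strip_abs h0 h1), hypH]
  have e : Complex.I * (a - (op+om)/2) = -Complex.I * ((op+om)/2 - a) := by ring
  rw [e]
  apply (hG op om hop hom).strip
  have := strip_abs (op := op) (om := om) h0 h1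
  simpa [abs_sub_comm] using this

theorem not_mem_hypGammaPoles {op om a : ℂ} (hop : 0 < op.re) (hom : 0 < om.re)
    (h0 : 0 < a.re) : Complex.I * (a - (op+om)/2) ∉ hypGammaPoles op om := by
  rintro ⟨m, n, h⟩
  have h2 : a = -(m*op + n*om) := by
    have : Complex.I * (a + (m*op+n*om)) = 0 := by linear_combination h
    have := (mul_eq_zero.1 this).resolve_left Complex.I_ne_zero
    linear_combination this
  rw [h2] at h0
  simp only [Complex.neg_re, Complex.add_re, Complex.mul_re, Complex.natCast_re,
    Complex.natCast_im, zero_mul, sub_zero] at h0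
  have : 0 ≤ (m:ℝ)*op.re + n*om.re := by positivity
  linarith

theorem isOpen_compl_hypGammaPoles {op om : ℂ} (hop : 0 < op.re) (hom : 0 < om.re) :
    ∀ a : ℂ, 0 < a.re → (hypGammaPoles op om)ᶜ ∈ 𝓝 (Complex.I * (a - (op+om)/2)) := by
  intro a ha
  have h1 : ∀ᶠ z in 𝓝 (Complex.I * (a - (op+om)/2)), 0 < (-Complex.I * z + (op+om)/2).re := by
    have : ContinuousAt (fun z => (-Complex.I * z + (op+om)/2).re) (Complex.I * (a - (op+om)/2)) := by
      fun_prop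
    refine this.eventually_const_lt ?_
    have : -Complex.I * (Complex.I * (a - (op+om)/2)) + (op+om)/2 = a := by
      linear_combination -(a - (op+om)/2) * Complex.I_sq
    simp only [this]; exact ha
  filter_upwards [h1] with z hz
  have := not_mem_hypGammaPoles hop hom hz
  have e : Complex.I * (-Complex.I * z + (op+om)/2 - (op+om)/2) = z := by
    linear_combination -z * Complex.I_sq
  rwa [e] at this

theorem continuousAt_hypH (hG : IsHypGammaFamily G) {op om a : ℂ} (hop : 0 < op.re)
    (hom : 0 < om.re) (h0 : 0 < a.re) : ContinuousAt (hypH G op om) a := by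
  have h := (hG op om hop hom).cont.continuousAt (isOpen_compl_hypGammaPoles hop hom a h0)
  unfold hypH
  exact ContinuousAt.comp (f := fun a => Complex.I * (a - (op+om)/2)) h (by fun_prop)

theorem eventually_sin_ne_zero {op : ℂ} (hop : op ≠ 0) (a : ℂ) :
    ∀ᶠ z in 𝓝[≠] a, Complex.sin (Real.pi * z / op) ≠ 0 := by
  have hd : HasDerivAt (fun z : ℂ => Complex.sin (Real.pi * z / op))
      (Complex.cos (Real.pi * a / op) * (Real.pi / op)) a := by
    have : HasDerivAt (fun z : ℂ => Real.pi * z / op) (Real.pi / op) a := by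
      simpa using ((hasDerivAt_id a).const_mul (Real.pi:ℂ)).div_const op
    exact this.csin
  by_cases h : Complex.sin (Real.pi * a / op) = 0
  · refine hd.eventually_ne (c := 0) ?_
    refine mul_ne_zero ?_ (div_ne_zero (by exact_mod_cast Real.pi_ne_zero) hop)
    intro hc
    have := Complex.sin_sq_add_cos_sq (Real.pi * a / op)
    rw [h, hc] at this
    norm_num at this
  · exact (hd.continuousAt.eventually_ne h).filter_mono nhdsWithin_le_nhds

theorem hypH_shift_aux {f : ℂ → ℂ} {op om : ℂ} (hop : 0 < op.re) (hom : 0 < om.re)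
    (hf : ∀ a : ℂ, 0 < a.re → ContinuousAt f a)
    (h : ∀ a : ℂ, 0 < a.re → Complex.sin (Real.pi * a / op) ≠ 0 →
      f (a+om) = 2 * Complex.sin (Real.pi * a / op) * f a) (a : ℂ) (ha : 0 < a.re) :
    f (a+om) = 2 * Complex.sin (Real.pi * a / op) * f a := by
  have h1 : Tendsto (fun z => f (z+om)) (𝓝[≠] a) (𝓝 (f (a+om))) := by
    have : ContinuousAt (fun z => f (z+om)) a :=
      ContinuousAt.comp (f := fun z => z + om) (hf _ (by simp; linarith)) (by fun_prop)
    exact this.tendsto.mono_left nhdsWithin_le_nhds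
  have h2 : Tendsto (fun z => 2 * Complex.sin (Real.pi * z / op) * f z) (𝓝[≠] a)
      (𝓝 (2 * Complex.sin (Real.pi * a / op) * f a)) := by
    have : ContinuousAt (fun z => 2 * Complex.sin (Real.pi * z / op) * f z) a :=
      ContinuousAt.mul (by fun_prop) (hf a ha)
    exact this.tendsto.mono_left nhdsWithin_le_nhds
  refine tendsto_nhds_unique_of_eventuallyEq h1 h2 ?_
  have hre : ∀ᶠ z in 𝓝[≠] a, 0 < z.re := by
    have : ContinuousAt (fun z : ℂ => z.re) a := by fun_prop
    exact (this.eventually_const_lt ha).filter_mono nhdsWithin_le_nhds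
  filter_upwards [eventually_sin_ne_zero (ne_zero_of_re_pos' hop) a, hre] with z hz hz1
  exact h z hz1 hz

theorem cosh_shift {op a : ℂ} (hop : op ≠ 0) :
    Complex.cosh (Real.pi * (Complex.I * (a - op/2)) / op) = Complex.sin (Real.pi * a / op) := by
  have : Real.pi * (Complex.I * (a - op/2)) / op = (Real.pi * a / op - Real.pi/2) * Complex.I := by
    field_simp
  rw [this, Complex.cosh_mul_I, Complex.cos_sub_pi_div_two]

theorem hypH_add_om (hG : IsHypGammaFamily G) {op om : ℂ} (hop : 0 < op.re)
    (hom : 0 < om.re) {a : ℂ} (h0 : 0 < a.re) :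
    hypH G op om (a+om) = 2 * Complex.sin (Real.pi * a / op) * hypH G op om a := by
  refine hypH_shift_aux hop hom (fun a ha => continuousAt_hypH hG hop hom ha) ?_ a h0
  intro a ha hs
  have hne := ne_zero_of_re_pos' hop
  have := (hG op om hop hom).funEqm (Complex.I * (a - op/2)) (by rwa [cosh_shift hne])
  rw [cosh_shift hne] at this
  unfold hypH
  convert this using 2 <;> [skip; congr 1] <;> ring

theorem hypH_add_op (hG : IsHypGammaFamily G) {op om : ℂ} (hop : 0 < op.re)
    (hom : 0 < om.re) {a : ℂ} (h0 : 0 < a.re) :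
    hypH G op om (a+op) = 2 * Complex.sin (Real.pi * a / om) * hypH G op om a := by
  refine hypH_shift_aux hom hop (fun a ha => continuousAt_hypH hG hop hom ha) ?_ a h0
  intro a ha hs
  have hne := ne_zero_of_re_pos' hom
  have := (hG op om hop hom).funEqp (Complex.I * (a - om/2)) (by rwa [cosh_shift hne])
  rw [cosh_shift hne] at this
  unfold hypH
  convert this using 2 <;> [skip; congr 1] <;> ring

theorem strip_induction {om : ℂ} (hom : 0 < om.re) {W : ℝ} (hW : om.re < W) {P : ℂ → Prop}
    (base : ∀ a : ℂ, 0 < a.re → a.re < W → P a) (step : ∀ a : ℂ, 0 < a.re → P a → P (a+om)) :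
    ∀ a : ℂ, 0 < a.re → P a := by
  have key : ∀ n : ℕ, ∀ a : ℂ, 0 < a.re → a.re < W + n * om.re → P a := by
    intro n
    induction n with
    | zero => intro a h0 h1; exact base a h0 (by simpa using h1)
    | succ n ih =>
      intro a h0 h1
      by_cases h : a.re < W
      · exact base a h0 h
      · have := step (a - om) (by simp; linarith)
          (ih _ (by simp; linarith) (by push_cast at h1; simp; linarith))
        rwa [sub_add_cancel] at this
  intro a ha
  obtain ⟨n, hn⟩ := exists_nat_gt (a.re / om.re)
  rw [div_lt_iff₀ hom] at hn
  exact key n a ha (by linarith)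

theorem continuousAt_hypH_joint (hG : IsHypGammaFamily G) {op₀ om : ℂ} (hop : 0 < op₀.re)
    (hom : 0 < om.re) (a₀ : ℂ) (h0 : 0 < a₀.re) :
    ContinuousAt (fun p : ℂ × ℂ => hypH G p.1 om p.2) (op₀, a₀) := by
  have hopev : ∀ a : ℂ, ∀ᶠ p : ℂ × ℂ in 𝓝 (op₀, a), 0 < p.1.re := fun a =>
    (show ContinuousAt (fun p : ℂ × ℂ => p.1.re) (op₀, a) by fun_prop).eventually_const_lt hop
  revert a₀
  refine strip_induction hom (W := op₀.re + om.re) (by linarith) ?_ ?_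
  · intro a h0 h1
    have hc : ContinuousAt (fun p : ℂ × ℂ => Complex.exp (gammaExp p.1 om ((p.1+om)/2 - p.2)))
        (op₀, a) := by
      refine ContinuousAt.cexp ?_
      exact ContinuousAt.comp (f := fun p : ℂ × ℂ => (p.1, (p.1+om)/2 - p.2)) (x := (op₀, a))
        (continuousAt_gammaExp hop hom (strip_abs h0 h1)) (by fun_prop)
    refine hc.congr ?_
    have e1 : ∀ᶠ p : ℂ × ℂ in 𝓝 (op₀, a), 0 < p.2.re :=
      (show ContinuousAt (fun p : ℂ × ℂ => p.2.re) (op₀, a) by fun_prop).eventually_const_lt h0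
    have e2 : ∀ᶠ p : ℂ × ℂ in 𝓝 (op₀, a), 0 < p.1.re + om.re - p.2.re :=
      (show ContinuousAt (fun p : ℂ × ℂ => p.1.re + om.re - p.2.re) (op₀, a) by
        fun_prop).eventually_const_lt (by simp only; linarith)
    filter_upwards [hopev a, e1, e2] with p hp h1 h2
    exact (hypH_strip hG hp hom h1 (by linarith)).symm
  · intro a h0 ih
    have hc : ContinuousAt (fun p : ℂ × ℂ => 2 * Complex.sin (Real.pi * (p.2 - om) / p.1) *
        hypH G p.1 om (p.2 - om)) (op₀, a+om) := by
      refine ContinuousAt.mul ?_ ?_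
      · refine ContinuousAt.mul continuousAt_const ?_
        refine ContinuousAt.comp (g := Complex.sin) (by fun_prop) ?_
        exact ContinuousAt.div (by fun_prop) (by fun_prop) (ne_zero_of_re_pos' hop)
      · refine ContinuousAt.comp (g := fun p : ℂ × ℂ => hypH G p.1 om p.2)
          (f := fun p : ℂ × ℂ => (p.1, p.2 - om)) (x := (op₀, a+om)) ?_ (by fun_prop)
        simpa using ih
    refine hc.congr ?_
    have e1 : ∀ᶠ p : ℂ × ℂ in 𝓝 (op₀, a+om), 0 < (p.2 - om).re :=
      (show ContinuousAt (fun p : ℂ × ℂ => (p.2-om).re) (op₀, a+om) by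
        fun_prop).eventually_const_lt (by simpa using h0)
    filter_upwards [hopev _, e1] with p hp h1
    have := hypH_add_om hG hp hom h1
    rw [sub_add_cancel] at this
    exact this.symm

theorem differentiableAt_hypH (hG : IsHypGammaFamily G) {op om : ℂ} (hop : 0 < op.re)
    (hom : 0 < om.re) (a₀ : ℂ) (h0 : 0 < a₀.re) : DifferentiableAt ℂ (hypH G op om) a₀ := by
  revert a₀
  refine strip_induction hom (W := op.re + om.re) (by linarith) ?_ ?_
  · intro a h0 h1
    have hd : DifferentiableAt ℂ (fun a => Complex.exp (gammaExp op om ((op+om)/2 - a))) a := by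
      refine DifferentiableAt.cexp ?_
      exact DifferentiableAt.comp a (differentiableAt_gammaExp hop hom (strip_abs h0 h1))
        (by fun_prop)
    refine hd.congr_of_eventuallyEq ?_
    have e1 : ∀ᶠ z : ℂ in 𝓝 a, 0 < z.re :=
      (show ContinuousAt (fun z : ℂ => z.re) a by fun_prop).eventually_const_lt h0
    have e2 : ∀ᶠ z : ℂ in 𝓝 a, z.re < op.re + om.re :=
      (show ContinuousAt (fun z : ℂ => z.re) a by fun_prop).eventually_lt_const h1
    filter_upwards [e1, e2] with z h1 h2
    exact hypH_strip hG hop hom h1 h2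
  · intro a h0 ih
    have hd : DifferentiableAt ℂ (fun z => 2 * Complex.sin (Real.pi * (z - om) / op) *
        hypH G op om (z - om)) (a+om) := by
      refine DifferentiableAt.mul (by fun_prop) ?_
      refine DifferentiableAt.comp (g := hypH G op om) (f := fun z => z - om) (a+om) ?_ (by fun_prop)
      simpa using ih
    refine hd.congr_of_eventuallyEq ?_
    have e1 : ∀ᶠ z : ℂ in 𝓝 (a+om), 0 < (z - om).re :=
      (show ContinuousAt (fun z : ℂ => (z-om).re) (a+om) by
        fun_prop).eventually_const_lt (by simpa using h0)
    filter_upwards [e1] with z h1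
    have := hypH_add_om hG hop hom h1
    rwa [sub_add_cancel] at this

theorem hypH_refl (hG : IsHypGammaFamily G) {op om a : ℂ} (hop : 0 < op.re) (hom : 0 < om.re)
    (h0 : 0 < a.re) (h1 : a.re < op.re + om.re) :
    hypH G op om a * hypH G op om (op + om - a) = 1 := by
  rw [hypH_strip hG hop hom h0 h1, hypH_strip hG hop hom (by simp; linarith) (by simp; linarith),
    ← Complex.exp_add]
  have : (op+om)/2 - (op+om-a) = -((op+om)/2 - a) := by ring
  rw [this, gammaExp_neg, add_neg_cancel, Complex.exp_zero]

end

section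

open Filter Topology

variable {G : ℂ → ℂ → ℂ → ℂ}

theorem exp_gammaPsi (hG : IsHypGammaFamily G) (x : ℝ) :
    Complex.exp (gammaPsi x) * (2 * Complex.cosh (Real.pi * x)) = 1 := by
  have h1 : (0:ℝ) < (1:ℂ).re := by simp
  have hp := gammaExp_pair (op := 1) (om := 1) (b₁ := 1/2) (b₂ := 1/2) h1 h1 (by norm_num)
    (by norm_num) x
  simp only [gammaKer_half, gammaKerDiff, sub_self, zero_div, mul_zero, add_zero,
    integral_zero, zero_add] at hp
  have e : ((1:ℂ)/2+1/2)/(1*1) = 1 := by norm_num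
  rw [e, one_mul] at hp
  have ha : hypH G 1 1 (1/2 - Complex.I*x) = Complex.exp (gammaExp 1 1 (1/2 + Complex.I*x)) := by
    rw [hypH_strip hG h1 h1 (by simp) (by norm_num)]
    congr 2; ring
  have hb : hypH G 1 1 (1/2 + Complex.I*x) = Complex.exp (gammaExp 1 1 (1/2 - Complex.I*x)) := by
    rw [hypH_strip hG h1 h1 (by simp) (by norm_num)]
    congr 2; ring
  have hs := hypH_add_om hG h1 h1 (a := 1/2 - Complex.I*x) (by simp)
  have hr := hypH_refl hG h1 h1 (a := 1/2 + Complex.I*x) (by simp) (by norm_num)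
  have e2 : (1:ℂ) + 1 - (1/2 + Complex.I*x) = 1/2 - Complex.I*x + 1 := by ring
  have e3 : Complex.sin (Real.pi * (1/2 - Complex.I*x) / 1) = Complex.cosh (Real.pi * x) := by
    rw [← Complex.cos_mul_I, ← Complex.sin_pi_div_two_sub]
    congr 1; ring
  rw [e2, hs, e3] at hr
  rw [← hp, Complex.exp_add, ← ha, ← hb]
  linear_combination hr

theorem gammaPsi_real (x : ℝ) : ∃ t : ℝ, gammaPsi x = t := by
  refine ⟨(∫ y in Ioi (0:ℝ), (1/y) * (1/Real.sinh y - 1/y)) +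
    ∫ y in Ioi (0:ℝ), (Real.cos (2*y*x) - 1)/(y*Real.sinh y), ?_⟩
  unfold gammaPsi gammaConst
  push_cast
  rw [← integral_complex_ofReal, ← integral_complex_ofReal]
  push_cast
  rfl

theorem gammaPsi_bounds (hG : IsHypGammaFamily G) (x : ℝ) :
    ∃ t : ℝ, gammaPsi x = t ∧ -Real.pi * |x| - Real.log 2 ≤ t ∧ t ≤ -Real.pi * |x| := by
  obtain ⟨t, ht⟩ := gammaPsi_real x
  have h := exp_gammaPsi hG x
  rw [ht] at h
  have h' : Real.exp t * (2 * Real.cosh (Real.pi * x)) = 1 := by exact_mod_cast h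
  have hc : 0 < 2 * Real.cosh (Real.pi * x) := by have := Real.cosh_pos (Real.pi * x); linarith
  have ht2 : t = -Real.log (2 * Real.cosh (Real.pi * x)) := by
    have h2 : Real.log (Real.exp t * (2 * Real.cosh (Real.pi * x))) = 0 := by rw [h', Real.log_one]
    rw [Real.log_mul (Real.exp_pos t).ne' hc.ne', Real.log_exp] at h2
    linarith
  have habs : |Real.pi * x| = Real.pi * |x| := by rw [abs_mul, abs_of_pos Real.pi_pos]
  have h1 : Real.exp (Real.pi * |x|) ≤ 2 * Real.cosh (Real.pi * x) := by
    rw [← Real.cosh_abs, habs, Real.cosh_eq]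
    have := Real.exp_pos (-(Real.pi * |x|))
    linarith
  have h2 : 2 * Real.cosh (Real.pi * x) ≤ 2 * Real.exp (Real.pi * |x|) := by
    rw [← Real.cosh_abs, habs, Real.cosh_eq]
    have : Real.exp (-(Real.pi * |x|)) ≤ Real.exp (Real.pi * |x|) := by
      apply Real.exp_le_exp.2
      have : 0 ≤ Real.pi * |x| := by positivity
      linarith
    linarith
  refine ⟨t, ht, ?_, ?_⟩
  · have := Real.log_le_log hc h2
    rw [Real.log_mul two_ne_zero (Real.exp_pos _).ne', Real.log_exp] at this
    linarith
  · have := Real.log_le_log (Real.exp_pos _) h1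
    rw [Real.log_exp] at this
    linarith

theorem integral_exp_neg_mul {r : ℝ} (hr : 0 < r) (C : ℝ) :
    ∫ y in Ioi (0:ℝ), C * Real.exp (-r*y) = C / r := by
  rw [integral_const_mul, integral_exp_mul_Ioi (by linarith) 0]
  simp [div_eq_mul_inv]

theorem norm_integral_cos_le {K₁ K₂ : ℝ → ℂ} {C₁ C₂ r₁ r₂ : ℝ} (hr₁ : 0 < r₁) (hr₂ : 0 < r₂)
    (h₁ : ∀ y : ℝ, 0 < y → ‖K₁ y‖ ≤ C₁ * Real.exp (-r₁*y))
    (h₂ : ∀ y : ℝ, 0 < y → ‖K₂ y‖ ≤ C₂ * Real.exp (-r₂*y)) (x : ℝ) :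
    ‖∫ y in Ioi (0:ℝ), Complex.cos (2*y*x) * (K₁ y + K₂ y)‖ ≤ C₁/r₁ + C₂/r₂ := by
  rw [← integral_exp_neg_mul hr₁, ← integral_exp_neg_mul hr₂, ← integral_add
    (integrableOn_exp_neg_mul hr₁ C₁) (integrableOn_exp_neg_mul hr₂ C₂)]
  refine norm_integral_le_of_norm_le
    ((integrableOn_exp_neg_mul hr₁ C₁).add (integrableOn_exp_neg_mul hr₂ C₂)) ?_
  filter_upwards [ae_restrict_mem measurableSet_Ioi] with y hy
  have e : Complex.cos (2*y*x) = ((Real.cos (2*y*x) : ℝ) : ℂ) := by push_cast; rfl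
  rw [norm_mul, e, Complex.norm_real, Real.norm_eq_abs]
  calc _ ≤ 1 * ‖K₁ y + K₂ y‖ := by gcongr; exact Real.abs_cos_le_one _
    _ ≤ _ := by
      rw [one_mul]
      exact (norm_add_le _ _).trans (add_le_add (h₁ y hy) (h₂ y hy))

theorem norm_integral_sin_le {K : ℝ → ℂ} {C r η : ℝ} (hr : 0 < r) (hη : 0 < η) (hC : 0 ≤ C)
    (h : ∀ y : ℝ, 0 < y → ‖K y‖ ≤ C * Real.exp (-r*y)) (x : ℝ) :
    ‖∫ y in Ioi (0:ℝ), Complex.sin (2*y*x) / y * K y‖ ≤ 2 * C * η * |x| + C/η/r := by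
  have i1 : IntegrableOn (indicator (Ioc 0 η) (fun _ : ℝ => 2 * |x| * C)) (Ioi 0) := by
    refine Integrable.integrableOn ?_
    rw [integrable_indicator_iff measurableSet_Ioc]
    exact integrableOn_const (by simp)
  have e1 : ∫ y in Ioi (0:ℝ), indicator (Ioc 0 η) (fun _ : ℝ => 2 * |x| * C) y = 2 * C * η * |x| := by
    rw [setIntegral_indicator measurableSet_Ioc, inter_eq_right.2 Ioc_subset_Ioi_self,
      setIntegral_const]
    simp [hη.le]; ring
  rw [← integral_exp_neg_mul hr, ← e1, ← integral_add i1 (integrableOn_exp_neg_mul hr _)]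
  refine norm_integral_le_of_norm_le (i1.add (integrableOn_exp_neg_mul hr _)) ?_
  filter_upwards [ae_restrict_mem measurableSet_Ioi] with y hy
  have hy : 0 < y := hy
  have hs := abs_sin_div_le x hy
  rw [norm_mul]
  by_cases hyη : y ≤ η
  · rw [indicator_of_mem (show y ∈ Ioc 0 η from ⟨hy, hyη⟩)]
    have h1 : ‖K y‖ ≤ C := (h y hy).trans (mul_le_of_le_one_right hC (by
      rw [Real.exp_le_one_iff]; nlinarith))
    have h2 : 0 ≤ C/η * Real.exp (-r*y) := by positivity
    have h3 := mul_le_mul (hs.trans (min_le_left _ _)) h1 (norm_nonneg _) (by positivity)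
    linarith
  · rw [indicator_of_notMem (fun hm => hyη hm.2), zero_add]
    have h1 : 1/y ≤ 1/η := one_div_le_one_div_of_le hη (not_le.1 hyη).le
    have h3 := mul_le_mul ((hs.trans (min_le_right _ _)).trans h1) (h y hy) (norm_nonneg _)
      (by positivity)
    refine h3.trans (le_of_eq (by ring))

theorem hypH_pair_bound_strip (hG : IsHypGammaFamily G) {op₀ om a₁ a₂ : ℂ} (hop : 0 < op₀.re)
    (hom : 0 < om.re) (h10 : 0 < a₁.re) (h11 : a₁.re < op₀.re + om.re) (h20 : 0 < a₂.re)
    (h21 : a₂.re < op₀.re + om.re) {δ : ℝ} (hδ : 0 < δ) :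
    ∃ C : ℝ, ∀ᶠ p : ℂ × ℂ × ℂ in 𝓝 (op₀, a₁, a₂), ∀ x : ℝ,
      ‖hypH G p.1 om (p.2.1 - Complex.I*x) * hypH G p.1 om (p.2.2 + Complex.I*x)‖ ≤
        C * Real.exp ((δ - Real.pi * ((op₀+om-a₁-a₂)/(op₀*om)).re) * |x|) := by
  obtain ⟨C₁, r₁, hr₁, hb₁⟩ := gammaKer_bound hop hom (strip_abs h10 h11)
  obtain ⟨C₂, r₂, hr₂, hb₂⟩ := gammaKer_bound hop hom (strip_abs h20 h21)
  obtain ⟨C, r, hr, hb⟩ := gammaKerDiff_bound hop hom (strip_abs h10 h11) (strip_abs h20 h21)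
  have hC : 0 ≤ C := by
    have h1 := (norm_nonneg _).trans (hb.self_of_nhds 1 one_pos)
    exact nonneg_of_mul_nonneg_left h1 (Real.exp_pos _)
  have hb₁' := (show ContinuousAt (fun p : ℂ × ℂ × ℂ => (p.1, (p.1+om)/2 - p.2.1)) (op₀, a₁, a₂) by
    fun_prop).eventually hb₁
  have hb₂' := (show ContinuousAt (fun p : ℂ × ℂ × ℂ => (p.1, (p.1+om)/2 - p.2.2)) (op₀, a₁, a₂) by
    fun_prop).eventually hb₂
  have hb' := (show ContinuousAt (fun p : ℂ × ℂ × ℂ => (p.1, (p.1+om)/2 - p.2.1, (p.1+om)/2 - p.2.2))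
    (op₀, a₁, a₂) by fun_prop).eventually hb
  set q₀ := ((op₀+om-a₁-a₂)/(op₀*om)).re with hq₀
  have hPne : op₀ * om ≠ 0 := mul_ne_zero (ne_zero_of_re_pos' hop) (ne_zero_of_re_pos' hom)
  have hqc : ContinuousAt (fun p : ℂ × ℂ × ℂ => ((p.1+om-p.2.1-p.2.2)/(p.1*om)).re) (op₀, a₁, a₂) := by
    refine ContinuousAt.comp (g := Complex.re) Complex.continuous_re.continuousAt ?_
    exact ContinuousAt.div (by fun_prop) (by fun_prop) hPne
  have hq1 := hqc.eventually_const_lt (u := q₀ - δ/(2*Real.pi)) (by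
    have : 0 < δ/(2*Real.pi) := by positivity
    simp only; linarith)
  have hq2 := hqc.eventually_lt_const (u := q₀ + 1) (by simp only; linarith)
  have c1 : ∀ᶠ p : ℂ × ℂ × ℂ in 𝓝 (op₀, a₁, a₂), 0 < p.1.re :=
    (show ContinuousAt (fun p : ℂ × ℂ × ℂ => p.1.re) _ by fun_prop).eventually_const_lt hop
  have c2 : ∀ᶠ p : ℂ × ℂ × ℂ in 𝓝 (op₀, a₁, a₂), 0 < p.2.1.re :=
    (show ContinuousAt (fun p : ℂ × ℂ × ℂ => p.2.1.re) _ by fun_prop).eventually_const_lt h10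
  have c3 : ∀ᶠ p : ℂ × ℂ × ℂ in 𝓝 (op₀, a₁, a₂), 0 < p.2.2.re :=
    (show ContinuousAt (fun p : ℂ × ℂ × ℂ => p.2.2.re) _ by fun_prop).eventually_const_lt h20
  have c4 : ∀ᶠ p : ℂ × ℂ × ℂ in 𝓝 (op₀, a₁, a₂), 0 < p.1.re + om.re - p.2.1.re :=
    (show ContinuousAt (fun p : ℂ × ℂ × ℂ => p.1.re + om.re - p.2.1.re) _ by
      fun_prop).eventually_const_lt (by simp only; linarith)
  have c5 : ∀ᶠ p : ℂ × ℂ × ℂ in 𝓝 (op₀, a₁, a₂), 0 < p.1.re + om.re - p.2.2.re :=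
    (show ContinuousAt (fun p : ℂ × ℂ × ℂ => p.1.re + om.re - p.2.2.re) _ by
      fun_prop).eventually_const_lt (by simp only; linarith)
  set η := δ / (2*(C+1)) with hη
  have hη0 : 0 < η := by positivity
  have hηC : 2 * C * η ≤ δ := by
    rw [hη]; rw [mul_div_assoc', div_le_iff₀ (by positivity)]; nlinarith
  refine ⟨Real.exp ((C₁/r₁ + C₂/r₂)/2 + (|q₀| + 1 + δ/(2*Real.pi)) * Real.log 2 + C/η/r/2), ?_⟩
  filter_upwards [hb₁', hb₂', hb', hq1, hq2, c1, c2, c3, c4, c5]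
    with p hb₁ hb₂ hb hq1 hq2 c1 c2 c3 c4 c5 x
  have s1 : hypH G p.1 om (p.2.1 - Complex.I*x) =
      Complex.exp (gammaExp p.1 om ((p.1+om)/2 - p.2.1 + Complex.I*x)) := by
    rw [hypH_strip hG c1 hom (by simpa using c2) (by simp; linarith)]
    congr 2; ring
  have s2 : hypH G p.1 om (p.2.2 + Complex.I*x) =
      Complex.exp (gammaExp p.1 om ((p.1+om)/2 - p.2.2 - Complex.I*x)) := by
    rw [hypH_strip hG c1 hom (by simpa using c3) (by simp; linarith)]
    congr 2; ring
  rw [s1, s2, ← Complex.exp_add, gammaExp_pair c1 hom (strip_abs c2 (by linarith))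
    (strip_abs c3 (by linarith)), Complex.norm_exp, ← Real.exp_add]
  apply Real.exp_le_exp.2
  obtain ⟨t, ht, ht1, ht2⟩ := gammaPsi_bounds hG x
  have e : ((p.1+om)/2 - p.2.1 + ((p.1+om)/2 - p.2.2))/(p.1*om) = (p.1+om-p.2.1-p.2.2)/(p.1*om) := by
    congr 1; ring
  rw [e, ht, Complex.add_re, Complex.add_re, Complex.re_mul_ofReal]
  set q := ((p.1+om-p.2.1-p.2.2)/(p.1*om)).re
  have n1 := norm_integral_cos_le hr₁ hr₂ hb₁ hb₂ x
  have n2 := norm_integral_sin_le hr hη0 hC hb x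
  have m1 := (Complex.re_le_norm ((1/2) * ∫ y in Ioi (0:ℝ), Complex.cos (2*y*x) *
    (gammaKer p.1 om ((p.1+om)/2 - p.2.1) y + gammaKer p.1 om ((p.1+om)/2 - p.2.2) y)))
  rw [norm_mul] at m1
  have m2 := (Complex.re_le_norm (Complex.I/2 * ∫ y in Ioi (0:ℝ), Complex.sin (2*y*x) / y *
    gammaKerDiff p.1 om ((p.1+om)/2 - p.2.1) ((p.1+om)/2 - p.2.2) y))
  rw [norm_mul] at m2
  have k1 : ‖(1/2:ℂ)‖ = 1/2 := by norm_num
  have k2 : ‖(Complex.I/2:ℂ)‖ = 1/2 := by simp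
  rw [k1] at m1
  rw [k2] at m2
  have hlog : 0 ≤ Real.log 2 := Real.log_nonneg (by norm_num)
  have hx : 0 ≤ |x| := abs_nonneg x
  have hqt : q * t ≤ -Real.pi * |x| * q + |q| * Real.log 2 := by
    have h1 : |t + Real.pi * abs x| ≤ Real.log 2 := by rw [abs_le]; constructor <;> linarith
    have h2 : q * (t + Real.pi * abs x) ≤ |q| * Real.log 2 := by
      refine (le_abs_self _).trans ?_
      rw [abs_mul]; gcongr
    linarith
  have hqa : |q| ≤ |q₀| + 1 + δ/(2*Real.pi) := by
    have : 0 < δ/(2*Real.pi) := by positivity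
    rw [abs_le]
    constructor
    · linarith [neg_abs_le q₀]
    · linarith [le_abs_self q₀]
  have hqa' := mul_le_mul_of_nonneg_right hqa hlog
  have hq3 : -Real.pi * |x| * q ≤ -Real.pi * |x| * q₀ + δ/2 * |x| := by
    have h1 : Real.pi * |x| * (q₀ - δ/(2*Real.pi)) ≤ Real.pi * |x| * q :=
      mul_le_mul_of_nonneg_left hq1.le (by positivity)
    have h2 : Real.pi * |x| * (δ/(2*Real.pi)) = δ/2 * |x| := by
      field_simp
    nlinarith
  have hq4 : 2 * C * η * |x| ≤ δ * |x| := by gcongr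
  linarith

end

section

open Filter Topology

variable {G : ℂ → ℂ → ℂ → ℂ}

/-- Locally uniform exponential bounds for a product of two hyperbolic gamma functions. -/
def PairBound (G : ℂ → ℂ → ℂ → ℂ) (op₀ om a₁ a₂ : ℂ) : Prop :=
  ∀ δ : ℝ, 0 < δ → ∃ C : ℝ, ∀ᶠ p : ℂ × ℂ × ℂ in 𝓝 (op₀, a₁, a₂), ∀ x : ℝ,
      ‖hypH G p.1 om (p.2.1 - Complex.I*x) * hypH G p.1 om (p.2.2 + Complex.I*x)‖ ≤
        C * Real.exp ((δ - Real.pi * ((op₀+om-a₁-a₂)/(op₀*om)).re) * |x|)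

theorem PairBound.symm {op₀ om a₁ a₂ : ℂ} (h : PairBound G op₀ om a₁ a₂) :
    PairBound G op₀ om a₂ a₁ := by
  intro δ hδ
  obtain ⟨C, hC⟩ := h δ hδ
  refine ⟨C, ?_⟩
  have hc : ContinuousAt (fun p : ℂ × ℂ × ℂ => (p.1, p.2.2, p.2.1)) (op₀, a₂, a₁) := by fun_prop
  filter_upwards [hc.eventually hC] with p hp x
  have := hp (-x)
  rw [mul_comm, abs_neg] at this
  have e : op₀ + om - a₂ - a₁ = op₀ + om - a₁ - a₂ := by ring
  rw [e]
  convert this using 4 <;> push_cast <;> ring_nf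

theorem norm_sin_le (z : ℂ) : ‖Complex.sin z‖ ≤ Real.exp |z.im| := by
  have h := norm_sinh_le (z * Complex.I)
  rw [Complex.sinh_mul_I, norm_mul, Complex.norm_I, mul_one] at h
  simpa using h

theorem PairBound.add {op₀ om a₁ a₂ : ℂ} (hG : IsHypGammaFamily G) (hop : 0 < op₀.re)
    (hom : 0 < om.re) (h1 : 0 < a₁.re) (h : PairBound G op₀ om a₁ a₂) :
    PairBound G op₀ om (a₁+om) a₂ := by
  intro δ hδ
  obtain ⟨C, hC⟩ := h (δ/2) (by positivity)
  have hne := ne_zero_of_re_pos' hop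
  have hne' := ne_zero_of_re_pos' hom
  set M := |(Real.pi * a₁ / op₀).im| + 1
  refine ⟨2 * Real.exp M * C, ?_⟩
  have hc : ContinuousAt (fun p : ℂ × ℂ × ℂ => (p.1, p.2.1 - om, p.2.2)) (op₀, a₁+om, a₂) := by
    fun_prop
  rw [ContinuousAt, add_sub_cancel_right] at hc
  have e1 : ∀ᶠ p : ℂ × ℂ × ℂ in 𝓝 (op₀, a₁+om, a₂), 0 < p.1.re :=
    (show ContinuousAt (fun p : ℂ × ℂ × ℂ => p.1.re) (op₀, a₁+om, a₂) by
      fun_prop).eventually_const_lt hop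
  have e2 : ∀ᶠ p : ℂ × ℂ × ℂ in 𝓝 (op₀, a₁+om, a₂), 0 < (p.2.1-om).re :=
    (show ContinuousAt (fun p : ℂ × ℂ × ℂ => (p.2.1-om).re) (op₀, a₁+om, a₂) by
      fun_prop).eventually_const_lt (by simpa using h1)
  have e3 : ∀ᶠ p : ℂ × ℂ × ℂ in 𝓝 (op₀, a₁+om, a₂), |(Real.pi * (p.2.1-om) / p.1).im| < M := by
    have : ContinuousAt (fun p : ℂ × ℂ × ℂ => |(Real.pi * (p.2.1-om) / p.1).im|)
        (op₀, a₁+om, a₂) := by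
      refine ContinuousAt.abs ?_
      exact Complex.continuous_im.continuousAt.comp
        (ContinuousAt.div (by fun_prop) (by fun_prop) hne)
    refine this.eventually_lt_const ?_
    simp only [add_sub_cancel_right]
    exact lt_add_one _
  have e4 : ∀ᶠ p : ℂ × ℂ × ℂ in 𝓝 (op₀, a₁+om, a₂), (1/p.1).re < (1/op₀).re + δ/(2*Real.pi) := by
    have : ContinuousAt (fun p : ℂ × ℂ × ℂ => (1/p.1).re) (op₀, a₁+om, a₂) := by
      exact Complex.continuous_re.continuousAt.comp
        (ContinuousAt.div (by fun_prop) (by fun_prop) hne)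
    refine this.eventually_lt_const ?_
    have : 0 < δ/(2*Real.pi) := by positivity
    linarith
  filter_upwards [hc.eventually hC, e1, e2, e3, e4] with p hp e1 e2 e3 e4 x
  have hp := hp x
  have es : p.2.1 - Complex.I*x = (p.2.1 - om - Complex.I*x) + om := by ring
  rw [es, hypH_add_om hG e1 hom (by simpa using e2), mul_assoc, mul_assoc, norm_mul, norm_mul]
  have him : |(Real.pi * (p.2.1 - om - Complex.I*x)/p.1).im| ≤
      M + Real.pi * ((1/op₀).re + δ/(2*Real.pi)) * |x| := by
    have e : (Real.pi * (p.2.1 - om - Complex.I*x)/p.1) =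
        Real.pi * (p.2.1 - om)/p.1 - Complex.I * ((Real.pi * x : ℝ) * (1/p.1)) := by
      push_cast; ring
    rw [e, Complex.sub_im]
    have : (Complex.I * ((Real.pi * x : ℝ) * (1/p.1))).im = Real.pi * x * (1/p.1).re := by
      rw [Complex.I_mul_im, Complex.re_ofReal_mul]
    rw [this]
    refine (abs_sub _ _).trans (add_le_add e3.le ?_)
    rw [abs_mul, abs_mul, abs_of_pos Real.pi_pos]
    have hpos : 0 < (1/p.1).re := by
      rw [one_div, Complex.inv_re]
      exact div_pos e1 (Complex.normSq_pos.2 (ne_zero_of_re_pos' e1))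
    rw [abs_of_pos hpos]
    have : Real.pi * |x| * (1/p.1).re ≤ Real.pi * |x| * ((1/op₀).re + δ/(2*Real.pi)) := by gcongr
    linarith
  have hs := (norm_sin_le _).trans (Real.exp_le_exp.2 him)
  calc _ ≤ 2 * (Real.exp (M + Real.pi * ((1/op₀).re + δ/(2*Real.pi)) * |x|) *
      (C * Real.exp ((δ/2 - Real.pi * ((op₀+om-a₁-a₂)/(op₀*om)).re) * |x|))) := by
        rw [Complex.norm_ofNat]
        gcongr
    _ = _ := by
        have e : (op₀+om-(a₁+om)-a₂)/(op₀*om) = (op₀+om-a₁-a₂)/(op₀*om) - 1/op₀ := by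
          field_simp; ring
        rw [e, Complex.sub_re]
        have : (δ - Real.pi * (((op₀+om-a₁-a₂)/(op₀*om)).re - (1/op₀).re)) * |x| =
          Real.pi * ((1/op₀).re + δ/(2*Real.pi)) * |x| +
            (δ/2 - Real.pi * ((op₀+om-a₁-a₂)/(op₀*om)).re) * |x| := by
          field_simp; ring
        rw [this, Real.exp_add M, Real.exp_add (Real.pi * ((1/op₀).re + δ/(2*Real.pi)) * |x|)]
        ring

theorem pairBound_of_pos (hG : IsHypGammaFamily G) {op₀ om : ℂ} (hop : 0 < op₀.re)
    (hom : 0 < om.re) (a₁ a₂ : ℂ) (h1 : 0 < a₁.re) (h2 : 0 < a₂.re) :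
    PairBound G op₀ om a₁ a₂ := by
  revert a₁
  refine strip_induction hom (W := op₀.re + om.re) (by linarith) ?_ ?_
  · intro a₁ h1 h1'
    revert a₂
    refine strip_induction hom (W := op₀.re + om.re) (by linarith) ?_ ?_
    · intro a₂ h2 h2' δ hδ
      exact hypH_pair_bound_strip hG hop hom h1 h1' h2 h2' hδ
    · intro a₂ h2 h
      exact (h.symm.add hG hop hom h2).symm
  · intro a₁ h1 h
    exact h.add hG hop hom h1

/-- The properties of `h(a) = G(i(a-ω))` on the right half plane. -/
structure HypH (op om : ℂ) (h : ℂ → ℂ) : Prop where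
  pop : 0 < op.re
  pom : 0 < om.re
  diff : ∀ a : ℂ, 0 < a.re → DifferentiableAt ℂ h a
  shm : ∀ a : ℂ, 0 < a.re → h (a+om) = 2 * Complex.sin (Real.pi * a / op) * h a
  shp : ∀ a : ℂ, 0 < a.re → h (a+op) = 2 * Complex.sin (Real.pi * a / om) * h a
  refl : ∀ a : ℂ, 0 < a.re → a.re < op.re + om.re → h a * h (op+om-a) = 1
  bound : ∀ a₁ a₂ : ℂ, 0 < a₁.re → 0 < a₂.re → ∀ δ : ℝ, 0 < δ → ∃ C : ℝ,
    ∀ᶠ p : ℂ × ℂ in 𝓝 (a₁, a₂), ∀ x : ℝ,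
      ‖h (p.1 - Complex.I*x) * h (p.2 + Complex.I*x)‖ ≤
        C * Real.exp ((δ - Real.pi * ((op+om-a₁-a₂)/(op*om)).re) * |x|)
  resm : op * h om = (op*om) ^ ((1:ℂ)/2)
  resp : om * h op = (op*om) ^ ((1:ℂ)/2)

theorem HypH.swap {op om : ℂ} {h : ℂ → ℂ} (H : HypH op om h) : HypH om op h where
  pop := H.pom
  pom := H.pop
  diff := H.diff
  shm := H.shp
  shp := H.shm
  refl := by
    intro a h0 h1
    rw [add_comm om op]; exact H.refl a h0 (by linarith)
  bound := by
    rw [add_comm om op, mul_comm om op]; exact H.bound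
  resm := by rw [mul_comm om op]; exact H.resp
  resp := by rw [mul_comm om op]; exact H.resm

theorem tendsto_sin_mul_div {c : ℂ} :
    Tendsto (fun e : ℝ => Complex.sin (c * e) / e) (𝓝[>] 0) (𝓝 c) := by
  have hd : HasDerivAt (fun e : ℝ => Complex.sin (c * e)) c 0 := by
    have h1 : HasDerivAt (fun e : ℂ => Complex.sin (c * e)) c ((0:ℝ):ℂ) := by
      have : HasDerivAt (fun e : ℂ => c * e) c ((0:ℝ):ℂ) := by
        simpa using (hasDerivAt_id ((0:ℝ):ℂ)).const_mul c
      simpa using this.csin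
    exact h1.comp_ofReal
  have := hd.tendsto_slope_zero_right
  refine this.congr fun e => ?_
  simp [div_eq_inv_mul]

theorem op_mul_eq_om_mul {op om : ℂ} {h : ℂ → ℂ} (pop : 0 < op.re) (pom : 0 < om.re)
    (diff : ∀ a : ℂ, 0 < a.re → DifferentiableAt ℂ h a)
    (shm : ∀ a : ℂ, 0 < a.re → h (a+om) = 2 * Complex.sin (Real.pi * a / op) * h a)
    (shp : ∀ a : ℂ, 0 < a.re → h (a+op) = 2 * Complex.sin (Real.pi * a / om) * h a) :
    op * h om = om * h op := by
  have hne := ne_zero_of_re_pos' pop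
  have hne' := ne_zero_of_re_pos' pom
  have hc : ∀ c : ℂ, 0 < c.re → Tendsto (fun e : ℝ => h (e + c)) (𝓝[>] 0) (𝓝 (h c)) := by
    intro c hc
    have : ContinuousAt (fun e : ℝ => h (e + c)) 0 :=
      ContinuousAt.comp (g := h) (f := fun e : ℝ => (e:ℂ) + c) (by simpa using (diff c hc).continuousAt)
        (by fun_prop)
    have := this.tendsto
    simp only [Complex.ofReal_zero, zero_add] at this
    exact this.mono_left nhdsWithin_le_nhds
  have h1 := (hc om pom).mul (tendsto_sin_mul_div (c := Real.pi / om))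
  have h2 := (hc op pop).mul (tendsto_sin_mul_div (c := Real.pi / op))
  have := tendsto_nhds_unique_of_eventuallyEq h1 h2 (by
    filter_upwards [self_mem_nhdsWithin] with e he
    have he : 0 < ((e:ℝ):ℂ).re := by simpa using he
    rw [shm _ he, shp _ he]
    ring_nf)
  have hpi : (Real.pi : ℂ) ≠ 0 := by exact_mod_cast Real.pi_ne_zero
  field_simp at this
  linear_combination this

theorem mul_mem_slitPlane {a b : ℂ} (ha : 0 < a.re) (hb : 0 < b.re) : a * b ∈ Complex.slitPlane := by
  rw [Complex.mem_slitPlane_iff]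
  by_contra hcon
  push Not at hcon
  obtain ⟨h1, h2⟩ := hcon
  rw [Complex.mul_re] at h1
  rw [Complex.mul_im] at h2
  have h3 : a.re * (b.re^2 + b.im^2) ≤ 0 := by
    have h3 := mul_le_mul_of_nonneg_left h1 hb.le
    have h4 : b.im * (a.re * b.im + a.im * b.re) = 0 := by rw [h2, mul_zero]
    linarith
  nlinarith [mul_pos ha (show 0 < b.re^2 + b.im^2 by positivity)]

theorem cpow_half_sq (z : ℂ) : (z ^ ((1:ℂ)/2))^2 = z := by
  rw [← Complex.cpow_mul_nat]; norm_num

theorem hypH_res (hG : IsHypGammaFamily G) {op om : ℂ} (hop : 0 < op.re) (hom : 0 < om.re) :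
    op * hypH G op om om = (op*om) ^ ((1:ℂ)/2) := by
  have hsq : ∀ p : ℂ, 0 < p.re → (p * hypH G p om om)^2 = ((p*om) ^ ((1:ℂ)/2))^2 := by
    intro p hp
    have e1 := op_mul_eq_om_mul (h := hypH G p om) hp hom
      (fun a ha => differentiableAt_hypH hG hp hom a ha)
      (fun a ha => hypH_add_om hG hp hom ha) (fun a ha => hypH_add_op hG hp hom ha)
    have e2 := hypH_refl hG hp hom hom (by linarith)
    rw [add_sub_cancel_right] at e2
    rw [cpow_half_sq, sq]
    nth_rewrite 2 [e1]
    linear_combination p*om*e2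
  let S : Set ℂ := {p : ℂ | 0 < p.re}
  have hS : IsPreconnected S := (convex_halfSpace_re_gt 0).isPreconnected
  have hc1 : ContinuousOn (fun p => p * hypH G p om om) S := by
    intro p hp
    have h1 : ContinuousAt (fun p : ℂ => hypH G p om om) p :=
      ContinuousAt.comp (g := fun q : ℂ × ℂ => hypH G q.1 om q.2)
        (f := fun p : ℂ => (p, om)) (x := p)
        (continuousAt_hypH_joint hG hp hom om hom)
        (Continuous.continuousAt (by fun_prop))
    exact (continuousAt_id.mul h1).continuousWithinAt
  have hc2 : ContinuousOn (fun p : ℂ => (p*om) ^ ((1:ℂ)/2)) S := by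
    intro p hp
    exact (ContinuousAt.cpow (f := fun p : ℂ => p*om) (g := fun _ => (1:ℂ)/2) (by fun_prop)
      (by fun_prop) (mul_mem_slitPlane hp hom)).continuousWithinAt
  refine hS.eq_of_sq_eq hc1 hc2 (fun p hp => hsq p hp) ?_ (y := om) hom ?_ hop
  · intro p hp h0
    have := cpow_half_sq (p*om)
    rw [h0] at this
    have h2 : p * om ≠ 0 := mul_ne_zero (ne_zero_of_re_pos' hp) (ne_zero_of_re_pos' hom)
    exact h2 (by rw [← this]; simp)
  · have e1 : hypH G om om om = 1 := by
      rw [hypH_strip hG hom hom hom (by linarith)]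
      have : (om+om)/2 - om = 0 := by ring
      rw [this]
      have h0 := gammaExp_neg om om 0
      rw [neg_zero] at h0
      have : gammaExp om om 0 = 0 := by linear_combination h0/2
      rw [this, Complex.exp_zero]
    simp only [e1, mul_one]
    rw [← sq, ← Complex.cpow_nat_mul' ] <;> norm_num
    all_goals
      have := Complex.abs_arg_lt_pi_div_two_iff.2 (Or.inl hom)
      rw [abs_lt] at this
      linarith

theorem isHypH (hG : IsHypGammaFamily G) {op om : ℂ} (hop : 0 < op.re) (hom : 0 < om.re) :
    HypH op om (hypH G op om) where
  pop := hop
  pom := hom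
  diff := fun a ha => differentiableAt_hypH hG hop hom a ha
  shm := fun a ha => hypH_add_om hG hop hom ha
  shp := fun a ha => hypH_add_op hG hop hom ha
  refl := fun a h0 h1 => hypH_refl hG hop hom h0 h1
  bound := by
    intro a₁ a₂ h1 h2 δ hδ
    obtain ⟨C, hC⟩ := pairBound_of_pos hG hop hom a₁ a₂ h1 h2 δ hδ
    exact ⟨C, (show ContinuousAt (fun p : ℂ × ℂ => (op, p.1, p.2)) (a₁, a₂) by
      fun_prop).eventually hC⟩
  resm := hypH_res hG hop hom
  resp := by
    rw [← hypH_res hG hop hom]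
    exact (op_mul_eq_om_mul (h := hypH G op om) hop hom
      (fun a ha => differentiableAt_hypH hG hop hom a ha)
      (fun a ha => hypH_add_om hG hop hom ha) (fun a ha => hypH_add_op hG hop hom ha)).symm

end

section

open Filter Topology

variable {G : ℂ → ℂ → ℂ → ℂ}

/-- The symmetric kernel of the exponent of the hyperbolic gamma function. -/
def gammaKerSymm (op om b : ℂ) (y : ℝ) : ℂ :=
  (1/(2*(y:ℂ))) * (Complex.sinh (2*y*b) / (Complex.sinh (op*y) * Complex.sinh (om*y))
    - 2*b/(op*om*y))

theorem gammaKerSymm_eq {op om : ℂ} (b : ℂ) (hop : 0 < op.re) (hom : 0 < om.re) {y : ℝ}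
    (hy : 0 < y) :
    (1/2) * gammaKer op om b y + b/(op*om) * ((1/(y:ℂ)) * (1/Complex.sinh y - 1/(y:ℂ))) =
      gammaKerSymm op om b y := by
  have h1 := sinh_mul_ne_zero hop hy
  have h2 := sinh_mul_ne_zero hom hy
  have h3 := sinh_mul_ne_zero (a := 1) (by simp) hy
  rw [one_mul] at h3
  have hop' := ne_zero_of_re_pos' hop
  have hom' := ne_zero_of_re_pos' hom
  have hy' : (y:ℂ) ≠ 0 := by exact_mod_cast hy.ne'
  unfold gammaKer gammaKerSymm
  field_simp
  ring

theorem integrableOn_gammaKerSymm {op om b : ℂ} (hop : 0 < op.re) (hom : 0 < om.re)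
    (hb : |b.re| < (op.re + om.re)/2) : IntegrableOn (gammaKerSymm op om b) (Ioi 0) := by
  have := ((integrableOn_gammaKer hop hom hb).const_mul (1/2)).add
    (integrableOn_gammaConst.const_mul (b/(op*om)))
  exact IntegrableOn.congr_fun this (fun _ hy => gammaKerSymm_eq b hop hom hy) measurableSet_Ioi

theorem gammaExp_eq_integral {op om b : ℂ} (hop : 0 < op.re) (hom : 0 < om.re)
    (hb : |b.re| < (op.re + om.re)/2) :
    gammaExp op om b = ∫ y in Ioi (0:ℝ), gammaKerSymm op om b y := by
  unfold gammaExp gammaConst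
  rw [← integral_const_mul, ← integral_const_mul, ← integral_add
    ((integrableOn_gammaKer hop hom hb).const_mul (1/2))
    (integrableOn_gammaConst.const_mul (b/(op*om)))]
  exact setIntegral_congr_fun measurableSet_Ioi fun y hy => gammaKerSymm_eq b hop hom hy

theorem gammaKerSymm_sum {op om : ℂ} (b : ℂ) (hop : 0 < op.re) (hom : 0 < om.re) {y : ℝ}
    (hy : 0 < y) :
    gammaKerSymm op om (b/2 + (op+om)/4) y + gammaKerSymm op om (b/2 + (om-op)/4) y
      + gammaKerSymm op om (b/2 + (op-om)/4) y + gammaKerSymm op om (b/2 - (op+om)/4) y =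
      (1/2) * gammaKerSymm op om b ((1/2)*y) := by
  have h1 := sinh_mul_ne_zero hop hy
  have h2 := sinh_mul_ne_zero hom hy
  have h3 := sinh_mul_ne_zero hop (y := (1/2)*y) (by positivity)
  have h4 := sinh_mul_ne_zero hom (y := (1/2)*y) (by positivity)
  have hop' := ne_zero_of_re_pos' hop
  have hom' := ne_zero_of_re_pos' hom
  have hy' : (y:ℂ) ≠ 0 := by exact_mod_cast hy.ne'
  have e1 : op * y = 2 * (op * ((1/2)*y : ℝ)) := by push_cast; ring
  have e2 : om * y = 2 * (om * ((1/2)*y : ℝ)) := by push_cast; ring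
  rw [e1, Complex.sinh_two_mul] at h1
  rw [e2, Complex.sinh_two_mul] at h2
  have c1 := right_ne_zero_of_mul h1
  have c2 := right_ne_zero_of_mul h2
  have es : Complex.sinh (2*y*(b/2 + (op+om)/4)) + Complex.sinh (2*y*(b/2 + (om-op)/4))
      + Complex.sinh (2*y*(b/2 + (op-om)/4)) + Complex.sinh (2*y*(b/2 - (op+om)/4)) =
      4 * Complex.sinh (2*((1/2)*y : ℝ)*b) * Complex.cosh (op * ((1/2)*y : ℝ)) *
        Complex.cosh (om * ((1/2)*y : ℝ)) := by
    have a1 : 2*y*(b/2 + (op+om)/4) = 2*((1/2)*y : ℝ)*b + op * ((1/2)*y : ℝ) + om * ((1/2)*y : ℝ) := by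
      push_cast; ring
    have a2 : 2*y*(b/2 + (om-op)/4) = 2*((1/2)*y : ℝ)*b - op * ((1/2)*y : ℝ) + om * ((1/2)*y : ℝ) := by
      push_cast; ring
    have a3 : 2*y*(b/2 + (op-om)/4) = 2*((1/2)*y : ℝ)*b + op * ((1/2)*y : ℝ) - om * ((1/2)*y : ℝ) := by
      push_cast; ring
    have a4 : 2*y*(b/2 - (op+om)/4) = 2*((1/2)*y : ℝ)*b - op * ((1/2)*y : ℝ) - om * ((1/2)*y : ℝ) := by
      push_cast; ring
    rw [a1, a2, a3, a4]
    simp only [Complex.sinh_add, Complex.sinh_sub, Complex.cosh_add, Complex.cosh_sub]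
    ring
  have : gammaKerSymm op om (b/2 + (op+om)/4) y + gammaKerSymm op om (b/2 + (om-op)/4) y
      + gammaKerSymm op om (b/2 + (op-om)/4) y + gammaKerSymm op om (b/2 - (op+om)/4) y =
      (1/(2*(y:ℂ))) * ((Complex.sinh (2*y*(b/2 + (op+om)/4)) + Complex.sinh (2*y*(b/2 + (om-op)/4))
      + Complex.sinh (2*y*(b/2 + (op-om)/4)) + Complex.sinh (2*y*(b/2 - (op+om)/4))) /
        (Complex.sinh (op*y) * Complex.sinh (om*y)) - 4*b/(op*om*y)) := by
    unfold gammaKerSymm; ring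
  rw [this, es, e1, e2, Complex.sinh_two_mul, Complex.sinh_two_mul]
  unfold gammaKerSymm
  set S := Complex.sinh (2*((1/2)*y : ℝ)*b)
  set A := Complex.sinh (op * ((1/2)*y : ℝ))
  set B := Complex.sinh (om * ((1/2)*y : ℝ))
  set D := Complex.cosh (op * ((1/2)*y : ℝ))
  set F := Complex.cosh (om * ((1/2)*y : ℝ))
  push_cast
  field_simp
  ring

theorem hypH_dup_strip (hG : IsHypGammaFamily G) {op om a : ℂ} (hop : 0 < op.re) (hom : 0 < om.re)
    (h0 : 0 < a.re) (h1 : a.re < op.re + om.re) :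
    hypH G op om a = hypH G op om (a/2) * hypH G op om (a/2 + op/2) *
      hypH G op om (a/2 + om/2) * hypH G op om (a/2 + (op+om)/2) := by
  have r0 : (a/2).re = a.re/2 := by simp
  have r1 : (op/2).re = op.re/2 := by simp
  have r2 : (om/2).re = om.re/2 := by simp
  have r3 : ((op+om)/2).re = (op.re+om.re)/2 := by simp
  have k0 := hypH_strip hG hop hom h0 h1
  have k1 := hypH_strip hG hop hom (a := a/2) (by linarith) (by linarith)
  have k2 := hypH_strip hG hop hom (a := a/2+op/2) (by rw [Complex.add_re]; linarith)
    (by rw [Complex.add_re]; linarith)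
  have k3 := hypH_strip hG hop hom (a := a/2+om/2) (by rw [Complex.add_re]; linarith)
    (by rw [Complex.add_re]; linarith)
  have k4 := hypH_strip hG hop hom (a := a/2+(op+om)/2) (by rw [Complex.add_re]; linarith)
    (by rw [Complex.add_re]; linarith)
  have s0 := strip_abs h0 h1
  have s1 := strip_abs (op := op) (om := om) (a := a/2) (by linarith) (by linarith)
  have s2 := strip_abs (op := op) (om := om) (a := a/2+op/2) (by rw [Complex.add_re]; linarith)
    (by rw [Complex.add_re]; linarith)
  have s3 := strip_abs (op := op) (om := om) (a := a/2+om/2) (by rw [Complex.add_re]; linarith)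
    (by rw [Complex.add_re]; linarith)
  have s4 := strip_abs (op := op) (om := om) (a := a/2+(op+om)/2) (by rw [Complex.add_re]; linarith)
    (by rw [Complex.add_re]; linarith)
  set b := (op+om)/2 - a with hb
  have e1 : (op+om)/2 - a/2 = b/2 + (op+om)/4 := by rw [hb]; ring
  have e2 : (op+om)/2 - (a/2+op/2) = b/2 + (om-op)/4 := by rw [hb]; ring
  have e3 : (op+om)/2 - (a/2+om/2) = b/2 + (op-om)/4 := by rw [hb]; ring
  have e4 : (op+om)/2 - (a/2+(op+om)/2) = b/2 - (op+om)/4 := by rw [hb]; ring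
  rw [e1] at k1 s1
  rw [e2] at k2 s2
  rw [e3] at k3 s3
  rw [e4] at k4 s4
  rw [k0, k1, k2, k3, k4, ← Complex.exp_add, ← Complex.exp_add, ← Complex.exp_add]
  congr 1
  have i1 := integrableOn_gammaKerSymm hop hom s1
  have i2 := integrableOn_gammaKerSymm hop hom s2
  have i3 := integrableOn_gammaKerSymm hop hom s3
  have i4 := integrableOn_gammaKerSymm hop hom s4
  rw [gammaExp_eq_integral hop hom s0, gammaExp_eq_integral hop hom s1,
    gammaExp_eq_integral hop hom s2, gammaExp_eq_integral hop hom s3,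
    gammaExp_eq_integral hop hom s4]
  have hc := integral_comp_mul_left_Ioi (fun y => (1/2:ℂ) * gammaKerSymm op om b y) 0
    (b := 1/2) (by norm_num)
  rw [mul_zero, integral_const_mul] at hc
  have e : ∫ y in Ioi (0:ℝ), gammaKerSymm op om b y =
      ∫ y in Ioi (0:ℝ), (1/2:ℂ) * gammaKerSymm op om b ((1/2)*y) := by
    rw [integral_const_mul, hc, integral_const_mul, Complex.real_smul]
    push_cast
    ring
  have i12 : IntegrableOn (fun y => gammaKerSymm op om (b/2 + (op+om)/4) y +
      gammaKerSymm op om (b/2 + (om-op)/4) y) (Ioi 0) := i1.add i2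
  have i123 : IntegrableOn (fun y => gammaKerSymm op om (b/2 + (op+om)/4) y +
      gammaKerSymm op om (b/2 + (om-op)/4) y + gammaKerSymm op om (b/2 + (op-om)/4) y) (Ioi 0) :=
    i12.add i3
  rw [e, ← integral_add i1 i2, ← integral_add i12 i3, ← integral_add i123 i4]
  exact setIntegral_congr_fun measurableSet_Ioi fun y hy => (gammaKerSymm_sum b hop hom hy).symm

theorem hypH_dup (hG : IsHypGammaFamily G) {op om : ℂ} (hop : 0 < op.re) (hom : 0 < om.re)
    (a : ℂ) (h0 : 0 < a.re) :
    hypH G op om a = hypH G op om (a/2) * hypH G op om (a/2 + op/2) *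
      hypH G op om (a/2 + om/2) * hypH G op om (a/2 + (op+om)/2) := by
  revert a
  refine strip_induction hom (W := op.re + om.re) (by linarith)
    (fun a h0 h1 => hypH_dup_strip hG hop hom h0 h1) ?_
  intro a h0 ih
  have e1 : (a+om)/2 = a/2 + om/2 := by ring
  have e2 : a/2 + om/2 + op/2 = a/2 + (op+om)/2 := by ring
  have e3 : a/2 + om/2 + om/2 = a/2 + om := by ring
  have e4 : a/2 + om/2 + (op+om)/2 = a/2 + op/2 + om := by ring
  have hne := ne_zero_of_re_pos' hop
  rw [hypH_add_om hG hop hom h0, e1, e2, e3, e4,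
    hypH_add_om hG hop hom (a := a/2) (by simpa using h0),
    hypH_add_om hG hop hom (a := a/2+op/2) (by simp; linarith), ih]
  have e5 : Real.pi * (a/2+op/2) / op = Real.pi * (a/2) / op + Real.pi/2 := by field_simp
  have e6 : Real.pi * a / op = 2 * (Real.pi * (a/2) / op) := by field_simp
  rw [e5, Complex.sin_add_pi_div_two, e6, Complex.sin_two_mul]
  ring

namespace HypH

variable {op om : ℂ} {h : ℂ → ℂ}

theorem ne_zero_aux (H : HypH op om h) (a : ℂ) (ha : 0 < a.re) :
    (∀ j k : ℕ, 1 ≤ j → 1 ≤ k → a ≠ j * op + k * om) → h a ≠ 0 := by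
  revert a
  refine strip_induction H.pom (W := op.re + om.re) (by linarith [H.pop]) ?_ ?_
  · intro a h0 h1 _ hz
    have := H.refl a h0 h1
    rw [hz, zero_mul] at this
    exact zero_ne_one this
  · intro a h0 ih hn
    have hop := ne_zero_of_re_pos' H.pop
    rw [H.shm a h0]
    refine mul_ne_zero (mul_ne_zero two_ne_zero ?_) (ih ?_)
    · intro hs
      rw [Complex.sin_eq_zero_iff] at hs
      obtain ⟨k, hk⟩ := hs
      have hpi : (Real.pi : ℂ) ≠ 0 := by exact_mod_cast Real.pi_ne_zero
      have hk : a = k * op := by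
        field_simp at hk
        linear_combination hk
      have hkp : 0 < k := by
        rw [hk] at h0
        have : ((k:ℂ)*op).re = k * op.re := by simp
        rw [this] at h0
        have := pos_of_mul_pos_left h0 H.pop.le
        exact_mod_cast this
      lift k to ℕ using hkp.le
      refine hn k 1 (by exact_mod_cast hkp) le_rfl ?_
      rw [hk]; push_cast; ring
    · intro j k hj hk e
      refine hn j (k+1) hj (by omega) ?_
      rw [e]; push_cast; ring

theorem ne_zero_of_re (H : HypH op om h) {a : ℂ} (ha : 0 < a.re)
    (h2 : 0 < ((op+om-a)/(op*om)).re) : h a ≠ 0 := by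
  refine H.ne_zero_aux a ha ?_
  rintro j k hj hk rfl
  have hop := ne_zero_of_re_pos' H.pop
  have hom := ne_zero_of_re_pos' H.pom
  have e : (op + om - (j*op+k*om))/(op*om) = ((1 - j : ℝ):ℂ) * om⁻¹ + ((1 - k : ℝ):ℂ) * op⁻¹ := by
    push_cast; field_simp; ring
  rw [e, Complex.add_re, Complex.re_ofReal_mul, Complex.re_ofReal_mul, Complex.inv_re,
    Complex.inv_re] at h2
  have p1 := div_pos H.pop (Complex.normSq_pos.2 hop)
  have p2 := div_pos H.pom (Complex.normSq_pos.2 hom)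
  have hj' : (1:ℝ) ≤ j := by exact_mod_cast hj
  have hk' : (1:ℝ) ≤ k := by exact_mod_cast hk
  nlinarith

theorem countable_zeros (H : HypH op om h) : {a : ℂ | 0 < a.re ∧ h a = 0}.Countable := by
  refine (countable_range (fun p : ℕ × ℕ => (p.1:ℂ) * op + p.2 * om)).mono ?_
  rintro a ⟨ha, hz⟩
  by_contra hn
  refine H.ne_zero_aux a ha ?_ hz
  intro j k _ _ e
  exact hn ⟨(j,k), e.symm⟩

theorem continuousAt (H : HypH op om h) {a : ℂ} (ha : 0 < a.re) : ContinuousAt h a :=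
  (H.diff a ha).continuousAt

theorem four_sinh_mul_sinh (H : HypH op om h) (x : ℝ) :
    h (op+om - 2*Complex.I*x) * h (op+om+2*Complex.I*x) =
      4 * Complex.sinh (2*Real.pi*x/op) * Complex.sinh (2*Real.pi*x/om) := by
  have hop := ne_zero_of_re_pos' H.pop
  have hom := ne_zero_of_re_pos' H.pom
  have pp := H.pop
  have pm := H.pom
  have e1 : op+om - 2*Complex.I*x = (om - 2*Complex.I*x) + op := by ring
  have e2 : op+om + 2*Complex.I*x = (op + 2*Complex.I*x) + om := by ring
  rw [e1, e2, H.shp _ (by simpa), H.shm _ (by simpa)]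
  have h1 := H.refl (om - 2*Complex.I*x) (by simpa) (by simpa)
  have e3 : op + om - (om - 2*Complex.I*x) = op + 2*Complex.I*x := by ring
  rw [e3] at h1
  have e4 : Real.pi * (om - 2*Complex.I*x) / om = Real.pi - (2*Real.pi*x/om) * Complex.I := by
    field_simp
  have e5 : Real.pi * (op + 2*Complex.I*x) / op = (2*Real.pi*x/op) * Complex.I + Real.pi := by
    field_simp
    ring
  rw [e4, e5, Complex.sin_pi_sub, Complex.sin_add_pi, Complex.sin_mul_I, Complex.sin_mul_I]
  linear_combination (-4 * Complex.sinh (2*Real.pi*x/om) * Complex.sinh (2*Real.pi*x/op) *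
    Complex.I^2) * h1 - 4 * Complex.sinh (2*Real.pi*x/om) * Complex.sinh (2*Real.pi*x/op) * Complex.I_sq

end HypH

end

section

open Filter Topology

/-- `f i` has exponential growth rate at most `c` on the real line, uniformly along `l`,
up to arbitrarily small losses. -/
def ExpBound {ι : Type*} (l : Filter ι) (f : ι → ℝ → ℂ) (c : ℝ) : Prop :=
  ∀ δ : ℝ, 0 < δ → ∃ C : ℝ, ∀ᶠ i in l, ∀ x : ℝ, ‖f i x‖ ≤ C * Real.exp ((c+δ) * |x|)

theorem integrable_exp_neg_mul_abs {r : ℝ} (hr : r < 0) :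
    Integrable (fun x : ℝ => Real.exp (r * |x|)) := by
  have h1 : IntegrableOn (fun x : ℝ => Real.exp (r * |x|)) (Ioi 0) := by
    refine (integrableOn_exp_mul_Ioi hr 0).congr_fun (fun x hx => ?_) measurableSet_Ioi
    simp [abs_of_pos (show (0:ℝ) < x from hx)]
  have h2 : IntegrableOn (fun x : ℝ => Real.exp (r * |x|)) (Iic 0) := by
    refine (integrableOn_exp_mul_Iic (a := -r) (by linarith) 0).congr_fun (fun x hx => ?_)
      measurableSet_Iic
    simp [abs_of_nonpos (show x ≤ (0:ℝ) from hx)]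
  rw [← integrableOn_univ, ← Iic_union_Ioi (a := (0:ℝ))]
  exact h2.union h1

namespace ExpBound

variable {ι κ : Type*} {l : Filter ι} {f g : ι → ℝ → ℂ} {c d : ℝ}

theorem mono (hf : ExpBound l f c) (h : c ≤ d) : ExpBound l f d := by
  intro δ hδ
  obtain ⟨C, hC⟩ := hf (δ + (d-c)) (by linarith)
  exact ⟨C, hC.mono fun i hi x => by convert hi x using 3; ring⟩

theorem exists_pos (hf : ExpBound l f c) {δ : ℝ} (hδ : 0 < δ) :
    ∃ C : ℝ, 0 < C ∧ ∀ᶠ i in l, ∀ x : ℝ, ‖f i x‖ ≤ C * Real.exp ((c+δ) * |x|) := by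
  obtain ⟨C, hC⟩ := hf δ hδ
  refine ⟨max C 1, by positivity, hC.mono fun i hi x => (hi x).trans ?_⟩
  gcongr
  exact le_max_left _ _

theorem congr (hf : ExpBound l f c) (h : ∀ᶠ i in l, ∀ x, f i x = g i x) : ExpBound l g c := by
  intro δ hδ
  obtain ⟨C, hC⟩ := hf δ hδ
  refine ⟨C, ?_⟩
  filter_upwards [hC, h] with i hi he x
  rw [← he]; exact hi x

theorem of_norm_le (hf : ExpBound l f c) (h : ∀ᶠ i in l, ∀ x, ‖g i x‖ ≤ ‖f i x‖) :
    ExpBound l g c := by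
  intro δ hδ
  obtain ⟨C, hC⟩ := hf δ hδ
  refine ⟨C, ?_⟩
  filter_upwards [hC, h] with i hi he x
  exact (he x).trans (hi x)

theorem mul (hf : ExpBound l f c) (hg : ExpBound l g d) :
    ExpBound l (fun i x => f i x * g i x) (c+d) := by
  intro δ hδ
  obtain ⟨C, hC0, hC⟩ := hf.exists_pos (half_pos hδ)
  obtain ⟨D, hD0, hD⟩ := hg.exists_pos (half_pos hδ)
  refine ⟨C*D, ?_⟩
  filter_upwards [hC, hD] with i h1 h2 x
  rw [norm_mul]
  calc ‖f i x‖ * ‖g i x‖ ≤ (C * Real.exp ((c+δ/2) * |x|)) * (D * Real.exp ((d+δ/2) * |x|)) :=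
        mul_le_mul (h1 x) (h2 x) (norm_nonneg _) (by positivity)
    _ = C*D*(Real.exp ((c+δ/2) * |x|) * Real.exp ((d+δ/2) * |x|)) := by ring
    _ = _ := by rw [← Real.exp_add]; congr 2; ring

theorem one : ExpBound l (fun _ _ => (1:ℂ)) 0 := by
  intro δ hδ
  refine ⟨1, Eventually.of_forall fun i x => ?_⟩
  simp only [norm_one, zero_add, one_mul]
  exact Real.one_le_exp (by positivity)

theorem const {e : ι → ℂ} {e₀ : ℂ} (he : Tendsto e l (𝓝 e₀)) : ExpBound l (fun i _ => e i) 0 := by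
  intro δ hδ
  refine ⟨‖e₀‖ + 1, ?_⟩
  filter_upwards [he.norm.eventually_lt_const (lt_add_one ‖e₀‖)] with i hi x
  rw [zero_add]
  have : 1 ≤ Real.exp (δ * |x|) := Real.one_le_exp (by positivity)
  nlinarith [norm_nonneg e₀]

theorem pow (hf : ExpBound l f c) (n : ℕ) : ExpBound l (fun i x => f i x ^ n) (n*c) := by
  induction n with
  | zero => simpa using one
  | succ n ih =>
    simp only [pow_succ]
    convert ih.mul hf using 1
    push_cast; ring

theorem add (hf : ExpBound l f c) (hg : ExpBound l g c) :
    ExpBound l (fun i x => f i x + g i x) c := by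
  intro δ hδ
  obtain ⟨C, hC⟩ := hf δ hδ
  obtain ⟨D, hD⟩ := hg δ hδ
  refine ⟨C+D, ?_⟩
  filter_upwards [hC, hD] with i h1 h2 x
  rw [add_mul]
  exact (norm_add_le _ _).trans (add_le_add (h1 x) (h2 x))

theorem neg (hf : ExpBound l f c) : ExpBound l (fun i x => - f i x) c :=
  hf.of_norm_le (Eventually.of_forall fun i x => by simp)

theorem sub (hf : ExpBound l f c) (hg : ExpBound l g c) :
    ExpBound l (fun i x => f i x - g i x) c := by
  simpa only [sub_eq_add_neg] using hf.add hg.neg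

theorem comp {l' : Filter κ} {φ : κ → ι} (hf : ExpBound l f c) (hφ : Tendsto φ l' l) :
    ExpBound l' (fun k => f (φ k)) c := by
  intro δ hδ
  obtain ⟨C, hC⟩ := hf δ hδ
  exact ⟨C, hφ.eventually hC⟩

theorem multiset_prod {α : Type*} (A : Multiset α) {F : α → ι → ℝ → ℂ} {C : α → ℝ}
    (h : ∀ a ∈ A, ExpBound l (F a) (C a)) :
    ExpBound l (fun i x => (A.map fun a => F a i x).prod) (A.map C).sum := by
  induction A using Multiset.induction_on with
  | empty => simpa using one
  | cons a A ih =>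
    simp only [Multiset.map_cons, Multiset.prod_cons, Multiset.sum_cons]
    exact (h a (by simp)).mul (ih fun b hb => h b (by simp [hb]))

theorem exists_integrable (hf : ExpBound l f c) (hc : c < 0) :
    ∃ g : ℝ → ℝ, Integrable g ∧ ∀ᶠ i in l, ∀ x, ‖f i x‖ ≤ g x := by
  obtain ⟨C, hC⟩ := hf (-c/2) (by linarith)
  exact ⟨_, (integrable_exp_neg_mul_abs (r := c + -c/2) (by linarith)).const_mul C, hC⟩

theorem integrable {f : ℝ → ℂ} (hf : ExpBound (pure ()) (fun _ => f) c) (hc : c < 0)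
    (hm : AEStronglyMeasurable f) : Integrable f := by
  obtain ⟨g, hg, h⟩ := hf.exists_integrable hc
  exact hg.mono' hm (Eventually.of_forall (by simpa using h))

theorem of_mem {i : ι} (hf : ExpBound l f c) (hi : pure i ≤ l) :
    ExpBound (pure ()) (fun _ => f i) c := by
  refine hf.comp (φ := fun _ : Unit => i) ?_
  rwa [tendsto_pure_left]

theorem cosh {α β : ι → ℂ} {α₀ β₀ : ℂ} (hα : Tendsto α l (𝓝 α₀)) (hβ : Tendsto β l (𝓝 β₀)) :
    ExpBound l (fun i x => Complex.cosh (α i * x + β i)) |α₀.re| := by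
  intro δ hδ
  refine ⟨Real.exp (|β₀.re| + 1), ?_⟩
  have h1 : Tendsto (fun i => |(α i).re|) l (𝓝 |α₀.re|) :=
    ((Complex.continuous_re.tendsto _).comp hα).abs
  have h2 : Tendsto (fun i => |(β i).re|) l (𝓝 |β₀.re|) :=
    ((Complex.continuous_re.tendsto _).comp hβ).abs
  filter_upwards [h1.eventually_lt_const (lt_add_of_pos_right _ hδ),
    h2.eventually_lt_const (lt_add_one _)] with i h3 h4 x
  refine (norm_cosh_le _).trans ?_
  rw [← Real.exp_add]
  refine Real.exp_le_exp.2 ?_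
  have h5 : (α i * x + β i).re = (α i).re * x + (β i).re := by simp
  rw [h5]
  refine (abs_add_le _ _).trans ?_
  rw [abs_mul]
  nlinarith [abs_nonneg x]

theorem sinh {α β : ι → ℂ} {α₀ β₀ : ℂ} (hα : Tendsto α l (𝓝 α₀)) (hβ : Tendsto β l (𝓝 β₀)) :
    ExpBound l (fun i x => Complex.sinh (α i * x + β i)) |α₀.re| := by
  have h := cosh hα (hβ.add_const (Real.pi/2 * Complex.I))
  refine (h.mul (const (e := fun _ => -Complex.I) (e₀ := -Complex.I) tendsto_const_nhds)).congr
    (Eventually.of_forall fun i x => ?_) |>.mono (by simp)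
  have e : α i * x + (β i + Real.pi/2 * Complex.I) = (α i * x + β i) + Real.pi/2 * Complex.I := by
    ring
  simp only [e, Complex.cosh_add, Complex.cosh_mul_I, Complex.sinh_mul_I]
  have : (Real.pi:ℂ)/2 = ((Real.pi/2 : ℝ) : ℂ) := by push_cast; rfl
  rw [Complex.cos_pi_div_two, Complex.sin_pi_div_two]
  ring_nf
  simp

end ExpBound

theorem HypH.expBound {op om : ℂ} {h : ℂ → ℂ} (H : HypH op om h) {ι : Type*} {l : Filter ι}
    {a b : ι → ℂ} {a₀ b₀ : ℂ} (ha : Tendsto a l (𝓝 a₀)) (hb : Tendsto b l (𝓝 b₀))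
    (ha₀ : 0 < a₀.re) (hb₀ : 0 < b₀.re) :
    ExpBound l (fun i x => h (a i - Complex.I*x) * h (b i + Complex.I*x))
      (-Real.pi * ((op+om-a₀-b₀)/(op*om)).re) := by
  intro δ hδ
  obtain ⟨C, hC⟩ := H.bound a₀ b₀ ha₀ hb₀ δ hδ
  refine ⟨C, ?_⟩
  filter_upwards [(ha.prodMk_nhds hb).eventually hC] with i hi x
  convert hi x using 3
  ring

theorem integral_translate_eq {F : ℂ → ℂ} {S : Set ℂ} (hS : IsOpen S) (hc : Convex ℝ S)
    (hSt : ∀ w ∈ S, ∀ t : ℝ, w + t ∈ S) (hF : ∀ w ∈ S, DifferentiableAt ℂ F w)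
    (hdom : ∀ w₀ ∈ S, ∃ g : ℝ → ℝ, Integrable g ∧ ∀ᶠ w in 𝓝 w₀, ∀ x : ℝ, ‖F (w + x)‖ ≤ g x)
    {w₁ w₂ : ℂ} (h1 : w₁ ∈ S) (h2 : w₂ ∈ S) :
    ∫ x : ℝ, F (w₁ + x) = ∫ x : ℝ, F (w₂ + x) := by
  set Φ : ℂ → ℂ := fun w => ∫ x : ℝ, F (w + x) with hΦ
  have hd : ∀ w ∈ S, DifferentiableAt ℂ Φ w := by
    intro w₀ hw₀
    obtain ⟨g, hg, hb⟩ := hdom w₀ hw₀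
    refine differentiableAt_integral_of_dominated hg ?_ hb ?_
    · filter_upwards [hS.mem_nhds hw₀] with w hw
      refine Continuous.aestronglyMeasurable ?_
      refine continuous_iff_continuousAt.2 fun x => ?_
      exact ContinuousAt.comp (f := fun x : ℝ => w + (x:ℂ)) (g := F)
        (hF _ (hSt w hw x)).continuousAt (by fun_prop)
    · filter_upwards [hS.mem_nhds hw₀] with w hw x
      exact DifferentiableAt.comp (f := fun w : ℂ => w + (x:ℂ)) w (hF _ (hSt w hw x)) (by fun_prop)
  have ht : ∀ (w : ℂ) (t : ℝ), Φ (w + t) = Φ w := by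
    intro w t
    simp only [hΦ]
    rw [← integral_add_left_eq_self (fun x : ℝ => F (w + x)) t]
    congr 1; ext x; congr 1; push_cast; ring
  have hz : ∀ w ∈ S, deriv Φ w = 0 := by
    intro w hw
    have h3 : HasDerivAt (fun t : ℝ => Φ (w + t)) (deriv Φ w) 0 := by
      have := HasDerivAt.comp_ofReal (z := (0:ℝ)) (e := fun t : ℂ => Φ (w + t)) (e' := deriv Φ w) ?_
      · exact this
      · have h4 : HasDerivAt (fun t : ℂ => w + t) 1 ((0:ℝ):ℂ) := (hasDerivAt_id _).const_add w
        have h5 : HasDerivAt Φ (deriv Φ w) (w + ((0:ℝ):ℂ)) := by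
          simpa using (hd w hw).hasDerivAt
        have h6 := h5.comp _ h4
        rw [mul_one] at h6
        exact h6
    simp only [ht] at h3
    exact h3.unique (hasDerivAt_const _ _)
  refine hS.is_const_of_deriv_eq_zero hc.isPreconnected
    (fun w hw => (hd w hw).differentiableWithinAt) (fun w hw => hz w hw) h1 h2

end

section

open Filter Topology

theorem det_mul_det_mul_prod {n : ℕ} (f g : Fin n → ℝ → ℂ) (w : ℝ → ℂ) (x : Fin n → ℝ) :
    (Matrix.of fun i j => f i (x j)).det * (Matrix.of fun i j => g i (x j)).det * ∏ j, w (x j) =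
      ∑ σ : Equiv.Perm (Fin n), ∑ τ : Equiv.Perm (Fin n),
        ((Equiv.Perm.sign σ : ℤ) : ℂ) * ((Equiv.Perm.sign τ : ℤ) : ℂ) *
          ∏ j, (f (σ j) (x j) * g (τ j) (x j) * w (x j)) := by
  simp only [Matrix.det_apply', Matrix.of_apply, Finset.sum_mul]
  refine Finset.sum_congr rfl fun σ _ => ?_
  rw [Finset.mul_sum, Finset.sum_mul]
  refine Finset.sum_congr rfl fun τ _ => ?_
  simp only [Finset.prod_mul_distrib]
  ring

/-- Andréief's identity. -/
theorem andreief {n : ℕ} (f g : Fin n → ℝ → ℂ) (w : ℝ → ℂ)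
    (hint : ∀ i k, Integrable fun x => f i x * g k x * w x) :
    Integrable (fun x : Fin n → ℝ => (Matrix.of fun i j => f i (x j)).det *
        (Matrix.of fun i j => g i (x j)).det * ∏ j, w (x j)) ∧
      ∫ x : Fin n → ℝ, (Matrix.of fun i j => f i (x j)).det *
        (Matrix.of fun i j => g i (x j)).det * ∏ j, w (x j) =
      (n.factorial : ℂ) * (Matrix.of fun i k => ∫ x, f i x * g k x * w x).det := by
  simp only [det_mul_det_mul_prod]
  have hI : ∀ σ τ : Equiv.Perm (Fin n), Integrable (fun x : Fin n → ℝ =>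
      ((Equiv.Perm.sign σ : ℤ) : ℂ) * ((Equiv.Perm.sign τ : ℤ) : ℂ) *
          ∏ j, (f (σ j) (x j) * g (τ j) (x j) * w (x j))) := fun σ τ =>
    (Integrable.fintype_prod (μ := fun _ => volume)
      (f := fun j x => f (σ j) x * g (τ j) x * w x) fun j => hint _ _).const_mul _
  refine ⟨integrable_finsetSum _ fun σ _ => integrable_finsetSum _ fun τ _ => hI σ τ, ?_⟩
  rw [integral_finsetSum _ fun σ _ => integrable_finsetSum _ fun τ _ => hI σ τ]
  have h1 : ∀ σ : Equiv.Perm (Fin n), ∫ x : Fin n → ℝ, ∑ τ : Equiv.Perm (Fin n),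
        ((Equiv.Perm.sign σ : ℤ) : ℂ) * ((Equiv.Perm.sign τ : ℤ) : ℂ) *
          ∏ j, (f (σ j) (x j) * g (τ j) (x j) * w (x j)) =
      (Matrix.of fun i k => ∫ x, f i x * g k x * w x).det := by
    intro σ
    rw [integral_finsetSum _ fun τ _ => hI σ τ]
    have h2 : ((Matrix.of fun i k => ∫ x, f i x * g k x * w x).submatrix σ id).det =
        ((Equiv.Perm.sign σ : ℤ) : ℂ) * (Matrix.of fun i k => ∫ x, f i x * g k x * w x).det :=
      Matrix.det_permute _ _
    have h3 : ((Equiv.Perm.sign σ : ℤ) : ℂ) * ((Equiv.Perm.sign σ : ℤ) : ℂ) = 1 := by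
      rcases Int.units_eq_one_or (Equiv.Perm.sign σ) with h | h <;> simp [h]
    calc _ = ((Equiv.Perm.sign σ : ℤ) : ℂ) *
          ((Matrix.of fun i k => ∫ x, f i x * g k x * w x).submatrix σ id).det := by
          rw [← Matrix.det_transpose, Matrix.det_apply', Finset.mul_sum]
          refine Finset.sum_congr rfl fun τ _ => ?_
          rw [integral_const_mul,
            integral_fintype_prod_volume_eq_prod (fun j x => f (σ j) x * g (τ j) x * w x), mul_assoc]
          rfl
      _ = _ := by rw [h2, ← mul_assoc, h3, one_mul]
  rw [Finset.sum_congr rfl fun σ _ => h1 σ]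
  simp [Fintype.card_perm]

/-- If a row vector `r` annihilates an `(n+1) × n` matrix, its extreme maximal minors are
proportional to the extreme entries of `r`. -/
theorem extreme_minors {R : Type*} [CommRing R] {n : ℕ} (V : Matrix (Fin (n+1)) (Fin n) R)
    (r : Fin (n+1) → R) (h : ∀ j, ∑ i, r i * V i j = 0) :
    r (Fin.last n) * (V.submatrix Fin.succ id).det =
      (-1)^n * r 0 * (V.submatrix Fin.castSucc id).det := by
  set M : Matrix (Fin (n+1)) (Fin (n+1)) R :=
    Matrix.of fun i => Fin.cons (if i = Fin.last n then 1 else 0) (V i) with hM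
  have hr : Matrix.vecMul r M = fun j => if j = 0 then r (Fin.last n) else 0 := by
    ext j
    refine Fin.cases ?_ (fun k => ?_) j
    · simp [hM, Matrix.vecMul, dotProduct]
    · simp only [hM, Matrix.vecMul, dotProduct, Matrix.of_apply, Fin.cons_succ, h k]
      simp [Fin.succ_ne_zero]
  have hadj : ∀ i, M.adjugate 0 i = (-1)^(i:ℕ) * (V.submatrix i.succAbove id).det := by
    intro i
    rw [Matrix.adjugate_fin_succ_eq_det_submatrix]
    simp only [Fin.val_zero, add_zero]
    congr 1
  have key : Matrix.vecMul (Matrix.vecMul r M) M.adjugate = M.det • r := by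
    rw [Matrix.vecMul_vecMul, Matrix.mul_adjugate, Matrix.vecMul_smul, Matrix.vecMul_one]
  have k2 : ∀ i : Fin (n+1), r (Fin.last n) * ((-1)^(i:ℕ) * (V.submatrix i.succAbove id).det) =
      M.det * r i := by
    intro i
    have := congrFun key i
    rw [hr] at this
    simp only [Matrix.vecMul, dotProduct, ite_mul, zero_mul, Finset.sum_ite_eq',
      Finset.mem_univ, if_true, Pi.smul_apply, smul_eq_mul] at this
    rw [← hadj, ← this]
  have hdet : M.det = (-1)^n * (V.submatrix Fin.castSucc id).det := by
    rw [Matrix.det_succ_column_zero]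
    rw [Finset.sum_eq_single (Fin.last n)]
    · simp [hM]
      rfl
    · intro b _ hb
      simp [hM, hb]
    · simp
  have := k2 0
  simp only [Fin.val_zero, pow_zero, one_mul, Fin.succAbove_zero] at this
  rw [this, hdet]; ring

end

section

open Filter Topology

/-- The even weight `∏_{a ∈ A} h(a ± ix)`. -/
def hypWt (h : ℂ → ℂ) (A : Multiset ℂ) (x : ℂ) : ℂ :=
  (A.map fun a => h (a - Complex.I*x) * h (a + Complex.I*x)).prod

/-- The variable `2 cosh(2πx/ω)`. -/
def coshVar (op x : ℂ) : ℂ := 2 * Complex.cosh (2*Real.pi/op*x)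

/-- The density `4 sinh(2πx/ω₊) sinh(2πx/ω₋)`. -/
def sinhDens (op om x : ℂ) : ℂ :=
  4 * Complex.sinh (2*Real.pi/op*x) * Complex.sinh (2*Real.pi/om*x)

/-- The integrand of a moment with respect to the weight `W`. -/
def momKer (op om e d : ℂ) (i j : ℕ) (W : ℂ → ℂ) (x : ℂ) : ℂ :=
  (coshVar op x - e)^i * (coshVar om x - d)^j * (sinhDens op om x * W x)

/-- The determinant of moments of the weight `hypWt h A`. -/
def momDet (op om : ℂ) (h : ℂ → ℂ) (n : ℕ) (A : Multiset ℂ) : ℂ :=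
  (Matrix.of fun i k : Fin n => ∫ x : ℝ, momKer op om 0 0 i k (hypWt h A) x).det

/-- Admissible parameters. -/
def Adm (op om : ℂ) (A : Multiset ℂ) : Prop :=
  (∀ a ∈ A, 0 < a.re) ∧ 0 < ((op+om-A.sum)/(op*om)).re

theorem re_inv_pos {a : ℂ} (ha : 0 < a.re) : 0 < (1/a).re := by
  rw [one_div, Complex.inv_re]
  exact div_pos ha (Complex.normSq_pos.2 (ne_zero_of_re_pos' ha))

theorem re_add_div_mul {op om : ℂ} (hop : 0 < op.re) (hom : 0 < om.re) :
    ((op+om)/(op*om)).re = (1/op).re + (1/om).re := by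
  rw [← Complex.add_re]
  have := ne_zero_of_re_pos' hop
  have := ne_zero_of_re_pos' hom
  congr 1
  field_simp
  ring

theorem hypWt_cons (h : ℂ → ℂ) (a : ℂ) (A : Multiset ℂ) (x : ℂ) :
    hypWt h (a ::ₘ A) x = h (a - Complex.I*x) * h (a + Complex.I*x) * hypWt h A x := by
  simp [hypWt]

theorem hypWt_neg (h : ℂ → ℂ) (A : Multiset ℂ) (x : ℂ) : hypWt h A (-x) = hypWt h A x := by
  simp only [hypWt]
  congr 2
  ext a
  rw [mul_comm]
  ring_nf

theorem coshVar_neg (op x : ℂ) : coshVar op (-x) = coshVar op x := by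
  simp [coshVar, Complex.cosh_neg]

theorem abs_two_pi_div_re {op : ℂ} (hop : 0 < op.re) :
    |(2*Real.pi/op : ℂ).re| = 2*Real.pi*(1/op).re := by
  have : (2*Real.pi/op : ℂ) = ((2*Real.pi : ℝ):ℂ) * (1/op) := by push_cast; ring
  rw [this, Complex.re_ofReal_mul, abs_of_pos]
  have := re_inv_pos hop
  positivity

section ExpBound
variable {ι : Type*} {l : Filter ι} {op : ι → ℂ} {op₀ om : ℂ} {c : ℝ}

theorem tendsto_two_pi_div (hop : Tendsto op l (𝓝 op₀)) (h0 : 0 < op₀.re) :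
    Tendsto (fun t => 2*Real.pi/op t) l (𝓝 (2*Real.pi/op₀)) :=
  tendsto_const_nhds.div hop (ne_zero_of_re_pos' h0)

theorem expBound_coshVar_sub (hop : Tendsto op l (𝓝 op₀)) (h0 : 0 < op₀.re) (e : ℂ) :
    ExpBound l (fun t x => coshVar (op t) x - e) (2*Real.pi*(1/op₀).re) := by
  have h1 := ExpBound.cosh (tendsto_two_pi_div hop h0)
    (tendsto_const_nhds (x := (0:ℂ)) (f := l))
  rw [abs_two_pi_div_re h0] at h1
  have h2 := (ExpBound.const (l := l) (tendsto_const_nhds (x := (2:ℂ)))).mul h1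
  have h3 := (ExpBound.const (l := l) (tendsto_const_nhds (x := e)))
  have := re_inv_pos h0
  rw [zero_add] at h2
  exact (h2.sub (h3.mono (by positivity))).congr
    (Eventually.of_forall fun t x => by simp [coshVar])

theorem expBound_sinhDens (hop : Tendsto op l (𝓝 op₀)) (h0 : 0 < op₀.re) (hom : 0 < om.re) :
    ExpBound l (fun t x => sinhDens (op t) om x) (2*Real.pi*((1/op₀).re + (1/om).re)) := by
  have h1 := ExpBound.sinh (tendsto_two_pi_div hop h0)
    (tendsto_const_nhds (x := (0:ℂ)) (f := l))
  have h2 := ExpBound.sinh (tendsto_two_pi_div (tendsto_const_nhds (x := om) (f := l)) hom)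
    (tendsto_const_nhds (x := (0:ℂ)) (f := l))
  rw [abs_two_pi_div_re h0] at h1
  rw [abs_two_pi_div_re hom] at h2
  refine (((ExpBound.const (l := l) (tendsto_const_nhds (x := (4:ℂ)))).mul h1).mul h2).congr
    (Eventually.of_forall fun t x => by simp [sinhDens]) |>.mono (by linarith)

theorem expBound_momKer (hop : Tendsto op l (𝓝 op₀)) (h0 : 0 < op₀.re) (hom : 0 < om.re)
    (e d : ℂ) (i j : ℕ) {W : ι → ℂ → ℂ} (hW : ExpBound l (fun t x => W t x) c) :
    ExpBound l (fun t x => momKer (op t) om e d i j (W t) x)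
      (2*Real.pi*((i+1)*(1/op₀).re + (j+1)*(1/om).re) + c) := by
  refine ((((expBound_coshVar_sub hop h0 e).pow i).mul
    ((expBound_coshVar_sub (tendsto_const_nhds (x := om)) hom d).pow j)).mul
      ((expBound_sinhDens hop h0 hom).mul hW)).mono (le_of_eq ?_)
  ring

end ExpBound

theorem sum_exponent {op om : ℂ} (hop : 0 < op.re) (hom : 0 < om.re) (A : Multiset ℂ) :
    (A.map fun a => -Real.pi * ((op+om-a-a)/(op*om)).re).sum =
      -Real.pi * (A.card * ((1/op).re + (1/om).re)) + 2*Real.pi*(A.sum/(op*om)).re := by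
  induction A using Multiset.induction_on with
  | empty => simp
  | cons a A ih =>
    rw [Multiset.map_cons, Multiset.sum_cons, ih, Multiset.card_cons, Multiset.sum_cons,
      sub_div, sub_div, Complex.sub_re, Complex.sub_re, re_add_div_mul hop hom, add_div a,
      Complex.add_re (a/_)]
    push_cast; ring

theorem momKer_exponent_neg {op om : ℂ} (hop : 0 < op.re) (hom : 0 < om.re) {A : Multiset ℂ}
    {n i j : ℕ} (hA : A.card = 2*n+2) (hA' : 0 < ((op+om-A.sum)/(op*om)).re)
    (hi : i < n) (hj : j < n) :
    2*Real.pi*((i+1)*(1/op).re + (j+1)*(1/om).re) +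
      (A.map fun a => -Real.pi * ((op+om-a-a)/(op*om)).re).sum < 0 := by
  rw [sum_exponent hop hom, hA]
  rw [sub_div, Complex.sub_re, re_add_div_mul hop hom] at hA'
  have h1 := re_inv_pos hop
  have h2 := re_inv_pos hom
  have hi' : (i:ℝ) + 1 ≤ n := by exact_mod_cast hi
  have hj' : (j:ℝ) + 1 ≤ n := by exact_mod_cast hj
  have h3 : ((i:ℝ)+1)*(1/op).re ≤ n*(1/op).re := by gcongr
  have h4 : ((j:ℝ)+1)*(1/om).re ≤ n*(1/om).re := by gcongr
  have h5 : 2*Real.pi*((i+1)*(1/op).re + (j+1)*(1/om).re) ≤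
      2*Real.pi*(n*(1/op).re + n*(1/om).re) := by gcongr
  have h6 : 0 < Real.pi * ((1/op).re + (1/om).re - (A.sum/(op*om)).re) := by positivity
  push_cast
  nlinarith

theorem tendsto_integral_of_expBound {ι : Type*} {l : Filter ι} [l.IsCountablyGenerated]
    {F : ι → ℝ → ℂ} {f : ℝ → ℂ} {c : ℝ} (hF : ExpBound l F c) (hc : c < 0)
    (hm : ∀ᶠ t in l, AEStronglyMeasurable (F t)) (hp : ∀ᵐ x, Tendsto (fun t => F t x) l (𝓝 (f x))) :
    Tendsto (fun t => ∫ x, F t x) l (𝓝 (∫ x, f x)) := by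
  obtain ⟨g, hg, hb⟩ := hF.exists_integrable hc
  exact tendsto_integral_filter_of_dominated_convergence g hm
    (hb.mono fun t ht => Eventually.of_forall ht) hg hp

theorem differentiableAt_integral_of_expBound {F : ℂ → ℝ → ℂ} {z₀ : ℂ} {c : ℝ}
    (hF : ExpBound (𝓝 z₀) F c) (hc : c < 0)
    (hm : ∀ᶠ z in 𝓝 z₀, Continuous (F z))
    (hd : ∀ᶠ z in 𝓝 z₀, ∀ x, DifferentiableAt ℂ (fun z => F z x) z) :
    DifferentiableAt ℂ (fun z => ∫ x, F z x) z₀ := by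
  obtain ⟨g, hg, hb⟩ := hF.exists_integrable hc
  exact differentiableAt_integral_of_dominated hg (hm.mono fun z hz => hz.aestronglyMeasurable) hb hd

theorem continuous_momKer_ofReal {op om e d : ℂ} (i j : ℕ) {W : ℂ → ℂ}
    (hW : Continuous fun x : ℝ => W x) : Continuous fun x : ℝ => momKer op om e d i j W x := by
  unfold momKer coshVar sinhDens
  exact Continuous.mul (by fun_prop) (Continuous.mul (by fun_prop) hW)

namespace HypH

variable {op om : ℂ} {h : ℂ → ℂ}

theorem continuous_hypWt (H : HypH op om h) {A : Multiset ℂ} (hA : ∀ a ∈ A, 0 < a.re) :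
    Continuous fun x : ℝ => hypWt h A x := by
  unfold hypWt
  refine continuous_multiset_prod (ι := ℂ) A (f := fun a (x:ℝ) => h (a - Complex.I*x) * h (a + Complex.I*x))
    fun a ha => ?_
  refine continuous_iff_continuousAt.2 fun x => ?_
  have h1 : ContinuousAt (fun x : ℝ => h (a - Complex.I*x)) x :=
    ContinuousAt.comp (g := h) (f := fun x : ℝ => a - Complex.I*x)
      (H.continuousAt (by simpa using hA a ha)) (by fun_prop)
  have h2 : ContinuousAt (fun x : ℝ => h (a + Complex.I*x)) x :=
    ContinuousAt.comp (g := h) (f := fun x : ℝ => a + Complex.I*x)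
      (H.continuousAt (by simpa using hA a ha)) (by fun_prop)
  exact h1.mul h2

theorem expBound_hypWt (H : HypH op om h) {ι : Type*} (l : Filter ι) {A : Multiset ℂ}
    (hA : ∀ a ∈ A, 0 < a.re) :
    ExpBound l (fun _ x => hypWt h A x)
      (A.map fun a => -Real.pi * ((op+om-a-a)/(op*om)).re).sum :=
  ExpBound.multiset_prod A fun a ha =>
    H.expBound tendsto_const_nhds tendsto_const_nhds (hA a ha) (hA a ha)

theorem expBound_hypWt_cons (H : HypH op om h) {A : Multiset ℂ} {z₀ : ℂ}
    (hA : ∀ a ∈ z₀ ::ₘ A, 0 < a.re) :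
    ExpBound (𝓝 z₀) (fun z x => hypWt h (z ::ₘ A) x)
      (Multiset.map (fun a => -Real.pi * ((op+om-a-a)/(op*om)).re) (z₀ ::ₘ A)).sum := by
  simp only [hypWt_cons, Multiset.map_cons, Multiset.sum_cons]
  exact (H.expBound tendsto_id tendsto_id (hA z₀ (by simp)) (hA z₀ (by simp))).mul
    (H.expBound_hypWt _ fun a ha => hA a (by simp [ha]))

theorem integrable_momKer (H : HypH op om h) {A : Multiset ℂ} (hA : ∀ a ∈ A, 0 < a.re)
    (e d : ℂ) {i j : ℕ} (hneg : 2*Real.pi*((i+1)*(1/op).re + (j+1)*(1/om).re) +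
      (A.map fun a => -Real.pi * ((op+om-a-a)/(op*om)).re).sum < 0) :
    Integrable fun x : ℝ => momKer op om e d i j (hypWt h A) x :=
  (expBound_momKer tendsto_const_nhds H.pop H.pom e d i j (H.expBound_hypWt _ hA)).integrable
    hneg (continuous_momKer_ofReal i j (H.continuous_hypWt hA)).aestronglyMeasurable

theorem andreief (H : HypH op om h) {A : Multiset ℂ} {n : ℕ} (hA : Adm op om A)
    (hc : A.card = 2*n+2) (e d : ℂ) :
    Integrable (fun x : Fin n → ℝ => (Matrix.vandermonde fun j => coshVar op (x j)).det *
        (Matrix.vandermonde fun j => coshVar om (x j)).det *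
          ∏ j, (sinhDens op om (x j) * hypWt h A (x j))) ∧
      ∫ x : Fin n → ℝ, (Matrix.vandermonde fun j => coshVar op (x j)).det *
        (Matrix.vandermonde fun j => coshVar om (x j)).det *
          ∏ j, (sinhDens op om (x j) * hypWt h A (x j)) =
      (n.factorial : ℂ) *
        (Matrix.of fun i k : Fin n => ∫ x : ℝ, momKer op om e d i k (hypWt h A) x).det := by
  have key := _root_.andreief (n := n) (fun i x => (coshVar op x - e)^(i:ℕ))
    (fun i x => (coshVar om x - d)^(i:ℕ)) (fun x => sinhDens op om x * hypWt h A x)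
    (fun i k => H.integrable_momKer hA.1 e d (momKer_exponent_neg H.pop H.pom hc hA.2 i.2 k.2))
  have e1 : ∀ (op e : ℂ) (x : Fin n → ℝ),
      (Matrix.of fun (i j : Fin n) => (coshVar op (x j) - e)^(i:ℕ)).det =
        (Matrix.vandermonde fun j => coshVar op (x j)).det := by
    intro op e x
    rw [← Matrix.det_vandermonde_sub _ e, ← Matrix.det_transpose]
    rfl
  simp only [e1] at key
  exact key

theorem momDet_eq (H : HypH op om h) {A : Multiset ℂ} {n : ℕ} (hA : Adm op om A)
    (hc : A.card = 2*n+2) (e d : ℂ) :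
    momDet op om h n A =
      (Matrix.of fun i k : Fin n => ∫ x : ℝ, momKer op om e d i k (hypWt h A) x).det := by
  have h1 := (H.andreief hA hc e d).2
  rw [(H.andreief hA hc 0 0).2] at h1
  exact mul_left_cancel₀ (by exact_mod_cast n.factorial_ne_zero) h1

theorem differentiableAt_momDet (H : HypH op om h) {A : Multiset ℂ} {n : ℕ} {z₀ : ℂ}
    (hA : Adm op om (z₀ ::ₘ A)) (hc : A.card = 2*n+1) :
    DifferentiableAt ℂ (fun z => momDet op om h n (z ::ₘ A)) z₀ := by
  unfold momDet
  simp only [Matrix.det_apply', Matrix.of_apply]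
  refine DifferentiableAt.fun_sum fun σ _ => DifferentiableAt.const_mul ?_ _
  refine DifferentiableAt.fun_finsetProd fun i _ => ?_
  have h0 : ∀ᶠ z : ℂ in 𝓝 z₀, 0 < z.re :=
    (Complex.continuous_re.tendsto z₀).eventually_const_lt (hA.1 z₀ (by simp))
  refine differentiableAt_integral_of_expBound
    (expBound_momKer tendsto_const_nhds H.pop H.pom 0 0 _ _ (H.expBound_hypWt_cons hA.1))
    (momKer_exponent_neg (n := n) H.pop H.pom (by simp [hc]) hA.2 (σ i).2 i.2) ?_ ?_
  · filter_upwards [h0] with z hz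
    refine continuous_momKer_ofReal _ _ (H.continuous_hypWt fun a ha => ?_)
    rcases Multiset.mem_cons.1 ha with rfl | ha
    · exact hz
    · exact hA.1 a (by simp [ha])
  · filter_upwards [h0] with z hz x
    simp only [momKer, hypWt_cons]
    refine DifferentiableAt.const_mul (DifferentiableAt.const_mul
      (DifferentiableAt.mul_const ?_ _) _) _
    have h1 : DifferentiableAt ℂ (fun z : ℂ => h (z - Complex.I*x)) z :=
      DifferentiableAt.comp (g := h) (f := fun z : ℂ => z - Complex.I*x) z
        (H.diff _ (by simpa using hz)) (by fun_prop)
    have h2 : DifferentiableAt ℂ (fun z : ℂ => h (z + Complex.I*x)) z :=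
      DifferentiableAt.comp (g := h) (f := fun z : ℂ => z + Complex.I*x) z
        (H.diff _ (by simpa using hz)) (by fun_prop)
    exact h1.mul h2

end HypH

end

section

open Filter Topology

/-- The trigonometric product `∏_{a ∈ A} 2 sin(π(a+ix)/ω)`. -/
def sinProd (op : ℂ) (A : Multiset ℂ) (x : ℂ) : ℂ :=
  (A.map fun a => 2 * Complex.sin (Real.pi * (a + Complex.I*x) / op)).prod

theorem two_sin_mul_two_sin (a b x op : ℂ) :
    (2 * Complex.sin (Real.pi * (a + Complex.I*x) / op)) *
      (2 * Complex.sin (Real.pi * (b + Complex.I*x) / op)) =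
    2 * Complex.cos (Real.pi * (a-b)/op) - Complex.cos (Real.pi * (a+b)/op) * coshVar op x +
      Complex.I * Complex.sin (Real.pi * (a+b)/op) * (2 * Complex.sinh (2*Real.pi/op*x)) := by
  have h1 : Real.pi * (a-b)/op = Real.pi * (a + Complex.I*x) / op -
      Real.pi * (b + Complex.I*x) / op := by ring
  have h2 : Complex.cos (Real.pi * (a + Complex.I*x) / op + Real.pi * (b + Complex.I*x) / op) =
      Complex.cos (Real.pi * (a+b)/op) * Complex.cosh (2*Real.pi/op*x) -
      Complex.I * Complex.sin (Real.pi * (a+b)/op) * Complex.sinh (2*Real.pi/op*x) := by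
    have : Real.pi * (a + Complex.I*x) / op + Real.pi * (b + Complex.I*x) / op =
        Real.pi * (a+b)/op + 2*Real.pi/op*x * Complex.I := by ring
    rw [this, Complex.cos_add, Complex.cos_mul_I, Complex.sin_mul_I]
    ring
  have h3 := h2
  rw [Complex.cos_add] at h3
  rw [h1, Complex.cos_sub, coshVar]
  linear_combination (-2) * h3

open Polynomial in
theorem exists_sinProd_poly (op : ℂ) (m : ℕ) : ∀ A : Multiset ℂ, A.card = 2*m →
    ∃ S R : ℂ[X], (∀ k, m < k → S.coeff k = 0) ∧ (∀ k, m ≤ k → R.coeff k = 0) ∧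
      S.coeff m = (-1)^m * Complex.cos (Real.pi * A.sum / op) ∧
      (X*R).coeff m = (-1)^(m+1) * (Complex.I * Complex.sin (Real.pi * A.sum / op)) ∧
      ∀ x, sinProd op A x = S.eval (coshVar op x) +
        2 * Complex.sinh (2*Real.pi/op*x) * R.eval (coshVar op x) := by
  induction m with
  | zero =>
    intro A hA
    rw [mul_zero, Multiset.card_eq_zero] at hA
    subst hA
    refine ⟨1, 0, fun k hk => ?_, by simp, by simp, by simp, by simp [sinProd]⟩
    rw [Polynomial.coeff_one, if_neg (by omega)]
  | succ m ih =>
    intro A hA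
    obtain ⟨a, B, rfl, hB⟩ := Multiset.card_eq_succ_iff.1 (show A.card = (2*m+1)+1 by omega)
    obtain ⟨b, A', rfl, hA'⟩ := Multiset.card_eq_succ_iff.1 hB
    obtain ⟨S, R, hS, hR, hSm, hRm, hx⟩ := ih A' hA'
    set κ := 2 * Complex.cos (Real.pi * (a-b)/op)
    set γ := Complex.cos (Real.pi * (a+b)/op)
    set σ := Complex.I * Complex.sin (Real.pi * (a+b)/op) with hσ
    have hsum : Real.pi * (a ::ₘ b ::ₘ A').sum / op =
        Real.pi * (a+b)/op + Real.pi * A'.sum / op := by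
      simp only [Multiset.sum_cons]; ring
    refine ⟨C κ * S - C γ * (X * S) + C σ * (X * (X * R) - C 4 * R),
      C κ * R - C γ * (X * R) + C σ * S, ?_, ?_, ?_, ?_, ?_⟩
    · intro k hk
      obtain ⟨k', rfl⟩ : ∃ k', k = k'+2 := ⟨k-2, by omega⟩
      simp [coeff_X_mul, hS (k'+2) (by omega), hS (k'+1) (by omega), hR (k'+2) (by omega),
        hR k' (by omega)]
    · intro k hk
      obtain ⟨k', rfl⟩ : ∃ k', k = k'+1 := ⟨k-1, by omega⟩
      simp [coeff_X_mul, hS (k'+1) (by omega), hR (k'+1) (by omega), hR k' (by omega)]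
    · simp only [coeff_add, coeff_sub, coeff_C_mul, coeff_X_mul]
      rw [hS (m+1) (by omega), hR (m+1) (by omega), hSm, hRm, hsum, Complex.cos_add, hσ]
      linear_combination ((-1)^(m+1) * Complex.sin (Real.pi * (a+b)/op) *
        Complex.sin (Real.pi * A'.sum/op)) * Complex.I_sq
    · simp only [coeff_add, coeff_sub, coeff_C_mul, coeff_X_mul]
      rw [hSm, hRm, hR m le_rfl, hsum, Complex.sin_add, hσ]
      ring
    · intro x
      have : sinProd op (a ::ₘ b ::ₘ A') x =
        (2 * Complex.sin (Real.pi * (a + Complex.I*x) / op)) *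
        (2 * Complex.sin (Real.pi * (b + Complex.I*x) / op)) * sinProd op A' x := by
        simp [sinProd]; ring
      rw [this, two_sin_mul_two_sin, hx]
      simp only [eval_add, eval_sub, eval_mul, eval_C, eval_X]
      have hc : coshVar op x ^2 - 4 = (2 * Complex.sinh (2*Real.pi/op*x))^2 := by
        have := Complex.cosh_sq (2*Real.pi/op*x)
        rw [coshVar, mul_pow, this]; ring
      linear_combination (-σ * R.eval (coshVar op x)) * hc

theorem sinProd_sub_neg (op : ℂ) {n : ℕ} (B : Multiset ℂ) (hB : B.card = 2*n+2) (c : ℂ) :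
    ∃ r : Fin (n+1) → ℂ,
      r (Fin.last n) = (-1)^n * (Complex.I * Complex.sin (Real.pi * B.sum / op)) ∧
      (∀ x, coshVar op x = c → sinProd op B x - sinProd op B (-x) =
        4 * Complex.sinh (2*Real.pi/op*x) * r 0) ∧
      ∀ x, sinProd op B x - sinProd op B (-x) =
        4 * Complex.sinh (2*Real.pi/op*x) * ∑ i, r i * (coshVar op x - c)^(i:ℕ) := by
  obtain ⟨S, R, hS, hR, hSm, hRm, hx⟩ := exists_sinProd_poly op (n+1) B (by omega)
  have hdeg : R.natDegree ≤ n :=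
    Polynomial.natDegree_le_iff_coeff_eq_zero.2 fun k hk => hR k hk
  have hT : (Polynomial.taylor c R).natDegree < n+1 := by
    rw [Polynomial.natDegree_taylor]; omega
  have hev : ∀ y, R.eval y = ∑ i : Fin (n+1), (Polynomial.taylor c R).coeff i * (y - c)^(i:ℕ) := by
    intro y
    have h1 : R.eval y = (Polynomial.taylor c R).eval (y - c) := by
      rw [Polynomial.taylor_eval, sub_add_cancel]
    rw [h1, Polynomial.eval_eq_sum_range' hT, Finset.sum_range]
  have hd : ∀ x, sinProd op B x - sinProd op B (-x) =
      4 * Complex.sinh (2*Real.pi/op*x) * R.eval (coshVar op x) := by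
    intro x
    rw [hx, hx, coshVar_neg, mul_neg, Complex.sinh_neg]
    ring
  refine ⟨fun i => (Polynomial.taylor c R).coeff i, ?_, ?_, ?_⟩
  · rw [Polynomial.coeff_X_mul] at hRm
    have : (Polynomial.taylor c R).coeff n = R.coeff n := by
      rcases hdeg.eq_or_lt with h | h
      · rw [← h, Polynomial.coeff_taylor_natDegree]; rfl
      · rw [Polynomial.coeff_eq_zero_of_natDegree_lt h, Polynomial.coeff_eq_zero_of_natDegree_lt]
        rwa [Polynomial.natDegree_taylor]
    simp only [Fin.val_last]
    rw [this, hRm]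
    ring
  · intro x hxc
    rw [hd, hxc]
    simp [Polynomial.taylor_coeff_zero]
  · intro x
    rw [hd, hev]

namespace HypH

variable {op om : ℂ} {h : ℂ → ℂ}

/-- The shifted product whose odd part gives the moment relation. -/
def shiftKer (om : ℂ) (h : ℂ → ℂ) (B : Multiset ℂ) (j : ℕ) (x : ℂ) : ℂ :=
  (B.map fun b => h (b - Complex.I*x) * h (b + om + Complex.I*x)).prod *
    (coshVar om x ^ j * (2 * Complex.sinh (2*Real.pi/om*x)))

theorem shiftKer_eq (H : HypH op om h) {B : Multiset ℂ} (hB : ∀ b ∈ B, 0 < b.re) (j : ℕ) (x : ℝ) :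
    shiftKer om h B j x = sinProd op B x * hypWt h B x *
      (coshVar om x ^ j * (2 * Complex.sinh (2*Real.pi/om*x))) := by
  unfold shiftKer sinProd hypWt
  rw [← Multiset.prod_map_mul]
  congr 2
  refine Multiset.map_congr rfl fun b hb => ?_
  have : b + om + Complex.I*x = (b + Complex.I*x) + om := by ring
  rw [this, H.shm _ (by simpa using hB b hb)]
  ring

theorem integral_shiftKer (H : HypH op om h) {B : Multiset ℂ} {n j : ℕ}
    (hB : ∀ b ∈ B, 0 < b.re) (hc : B.card = 2*n+2) (hs : 0 < ((op-B.sum)/(op*om)).re)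
    (hj : j < n) : Integrable (fun x : ℝ => shiftKer om h B j x) ∧
      ∫ x : ℝ, shiftKer om h B j x = 0 := by
  have hop := ne_zero_of_re_pos' H.pop
  have hom := ne_zero_of_re_pos' H.pom
  set S : Set ℂ := {w | ∀ b ∈ B, 0 < (b - Complex.I*w).re ∧ 0 < (b + om + Complex.I*w).re} with hS
  have hSeq : S = ⋂ b ∈ B.toFinset, ({w | 0 < b.re + w.im} ∩ {w | 0 < b.re + om.re - w.im}) := by
    ext w
    simp only [hS, Set.mem_ofPred_eq, Set.mem_iInter, Multiset.mem_toFinset, Set.mem_inter_iff]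
    refine forall₂_congr fun b _ => ?_
    simp [sub_eq_add_neg]
  have hopen : IsOpen S := by
    rw [hSeq]
    refine isOpen_biInter_finset fun b _ => IsOpen.inter ?_ ?_
    · exact isOpen_lt continuous_const (by fun_prop)
    · exact isOpen_lt continuous_const (by fun_prop)
  have hconv : Convex ℝ S := by
    intro w hw v hv s t hs ht hst b hb
    obtain ⟨h1, h2⟩ := hw b hb
    obtain ⟨h3, h4⟩ := hv b hb
    simp only [Complex.sub_re, Complex.add_re, Complex.mul_re, Complex.I_re, Complex.I_im,
      Complex.add_im, Complex.real_smul, Complex.mul_im, Complex.ofReal_re, Complex.ofReal_im] at *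
    obtain rfl : s = 1 - t := by linarith
    rcases hs.eq_or_lt with hs | hs
    · obtain rfl : t = 1 := by linarith
      constructor <;> linarith
    · have := mul_pos hs h1
      have := mul_pos hs h2
      have := mul_nonneg ht h3.le
      have := mul_nonneg ht h4.le
      constructor <;> linarith
  have hst : ∀ w ∈ S, ∀ t : ℝ, w + t ∈ S := by
    intro w hw t b hb
    simpa using hw b hb
  have hdiff : ∀ w ∈ S, DifferentiableAt ℂ (shiftKer om h B j) w := by
    intro w hw
    unfold shiftKer coshVar
    refine DifferentiableAt.mul ?_ (by fun_prop)
    have : ∀ A : Multiset ℂ, (∀ a ∈ A, a ∈ B) → DifferentiableAt ℂ (fun x =>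
        (A.map fun b => h (b - Complex.I*x) * h (b + om + Complex.I*x)).prod) w := by
      intro A
      induction A using Multiset.induction_on with
      | empty => intro _; simp
      | cons a A ih =>
        intro hA
        simp only [Multiset.map_cons, Multiset.prod_cons]
        refine DifferentiableAt.mul (DifferentiableAt.mul ?_ ?_)
          (ih fun b hb => hA b (by simp [hb]))
        · exact DifferentiableAt.comp (g := h) (f := fun x => a - Complex.I*x) w
            (H.diff _ (hw a (hA a (by simp))).1) (by fun_prop)
        · exact DifferentiableAt.comp (g := h) (f := fun x => a + om + Complex.I*x) w
            (H.diff _ (hw a (hA a (by simp))).2) (by fun_prop)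
    exact this B fun a ha => ha
  have hneg : (B.map fun b => -Real.pi * ((op+om-b-(b+om))/(op*om)).re).sum +
      (j*(2*Real.pi*(1/om).re) + 2*Real.pi*(1/om).re) < 0 := by
    have e : ∀ A : Multiset ℂ, (A.map fun b => -Real.pi * ((op+om-b-(b+om))/(op*om)).re).sum =
        -Real.pi * (A.card * (1/om).re) + 2*Real.pi*(A.sum/(op*om)).re := by
      intro A
      induction A using Multiset.induction_on with
      | empty => simp
      | cons a A ih =>
        have e1 : (op+om-a-(a+om))/(op*om) = 1/om - a/(op*om) - a/(op*om) := by
          field_simp; ring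
        rw [Multiset.map_cons, Multiset.sum_cons, ih, e1, Multiset.card_cons, Multiset.sum_cons,
          add_div a, Complex.add_re (a/_), Complex.sub_re, Complex.sub_re]
        push_cast; ring
    rw [e, hc]
    have e2 : (op-B.sum)/(op*om) = 1/om - B.sum/(op*om) := by field_simp
    rw [e2, Complex.sub_re] at hs
    have h1 := re_inv_pos H.pom
    have hj' : (j:ℝ) + 1 ≤ n := by exact_mod_cast hj
    have h4 : ((j:ℝ)+1)*(1/om).re ≤ n*(1/om).re := by gcongr
    have h5 : 2*Real.pi*((j+1)*(1/om).re) ≤ 2*Real.pi*(n*(1/om).re) := by gcongr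
    have h6 := mul_pos Real.pi_pos hs
    push_cast
    nlinarith
  have hbd : ∀ w₀ ∈ S, ExpBound (𝓝 w₀) (fun w x => shiftKer om h B j (w + x))
      ((B.map fun b => -Real.pi * ((op+om-b-(b+om))/(op*om)).re).sum +
      (j*(2*Real.pi*(1/om).re) + 2*Real.pi*(1/om).re)) := by
    intro w₀ hw₀
    have h1 := tendsto_two_pi_div (tendsto_const_nhds (x := om) (f := 𝓝 w₀)) H.pom
    have h2 : Tendsto (fun w => 2*Real.pi/om * w) (𝓝 w₀) (𝓝 (2*Real.pi/om * w₀)) :=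
      (continuous_const.mul continuous_id).tendsto _
    have h3 := ExpBound.cosh h1 h2
    have h4 := ExpBound.sinh h1 h2
    rw [abs_two_pi_div_re H.pom] at h3 h4
    have h5 := (ExpBound.const (l := 𝓝 w₀) (tendsto_const_nhds (x := (2:ℂ)))).mul h3
    have h6 := (ExpBound.const (l := 𝓝 w₀) (tendsto_const_nhds (x := (2:ℂ)))).mul h4
    rw [zero_add] at h5 h6
    have h7 := ExpBound.multiset_prod (l := 𝓝 w₀) B
      (F := fun b w x => h ((b - Complex.I*w) - Complex.I*x) *
        h ((b + om + Complex.I*w) + Complex.I*x))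
      (C := fun b => -Real.pi * ((op+om-b-(b+om))/(op*om)).re) (fun b hb => by
        have hq := H.expBound (l := 𝓝 w₀) (a := fun w => b - Complex.I*w)
          (b := fun w => b + om + Complex.I*w)
          (Continuous.tendsto (by fun_prop) w₀) (Continuous.tendsto (by fun_prop) w₀)
          (hw₀ b hb).1 (hw₀ b hb).2
        convert hq using 4
        ring)
    refine (h7.mul ((h5.pow j).mul h6)).congr (Eventually.of_forall fun w x => ?_)
    unfold shiftKer coshVar
    have e1 : 2*Real.pi/om * (x:ℂ) + 2*Real.pi/om * w = 2*Real.pi/om * (w + x) := by ring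
    simp only [e1]
    congr 3
    ext b
    congr 2 <;> ring
  have h0 : (0:ℂ) ∈ S := by
    intro b hb
    have := hB b hb
    have := H.pom
    constructor <;> simp <;> linarith
  have h1 : Complex.I*om/2 ∈ S := by
    intro b hb
    have := hB b hb
    have := H.pom
    have e1 : b - Complex.I*(Complex.I*om/2) = b + om/2 := by
      linear_combination (-om/2)*Complex.I_sq
    have e2 : b + om + Complex.I*(Complex.I*om/2) = b + om/2 := by
      linear_combination (om/2)*Complex.I_sq
    rw [e1, e2]
    simp; linarith
  constructor
  · have := (hbd 0 h0).of_mem (pure_le_nhds 0)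
    simp only [zero_add] at this
    refine this.integrable hneg (Continuous.aestronglyMeasurable ?_)
    refine continuous_iff_continuousAt.2 fun x => ?_
    exact ContinuousAt.comp (f := fun x : ℝ => (x:ℂ)) (g := shiftKer om h B j)
      (hdiff _ (by simpa using hst 0 h0 x)).continuousAt (by fun_prop)
  · have key := integral_translate_eq hopen hconv hst hdiff
      (fun w₀ hw₀ => (hbd w₀ hw₀).exists_integrable hneg) h0 h1
    simp only [zero_add] at key
    rw [key]
    have hodd : ∀ x : ℝ, shiftKer om h B j (Complex.I*om/2 + ((-x : ℝ):ℂ)) =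
        - shiftKer om h B j (Complex.I*om/2 + x) := by
      intro x
      have e0 : ∀ y : ℂ, 2*Real.pi/om*(Complex.I*om/2 + y) =
          2*Real.pi/om*y + Real.pi * Complex.I := by
        intro y; field_simp; ring
      have e1 : ∀ (b y : ℂ), b - Complex.I*(Complex.I*om/2 + y) = b + om/2 - Complex.I*y := by
        intro b y; linear_combination (-om/2)*Complex.I_sq
      have e2 : ∀ (b y : ℂ), b + om + Complex.I*(Complex.I*om/2 + y) =
          b + om/2 + Complex.I*y := by
        intro b y; linear_combination (om/2)*Complex.I_sq
      unfold shiftKer coshVar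
      simp only [e0, e1, e2, Complex.cosh_add, Complex.sinh_add, Complex.cosh_mul_I,
        Complex.sinh_mul_I, Complex.cos_pi, Complex.sin_pi, zero_mul, mul_zero, add_zero]
      push_cast
      simp only [mul_neg, Complex.cosh_neg, Complex.sinh_neg, sub_neg_eq_add, ← sub_eq_add_neg]
      have : (B.map fun b => h (b + om/2 + Complex.I*x) * h (b + om/2 - Complex.I*x)) =
          (B.map fun b => h (b + om/2 - Complex.I*x) * h (b + om/2 + Complex.I*x)) :=
        Multiset.map_congr rfl fun b _ => mul_comm _ _
      rw [this]
      ring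
    have h2 := integral_neg_eq_self (fun x : ℝ => shiftKer om h B j (Complex.I*om/2 + x)) volume
    simp only [hodd, integral_neg] at h2
    exact self_eq_neg.1 h2.symm

end HypH

end

section

open Filter Topology

theorem coshVar_sub_eq (op z x : ℂ) :
    (2 * Complex.sin (Real.pi * (z - Complex.I*x) / op)) *
      (2 * Complex.sin (Real.pi * (z + Complex.I*x) / op)) =
    coshVar op x - 2 * Complex.cos (2*Real.pi*z/op) := by
  have h1 : Complex.cosh (2*Real.pi/op*x) = Complex.cos (Real.pi * (z + Complex.I*x) / op -
      Real.pi * (z - Complex.I*x) / op) := by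
    rw [← Complex.cosh_mul_I, ← Complex.cosh_neg]
    congr 1
    linear_combination (-2*Real.pi/op*x) * Complex.I_sq
  have h2 : 2*Real.pi*z/op = Real.pi * (z + Complex.I*x) / op +
      Real.pi * (z - Complex.I*x) / op := by ring
  rw [coshVar, h1, h2, Complex.cos_add, Complex.cos_sub]
  ring

namespace HypH

variable {op om : ℂ} {h : ℂ → ℂ}

theorem hypWt_add_om (H : HypH op om h) {z : ℂ} (hz : 0 < z.re) (A : Multiset ℂ) (x : ℝ) :
    hypWt h ((z+om) ::ₘ A) x =
      (coshVar op x - 2 * Complex.cos (2*Real.pi*z/op)) * hypWt h (z ::ₘ A) x := by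
  rw [hypWt_cons, hypWt_cons, ← coshVar_sub_eq]
  have e1 : z + om - Complex.I*x = (z - Complex.I*x) + om := by ring
  have e2 : z + om + Complex.I*x = (z + Complex.I*x) + om := by ring
  rw [e1, e2, H.shm _ (by simpa using hz), H.shm _ (by simpa using hz)]
  ring

theorem adm_of_add_om (H : HypH op om h) {z : ℂ} (hz : 0 < z.re) {A : Multiset ℂ}
    (hA : Adm op om ((z+om) ::ₘ A)) : Adm op om (z ::ₘ A) := by
  refine ⟨fun a ha => ?_, ?_⟩
  · rcases Multiset.mem_cons.1 ha with rfl | ha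
    · exact hz
    · exact hA.1 a (by simp [ha])
  · have hop := ne_zero_of_re_pos' H.pop
    have hom := ne_zero_of_re_pos' H.pom
    have h1 := hA.2
    rw [Multiset.sum_cons] at h1 ⊢
    have e : (op+om-(z+A.sum))/(op*om) = (op+om-(z+om+A.sum))/(op*om) + 1/op := by
      field_simp; ring
    rw [e, Complex.add_re]
    have := re_inv_pos H.pop
    linarith

theorem momDet_add_om_aux (H : HypH op om h) {z : ℂ} (hz : 0 < z.re) {A : Multiset ℂ} {n : ℕ}
    (hc : A.card = 2*n+1) (hA : Adm op om ((z+om) ::ₘ A))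
    (hsin : Complex.sin (2*Real.pi*z/op) ≠ 0) :
    2 * Complex.sin (Real.pi * (z+A.sum)/op) * momDet op om h n ((z+om) ::ₘ A) =
      (A.map fun b => 2 * Complex.sin (Real.pi * (b+z)/op)).prod * momDet op om h n (z ::ₘ A) := by
  have hop := ne_zero_of_re_pos' H.pop
  have hom := ne_zero_of_re_pos' H.pom
  have hA' := H.adm_of_add_om hz hA
  set c := 2 * Complex.cos (2*Real.pi*z/op) with hcdef
  have hB : (z ::ₘ A).card = 2*n+2 := by simp [hc]
  obtain ⟨r, hrn, hr0, hr⟩ := sinProd_sub_neg op (z ::ₘ A) hB c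
  have hs : 0 < ((op-(z ::ₘ A).sum)/(op*om)).re := by
    have h1 := hA.2
    rw [Multiset.sum_cons] at h1 ⊢
    convert h1 using 3
    ring
  set V : Matrix (Fin (n+1)) (Fin n) ℂ :=
    Matrix.of fun i j => ∫ x : ℝ, momKer op om c 0 i j (hypWt h (z ::ₘ A)) x with hV
  have hint : ∀ (i : Fin (n+1)) (j : Fin n),
      Integrable fun x : ℝ => momKer op om c 0 i j (hypWt h (z ::ₘ A)) x := by
    intro i j
    refine H.integrable_momKer hA'.1 c 0 ?_
    rw [sum_exponent H.pop H.pom, hB]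
    have e2 : (op-(z ::ₘ A).sum)/(op*om) = 1/om - (z ::ₘ A).sum/(op*om) := by field_simp
    rw [e2, Complex.sub_re] at hs
    have h1 := re_inv_pos H.pop
    have h2 := re_inv_pos H.pom
    have hi' : (i:ℝ) ≤ n := by exact_mod_cast Nat.lt_succ_iff.1 i.2
    have hj' : (j:ℝ) + 1 ≤ n := by exact_mod_cast j.2
    have h3 : ((i:ℝ)+1)*(1/op).re ≤ (n+1)*(1/op).re := by gcongr
    have h4 : ((j:ℝ)+1)*(1/om).re ≤ n*(1/om).re := by gcongr
    have h5 : 2*Real.pi*((i+1)*(1/op).re + (j+1)*(1/om).re) ≤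
        2*Real.pi*((n+1)*(1/op).re + n*(1/om).re) := by gcongr
    have h6 := mul_pos Real.pi_pos hs
    push_cast
    nlinarith
  have hrel : ∀ j, ∑ i, r i * V i j = 0 := by
    intro j
    obtain ⟨hi0, hi1⟩ := H.integral_shiftKer hA'.1 hB hs j.2
    have hpt : ∀ x : ℝ, ∑ i, r i * momKer op om c 0 i j (hypWt h (z ::ₘ A)) x =
        (1/2) * (shiftKer om h (z ::ₘ A) j x + shiftKer om h (z ::ₘ A) j ((-x : ℝ):ℂ)) := by
      intro x
      rw [H.shiftKer_eq hA'.1, H.shiftKer_eq hA'.1]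
      push_cast
      rw [hypWt_neg, coshVar_neg, mul_neg, Complex.sinh_neg]
      have e1 := hr x
      have e2 : ∑ i, r i * momKer op om c 0 i j (hypWt h (z ::ₘ A)) x =
          (∑ i, r i * (coshVar op x - c)^(i:ℕ)) *
            (coshVar om x ^ (j:ℕ) * (sinhDens op om x * hypWt h (z ::ₘ A) x)) := by
        rw [Finset.sum_mul]
        refine Finset.sum_congr rfl fun i _ => ?_
        rw [momKer, sub_zero]
        ring
      rw [e2, sinhDens]
      linear_combination (-(coshVar om x ^ (j:ℕ)) * hypWt h (z ::ₘ A) x *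
        Complex.sinh (2*Real.pi/om*x)) * e1
    have : ∑ i, r i * V i j =
        ∫ x : ℝ, ∑ i, r i * momKer op om c 0 i j (hypWt h (z ::ₘ A)) x := by
      rw [integral_finsetSum _ fun i _ => (hint i j).const_mul _]
      refine Finset.sum_congr rfl fun i _ => ?_
      rw [integral_const_mul]
      rfl
    rw [this]
    simp only [hpt]
    rw [integral_const_mul, integral_add hi0 hi0.comp_neg, hi1,
      integral_neg_eq_self (fun x : ℝ => shiftKer om h (z ::ₘ A) j x), hi1]
    simp
  have key := extreme_minors V r hrel
  have hV0 : (V.submatrix Fin.castSucc id).det = momDet op om h n (z ::ₘ A) := by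
    rw [H.momDet_eq hA' hB c 0]
    rfl
  have hV1 : (V.submatrix Fin.succ id).det = momDet op om h n ((z+om) ::ₘ A) := by
    rw [H.momDet_eq hA (by simp [hc]) c 0]
    congr 1
    ext i j
    simp only [hV, Matrix.submatrix_apply, Matrix.of_apply, id]
    congr 1
    ext x
    rw [momKer, momKer, H.hypWt_add_om hz, Fin.val_succ, pow_succ]
    ring
  rw [hV0, hV1, hrn, Multiset.sum_cons] at key
  have hcx : coshVar op (Complex.I*z) = c := by
    have e : 2*Real.pi/op*(Complex.I*z) = 2*Real.pi*z/op * Complex.I := by ring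
    rw [coshVar, e, Complex.cosh_mul_I]
  have hsx : Complex.sinh (2*Real.pi/op*(Complex.I*z)) =
      Complex.sin (2*Real.pi*z/op) * Complex.I := by
    have e : 2*Real.pi/op*(Complex.I*z) = 2*Real.pi*z/op * Complex.I := by ring
    rw [e, Complex.sinh_mul_I]
  have hr0' := hr0 (Complex.I*z) hcx
  have hN1 : sinProd op (z ::ₘ A) (Complex.I*z) = 0 := by
    have : z + Complex.I*(Complex.I*z) = 0 := by linear_combination z * Complex.I_sq
    simp [sinProd, this]
  have hN2 : sinProd op (z ::ₘ A) (-(Complex.I*z)) = 2 * Complex.sin (2*Real.pi*z/op) *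
      (A.map fun b => 2 * Complex.sin (Real.pi * (b+z)/op)).prod := by
    have : ∀ b : ℂ, b + Complex.I*(-(Complex.I*z)) = b + z := by
      intro b; linear_combination (-z) * Complex.I_sq
    simp only [sinProd, this, Multiset.map_cons, Multiset.prod_cons]
    congr 4
    ring
  rw [hN1, hN2, hsx] at hr0'
  have hr0'' : r 0 * 2 = Complex.I *
      (A.map fun b => 2 * Complex.sin (Real.pi * (b+z)/op)).prod := by
    have := mul_left_cancel₀ hsin (a := Complex.sin (2*Real.pi*z/op))
      (b := -(A.map fun b => 2 * Complex.sin (Real.pi * (b+z)/op)).prod)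
      (c := 2 * Complex.I * r 0) (by linear_combination hr0'/2)
    linear_combination Complex.I * this + 2 * r 0 * Complex.I_sq
  have hm : ((-1:ℂ))^n ≠ 0 := by simp
  refine mul_left_cancel₀ hm (mul_left_cancel₀ Complex.I_ne_zero ?_)
  linear_combination 2 * key + (-1)^n * momDet op om h n (z ::ₘ A) * hr0''

/-- The difference equation of the moment determinant in one parameter. -/
theorem momDet_add_om (H : HypH op om h) {z : ℂ} (hz : 0 < z.re) {A : Multiset ℂ} {n : ℕ}
    (hc : A.card = 2*n+1) (hA : Adm op om ((z+om) ::ₘ A)) :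
    2 * Complex.sin (Real.pi * (z+A.sum)/op) * momDet op om h n ((z+om) ::ₘ A) =
      (A.map fun b => 2 * Complex.sin (Real.pi * (b+z)/op)).prod * momDet op om h n (z ::ₘ A) := by
  have hop := ne_zero_of_re_pos' H.pop
  have hA' := H.adm_of_add_om hz hA
  have hadm : ∀ᶠ w in 𝓝 z, Adm op om ((w+om) ::ₘ A) ∧ 0 < w.re := by
    have h1 : ∀ᶠ w : ℂ in 𝓝 z, 0 < w.re :=
      (Complex.continuous_re.tendsto z).eventually_const_lt hz
    have h2 : ∀ᶠ w : ℂ in 𝓝 z, 0 < ((op+om-((w+om)+A.sum))/(op*om)).re := by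
      have : ContinuousAt (fun w : ℂ => ((op+om-((w+om)+A.sum))/(op*om)).re) z := by fun_prop
      exact this.eventually_const_lt (by simpa using hA.2)
    filter_upwards [h1, h2] with w h1 h2
    refine ⟨⟨fun a ha => ?_, by simpa using h2⟩, h1⟩
    rcases Multiset.mem_cons.1 ha with rfl | ha
    · have := H.pom
      simp; linarith
    · exact hA.1 a (by simp [ha])
  have hne : ∀ᶠ w in 𝓝[≠] z, Complex.sin (2*Real.pi*w/op) ≠ 0 := by
    have h2 : op/2 ≠ 0 := by simpa using hop
    refine (eventually_sin_ne_zero h2 z).mono fun w hw => ?_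
    convert hw using 2
    field_simp
  have hc1 : ContinuousAt (fun w => momDet op om h n ((w+om) ::ₘ A)) z :=
    ContinuousAt.comp (g := fun w => momDet op om h n (w ::ₘ A)) (f := fun w => w + om)
      (H.differentiableAt_momDet hA hc).continuousAt (by fun_prop)
  have hc2 : ContinuousAt (fun w => momDet op om h n (w ::ₘ A)) z :=
    (H.differentiableAt_momDet hA' hc).continuousAt
  have hc3 : ContinuousAt (fun w => (A.map fun b => 2 * Complex.sin (Real.pi * (b+w)/op)).prod)
      z := by
    refine tendsto_multiset_prod (ι := ℂ) (f := fun b w => 2 * Complex.sin (Real.pi * (b+w)/op)) A fun b _ => ?_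
    exact Continuous.tendsto (by fun_prop) z
  have hl : ContinuousAt (fun w => 2 * Complex.sin (Real.pi * (w+A.sum)/op) *
      momDet op om h n ((w+om) ::ₘ A)) z := ContinuousAt.mul (by fun_prop) hc1
  have hr := hc3.mul hc2
  refine tendsto_nhds_unique_of_eventuallyEq (hl.tendsto.mono_left nhdsWithin_le_nhds)
    (hr.tendsto.mono_left nhdsWithin_le_nhds) (l := 𝓝[≠] z) ?_
  filter_upwards [hne, hadm.filter_mono nhdsWithin_le_nhds] with w h1 h2
  exact H.momDet_add_om_aux h2.2 hc h2.1 h1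

theorem momDet_swap (n : ℕ) (A : Multiset ℂ) :
    momDet op om h n A = momDet om op h n A := by
  unfold momDet
  rw [← Matrix.det_transpose]
  congr 1
  ext i k
  simp only [Matrix.transpose_apply, Matrix.of_apply]
  congr 1
  ext x
  simp only [momKer, sinhDens]
  ring

end HypH

theorem adm_swap {op om : ℂ} {A : Multiset ℂ} (hA : Adm op om A) : Adm om op A :=
  ⟨hA.1, by rw [add_comm om op, mul_comm om op]; exact hA.2⟩

end

section

open Filter Topology

theorem convex_re_pos_div_lt (P : ℂ) (M : ℝ) : Convex ℝ {z : ℂ | 0 < z.re ∧ (z/P).re < M} := by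
  have h1 : IsLinearMap ℝ fun z : ℂ => z.re := ⟨fun _ _ => by simp, fun _ _ => by simp⟩
  have h2 : IsLinearMap ℝ fun z : ℂ => (z/P).re :=
    ⟨fun _ _ => by simp [add_div], fun c z => by
      rw [Complex.real_smul, mul_div_assoc, Complex.re_ofReal_mul, smul_eq_mul]⟩
  exact (convex_halfSpace_gt h1 0).inter (convex_halfSpace_lt h2 M)

theorem isOpen_re_pos_div_lt (P : ℂ) (M : ℝ) : IsOpen {z : ℂ | 0 < z.re ∧ (z/P).re < M} :=
  (isOpen_lt continuous_const Complex.continuous_re).inter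
    (isOpen_lt (Complex.continuous_re.comp (continuous_id.div_const P)) continuous_const)

theorem exists_ball_subset_wedge {P : ℂ} (hP : P.im ≠ 0) (M r : ℝ) :
    ∃ c : ℂ, Metric.ball c r ⊆ {z : ℂ | 0 < z.re ∧ (z/P).re < M} := by
  have hP0 : P ≠ 0 := fun h => hP (by simp [h])
  have hn : 0 < Complex.normSq P := Complex.normSq_pos.2 hP0
  obtain ⟨u, hu1, hu2⟩ : ∃ u : ℂ, u.re = 1 ∧ (u/P).re < 0 := by
    refine ⟨⟨1, -(P.re+1)/P.im⟩, rfl, ?_⟩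
    rw [Complex.div_re]
    simp only
    rw [← add_div]
    apply div_neg_of_neg_of_pos _ hn
    field_simp
    linarith
  have hk : ∀ᶠ k : ℝ in atTop, r < k ∧ r * ‖P‖⁻¹ - M < k * (-(u/P).re) :=
    (eventually_gt_atTop r).and
      ((tendsto_id.atTop_mul_const (neg_pos.2 hu2)).eventually_gt_atTop _)
  obtain ⟨k, hk1, hk2⟩ := hk.exists
  refine ⟨k * u, fun z hz => ?_⟩
  rw [Metric.mem_ball, dist_eq_norm] at hz
  have e1 := (Complex.abs_re_le_norm (z - k*u)).trans_lt hz
  have e2 := (Complex.abs_re_le_norm ((z - k*u)/P))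
  rw [norm_div, div_eq_mul_inv ‖_‖] at e2
  have e3 : ‖z - k*u‖ * ‖P‖⁻¹ ≤ r * ‖P‖⁻¹ := by gcongr
  have e4 := (abs_le.1 (e2.trans e3)).2
  rw [sub_div, mul_div_assoc, Complex.sub_re, Complex.re_ofReal_mul] at e4
  rw [Complex.sub_re, Complex.re_ofReal_mul, hu1] at e1
  have e5 := (abs_lt.1 e1).1
  exact ⟨by linarith, by linarith⟩

theorem wedge_periodic_int {op P : ℂ} {M : ℝ} {Q : ℂ → ℂ} (h1 : 0 < op.re) (h2 : 0 < (op/P).re)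
    (hQ : ∀ z : ℂ, 0 < z.re → ((z+op)/P).re < M → Q (z+op) = Q z) (k : ℤ) (z : ℂ)
    (hz : 0 < z.re ∧ (z/P).re < M) (hz' : 0 < (z+k*op).re ∧ ((z+k*op)/P).re < M) :
    Q (z+k*op) = Q z := by
  have key : ∀ (k : ℕ) (z : ℂ), 0 < z.re → ((z+k*op)/P).re < M → Q (z+k*op) = Q z := by
    intro k
    induction k with
    | zero => intro z _ _; simp
    | succ k ih =>
      intro z h3 h4
      have e : z + (k+1:ℕ)*op = (z + k*op) + op := by push_cast; ring
      rw [e] at h4 ⊢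
      have h5 : 0 < (z+k*op).re := by
        rw [← Complex.ofReal_natCast, Complex.add_re, Complex.re_ofReal_mul]; positivity
      rw [hQ _ h5 h4, ih z h3]
      rw [add_div, Complex.add_re] at h4
      linarith
  obtain ⟨m, rfl | rfl⟩ := k.eq_nat_or_neg
  · exact key m z hz.1 (by simpa using hz'.2)
  · have := key m (z + ((-m : ℤ):ℂ)*op) hz'.1 (by push_cast; simpa using hz.2)
    rw [← this]
    congr 1
    push_cast; ring

theorem lattice_coords {op om : ℂ} (hD : (op * starRingEnd ℂ om).im ≠ 0) (w : ℂ) :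
    w = (((w * starRingEnd ℂ om).im / (op * starRingEnd ℂ om).im : ℝ) : ℂ) * op +
      ((-(w * starRingEnd ℂ op).im / (op * starRingEnd ℂ om).im : ℝ) : ℂ) * om := by
  have hD' : ((op * starRingEnd ℂ om).im : ℂ) ≠ 0 := by exact_mod_cast hD
  push_cast
  rw [div_mul_eq_mul_div, div_mul_eq_mul_div, ← add_div, eq_div_iff hD']
  apply Complex.ext
  · simp [Complex.mul_im]
    ring
  · simp [Complex.mul_im]
    ring

/-- A holomorphic function on a wedge with two independent periods is constant. -/
theorem eq_of_doubly_periodic_on_wedge {op om P : ℂ} {M : ℝ} {Q : ℂ → ℂ} (hP : P.im ≠ 0)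
    (hD : (op * starRingEnd ℂ om).im ≠ 0) (hop : 0 < op.re) (hom : 0 < om.re)
    (hopP : 0 < (op/P).re) (homP : 0 < (om/P).re)
    (hd : ∀ z : ℂ, 0 < z.re → (z/P).re < M → DifferentiableAt ℂ Q z)
    (hQp : ∀ z : ℂ, 0 < z.re → ((z+op)/P).re < M → Q (z+op) = Q z)
    (hQm : ∀ z : ℂ, 0 < z.re → ((z+om)/P).re < M → Q (z+om) = Q z) :
    ∃ q, ∀ z : ℂ, 0 < z.re → (z/P).re < M → Q z = q := by
  set W := {z : ℂ | 0 < z.re ∧ (z/P).re < M} with hW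
  have hWo : IsOpen W := isOpen_re_pos_div_lt P M
  set R := ‖op‖ + ‖om‖ with hR
  have hRp : 0 < R := add_pos_of_pos_of_nonneg
    (norm_pos_iff.2 (ne_zero_of_re_pos' hop)) (norm_nonneg _)
  obtain ⟨c, hc⟩ := exists_ball_subset_wedge hP M (3*R)
  set f : ℝ × ℝ → ℂ := fun p => c + p.1 * op + p.2 * om with hf
  have hfW : ∀ p : ℝ × ℝ, |p.1| ≤ 2 → |p.2| ≤ 2 → f p ∈ W := by
    intro p h1 h2
    apply hc
    rw [Metric.mem_ball, dist_eq_norm]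
    have : f p - c = p.1 * op + p.2 * om := by simp only [hf]; ring
    rw [this]
    refine (norm_add_le _ _).trans_lt ?_
    rw [norm_mul, norm_mul, Complex.norm_real, Complex.norm_real, Real.norm_eq_abs,
      Real.norm_eq_abs]
    have a1 := mul_le_mul_of_nonneg_right h1 (norm_nonneg op)
    have a2 := mul_le_mul_of_nonneg_right h2 (norm_nonneg om)
    linarith
  set K := f '' (Icc 0 1 ×ˢ Icc 0 1) with hK
  have hKc : IsCompact K := (isCompact_Icc.prod isCompact_Icc).image (by fun_prop)
  have hKW : K ⊆ W := by
    rintro _ ⟨p, ⟨h1, h2⟩, rfl⟩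
    exact hfW p (abs_le.2 ⟨by linarith [h1.1], by linarith [h1.2]⟩)
      (abs_le.2 ⟨by linarith [h2.1], by linarith [h2.2]⟩)
  have hQc : ContinuousOn Q K := fun z hz =>
    (hd z (hKW hz).1 (hKW hz).2).continuousAt.continuousWithinAt
  obtain ⟨z₀, hz₀, hmax⟩ := hKc.exists_isMaxOn ⟨f (0,0), (0,0), by simp, rfl⟩ hQc.norm
  obtain ⟨p₀, hp₀, hfp⟩ := hz₀
  set s : ℂ → ℝ := fun z => ((z-c) * starRingEnd ℂ om).im / (op * starRingEnd ℂ om).im with hs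
  set t : ℂ → ℝ := fun z => -((z-c) * starRingEnd ℂ op).im / (op * starRingEnd ℂ om).im with ht
  have hst : ∀ z, z = f (s z, t z) := fun z => by
    have := lattice_coords hD (z-c)
    simp only [hf, hs, ht]
    linear_combination this
  have hs0 : s z₀ = p₀.1 := by
    rw [← hfp]
    simp only [hs, hf]
    rw [div_eq_iff hD]
    simp [Complex.mul_im]
    ring
  have ht0 : t z₀ = p₀.2 := by
    rw [← hfp]
    simp only [ht, hf]
    rw [div_eq_iff hD]
    simp [Complex.mul_im]
    ring
  have hsc : Continuous s := by
    have : Continuous fun z : ℂ => ((z-c) * starRingEnd ℂ om).im := by fun_prop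
    exact this.div_const _
  have htc : Continuous t := by
    have : Continuous fun z : ℂ => -((z-c) * starRingEnd ℂ op).im := by fun_prop
    exact this.div_const _
  have hred : ∀ z, -1 < s z → s z < 2 → -1 < t z → t z < 2 → ‖Q z‖ ≤ ‖Q z₀‖ := by
    intro z a1 a2 a3 a4
    have f1 := Int.fract_nonneg (s z)
    have f2 := (Int.fract_lt_one (s z)).le
    have f3 := Int.fract_nonneg (t z)
    have f4 := (Int.fract_lt_one (t z)).le
    have b1 : f (s z, t z) ∈ W := hfW _ (abs_le.2 ⟨by linarith, by linarith⟩)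
      (abs_le.2 ⟨by linarith, by linarith⟩)
    have b2 : f (Int.fract (s z), t z) ∈ W := hfW _ (abs_le.2 ⟨by linarith, by linarith⟩)
      (abs_le.2 ⟨by linarith, by linarith⟩)
    have b3 : f (Int.fract (s z), Int.fract (t z)) ∈ W :=
      hfW _ (abs_le.2 ⟨by linarith, by linarith⟩) (abs_le.2 ⟨by linarith, by linarith⟩)
    have e1 : f (Int.fract (s z), t z) + (⌊s z⌋ : ℤ) * op = f (s z, t z) := by
      simp only [hf, Int.fract]; push_cast; ring
    have e2 : f (Int.fract (s z), Int.fract (t z)) + (⌊t z⌋ : ℤ) * om =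
        f (Int.fract (s z), t z) := by
      simp only [hf, Int.fract]; push_cast; ring
    have q1 := wedge_periodic_int hop hopP hQp ⌊s z⌋ _ b2 (by rw [e1]; exact b1)
    have q2 := wedge_periodic_int hom homP hQm ⌊t z⌋ _ b3 (by rw [e2]; exact b2)
    rw [e1, ← hst z] at q1
    rw [e2] at q2
    rw [q1, q2]
    exact hmax ⟨_, ⟨⟨f1, f2⟩, ⟨f3, f4⟩⟩, rfl⟩
  have hz₀W : z₀ ∈ W := hKW ⟨p₀, hp₀, hfp⟩
  have hloc : IsLocalMax (norm ∘ Q) z₀ := by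
    have c1 := hsc.continuousAt (x := z₀)
    have c2 := htc.continuousAt (x := z₀)
    filter_upwards [c1.eventually_const_lt (u := -1) (by rw [hs0]; linarith [hp₀.1.1]),
      c1.eventually_lt_const (u := 2) (by rw [hs0]; linarith [hp₀.1.2]),
      c2.eventually_const_lt (u := -1) (by rw [ht0]; linarith [hp₀.2.1]),
      c2.eventually_lt_const (u := 2) (by rw [ht0]; linarith [hp₀.2.2])] with z a1 a2 a3 a4
    exact hred z a1 a2 a3 a4
  have hev := Complex.eventually_eq_of_isLocalMax_norm (f := Q) (c := z₀)
    (by filter_upwards [hWo.mem_nhds hz₀W] with z hz using hd z hz.1 hz.2) hloc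
  have han : AnalyticOnNhd ℂ Q W := DifferentiableOn.analyticOnNhd
    (fun z hz => (hd z hz.1 hz.2).differentiableWithinAt) hWo
  have := han.eqOn_of_preconnected_of_eventuallyEq (g := fun _ => Q z₀) analyticOnNhd_const
    (convex_re_pos_div_lt P M).isPreconnected hz₀W hev
  exact ⟨Q z₀, fun z h1 h2 => this ⟨h1, h2⟩⟩

end

section

open Filter Topology

/-- The product `∏ h(a+b)` over unordered pairs from `A`. -/
def pairProd (h : ℂ → ℂ) (A : Multiset ℂ) : ℂ :=
  ((A.powersetCard 2).map fun p => h p.sum).prod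

theorem pairProd_cons (h : ℂ → ℂ) (a : ℂ) (A : Multiset ℂ) :
    pairProd h (a ::ₘ A) = pairProd h A * (A.map fun b => h (b+a)).prod := by
  simp [pairProd, Multiset.powersetCard_cons, Multiset.powersetCard_one, Multiset.map_map,
    add_comm _ a]

theorem exists_lower_bound (f : ℂ → ℝ) (A : Multiset ℂ) (M₀ : ℝ) :
    ∃ M ≤ M₀, ∀ a ∈ A, M ≤ f a := by
  induction A using Multiset.induction_on with
  | empty => exact ⟨M₀, le_rfl, by simp⟩
  | cons a A ih =>
    obtain ⟨M, h1, h2⟩ := ih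
    refine ⟨min M (f a), (min_le_left _ _).trans h1, fun b hb => ?_⟩
    rcases Multiset.mem_cons.1 hb with rfl | hb
    · exact min_le_right _ _
    · exact (min_le_left _ _).trans (h2 b hb)

theorem multiset_sum_re_nonneg {A : Multiset ℂ} (hA : ∀ a ∈ A, 0 < a.re) : 0 ≤ A.sum.re := by
  induction A using Multiset.induction_on with
  | empty => simp
  | cons a A ih =>
    have h1 := hA a (by simp)
    have h2 := ih fun b hb => hA b (by simp [hb])
    simp only [Multiset.sum_cons, Complex.add_re]
    linarith

namespace HypH

variable {op om : ℂ} {h : ℂ → ℂ}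

theorem momDet_mul_add_om (H : HypH op om h) {z : ℂ} (hz : 0 < z.re) {A : Multiset ℂ} {n : ℕ}
    (hc : A.card = 2*n+1) (hA : Adm op om ((z+om) ::ₘ A)) :
    momDet op om h n ((z+om) ::ₘ A) * h (A.sum + (z+om)) *
        (A.map fun b => h (b+z)).prod =
      momDet op om h n (z ::ₘ A) * h (A.sum + z) * (A.map fun b => h (b+(z+om))).prod := by
  have h1 := H.momDet_add_om hz hc hA
  have hpos : ∀ a ∈ A, 0 < a.re := fun a ha => hA.1 a (by simp [ha])
  have h2 : h (A.sum + (z+om)) = 2 * Complex.sin (Real.pi * (z+A.sum)/op) * h (A.sum + z) := by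
    rw [← add_assoc, H.shm, add_comm z]
    rw [Complex.add_re]
    linarith [multiset_sum_re_nonneg hpos]
  have h3 : (A.map fun b => h (b+(z+om))).prod =
      (A.map fun b => 2 * Complex.sin (Real.pi * (b+z)/op)).prod *
        (A.map fun b => h (b+z)).prod := by
    rw [← Multiset.prod_map_mul]
    congr 1
    refine Multiset.map_congr rfl fun b hb => ?_
    rw [← add_assoc, H.shm]
    rw [Complex.add_re]
    linarith [hpos b hb]
  rw [h2, h3]
  linear_combination h (A.sum + z) * (A.map fun b => h (b+z)).prod * h1

theorem differentiableAt_shift_prod (H : HypH op om h) {A : Multiset ℂ} (hA : ∀ a ∈ A, 0 < a.re)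
    {z : ℂ} (hz : 0 < z.re) :
    DifferentiableAt ℂ (fun z => (A.map fun b => h (b+z)).prod) z := by
  induction A using Multiset.induction_on with
  | empty => simp
  | cons a A ih =>
    simp only [Multiset.map_cons, Multiset.prod_cons]
    refine DifferentiableAt.mul ?_ (ih fun b hb => hA b (by simp [hb]))
    refine DifferentiableAt.comp (g := h) (f := fun z => a + z) z (H.diff _ ?_) (by fun_prop)
    have := hA a (by simp)
    simp; linarith

theorem adm_cons_iff {A : Multiset ℂ} (hA : ∀ a ∈ A, 0 < a.re) (z : ℂ) :
    Adm op om (z ::ₘ A) ↔ 0 < z.re ∧ (z/(op*om)).re < ((op+om-A.sum)/(op*om)).re := by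
  have : (op+om-(z+A.sum)) = (op+om-A.sum) - z := by ring
  rw [Adm, Multiset.sum_cons, this, sub_div _ z, Complex.sub_re, sub_pos]
  constructor
  · exact fun h => ⟨h.1 z (by simp), h.2⟩
  · refine fun h => ⟨fun a ha => ?_, h.2⟩
    rcases Multiset.mem_cons.1 ha with rfl | ha
    · exact h.1
    · exact hA a ha

theorem momDet_cons_eq (H : HypH op om h) (hP : (op*om).im ≠ 0)
    (hD : (op * starRingEnd ℂ om).im ≠ 0) {A : Multiset ℂ} {n : ℕ} (hc : A.card = 2*n+1)
    (hA : ∀ a ∈ A, 0 < a.re) :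
    ∃ q, ∀ z, Adm op om (z ::ₘ A) →
      momDet op om h n (z ::ₘ A) * h (z ::ₘ A).sum = q * (A.map fun b => h (b+z)).prod := by
  have hop := ne_zero_of_re_pos' H.pop
  have hom := ne_zero_of_re_pos' H.pom
  set P := op*om with hPdef
  set M₀ := ((op+om-A.sum)/P).re with hM₀
  obtain ⟨M, hM1, hM2⟩ := exists_lower_bound (fun a => ((op+om-a)/P).re) A M₀
  set F : ℂ → ℂ := fun z => momDet op om h n (z ::ₘ A) * h (A.sum + z) with hF
  set S : ℂ → ℂ := fun z => (A.map fun b => h (b+z)).prod with hS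
  have hadm := adm_cons_iff (op := op) (om := om) hA
  have hFd : ∀ z, 0 < z.re → (z/P).re < M₀ → DifferentiableAt ℂ F z := fun z h1 h2 => by
    refine (H.differentiableAt_momDet ((hadm z).2 ⟨h1, h2⟩) hc).mul ?_
    refine DifferentiableAt.comp (g := h) (f := fun z => A.sum + z) z (H.diff _ ?_) (by fun_prop)
    rw [Complex.add_re]
    linarith [multiset_sum_re_nonneg hA]
  have hSd : ∀ z : ℂ, 0 < z.re → DifferentiableAt ℂ S z := fun z h1 =>
    H.differentiableAt_shift_prod hA h1
  have hS0 : ∀ z : ℂ, 0 < z.re → (z/P).re < M → S z ≠ 0 := by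
    intro z h1 h2
    refine Multiset.prod_ne_zero fun h0 => ?_
    obtain ⟨a, ha, h0⟩ := Multiset.mem_map.1 h0
    refine H.ne_zero_of_re (a := a + z) ?_ ?_ h0
    · have := hA a ha
      simp; linarith
    · have e : op + om - (a+z) = (op+om-a) - z := by ring
      rw [e, sub_div _ z, Complex.sub_re]
      linarith [hM2 a ha]
  have hopP : (op/P) = 1/om := by rw [hPdef]; field_simp
  have homP : (om/P) = 1/op := by rw [hPdef]; field_simp
  have iop := re_inv_pos H.pop
  have iom := re_inv_pos H.pom
  have hQm : ∀ z : ℂ, 0 < z.re → ((z+om)/P).re < M → F (z+om) / S (z+om) = F z / S z := by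
    intro z h1 h2
    have h3 : 0 < (z+om).re := by rw [Complex.add_re]; linarith [H.pom]
    have h4 : (z/P).re < M := by
      rw [add_div, Complex.add_re, homP] at h2
      linarith
    rw [div_eq_div_iff (hS0 _ h3 h2) (hS0 _ h1 h4)]
    exact H.momDet_mul_add_om h1 hc ((hadm _).2 ⟨h3, h2.trans_le hM1⟩)
  have hQp : ∀ z : ℂ, 0 < z.re → ((z+op)/P).re < M → F (z+op) / S (z+op) = F z / S z := by
    intro z h1 h2
    have h3 : 0 < (z+op).re := by rw [Complex.add_re]; linarith [H.pop]
    have h4 : (z/P).re < M := by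
      rw [add_div, Complex.add_re, hopP] at h2
      linarith
    rw [div_eq_div_iff (hS0 _ h3 h2) (hS0 _ h1 h4)]
    have := H.swap.momDet_mul_add_om h1 hc (adm_swap ((hadm _).2 ⟨h3, h2.trans_le hM1⟩))
    rw [momDet_swap, momDet_swap (op := om)] at this
    exact this
  obtain ⟨q, hq⟩ := eq_of_doubly_periodic_on_wedge (M := M) (Q := fun z => F z / S z) hP hD
    H.pop H.pom (by rw [hopP]; exact iom) (by rw [homP]; exact iop)
    (fun z h1 h2 => (hFd z h1 (h2.trans_le hM1)).div (hSd z h1) (hS0 z h1 h2)) hQp hQm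
  refine ⟨q, fun z hz => ?_⟩
  obtain ⟨c, hcb⟩ := exists_ball_subset_wedge hP M 1
  have hcW := hcb (Metric.mem_ball_self one_pos)
  have han : AnalyticOnNhd ℂ (fun z => F z - q * S z) {z : ℂ | 0 < z.re ∧ (z/P).re < M₀} :=
    DifferentiableOn.analyticOnNhd (fun z hz => ((hFd z hz.1 hz.2).sub
      ((hSd z hz.1).const_mul q)).differentiableWithinAt) (isOpen_re_pos_div_lt P M₀)
  have hev : (fun z => F z - q * S z) =ᶠ[𝓝 c] fun _ => 0 := by
    filter_upwards [(isOpen_re_pos_div_lt P M).mem_nhds hcW] with w hw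
    have := hq w hw.1 hw.2
    rw [div_eq_iff (hS0 w hw.1 hw.2)] at this
    rw [this, sub_self]
  have := han.eqOn_of_preconnected_of_eventuallyEq (g := fun _ => 0) analyticOnNhd_const
    (convex_re_pos_div_lt P M₀).isPreconnected ⟨hcW.1, hcW.2.trans_le hM1⟩ hev ((hadm z).1 hz)
  rw [Multiset.sum_cons, add_comm z]
  exact sub_eq_zero.1 this

theorem momDet_chain (H : HypH op om h) (hP : (op*om).im ≠ 0)
    (hD : (op * starRingEnd ℂ om).im ≠ 0) {n : ℕ} {w : ℂ} (hw : 0 < w.re)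
    (hww : 0 < ((op+om-(w+w))/(op*om)).re) {E : Multiset ℂ → ℂ}
    (hE : ∀ A, E A = momDet op om h n A * h A.sum) (A : Multiset ℂ) :
    ∀ k : ℕ, A.card + k = 2*n+2 → Adm op om (A + Multiset.replicate k w) →
    (∀ c ∈ A, 0 < ((op+om-(c+w))/(op*om)).re ∧ (w/(op*om)).re ≤ (c/(op*om)).re) →
    E (A + Multiset.replicate k w) * pairProd h (Multiset.replicate (2*n+2) w) =
      E (Multiset.replicate (2*n+2) w) * pairProd h (A + Multiset.replicate k w) := by
  induction A using Multiset.induction_on with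
  | empty =>
    intro k hk _ _
    simp only [Multiset.card_zero, zero_add] at hk
    rw [hk, zero_add]
  | cons c A ih =>
    intro k hk hadm hgood
    rw [Multiset.cons_add] at hadm ⊢
    set B := A + Multiset.replicate k w with hB
    have hwB : w ::ₘ B = A + Multiset.replicate (k+1) w := by
      rw [Multiset.replicate_succ, Multiset.add_cons]
    have hcard : B.card = 2*n+1 := by
      simp only [Multiset.card_cons] at hk
      simp only [hB, Multiset.card_add, Multiset.card_replicate]
      omega
    have hBp : ∀ a ∈ B, 0 < a.re := fun a ha => hadm.1 a (by simp [ha])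
    obtain ⟨q, hq⟩ := H.momDet_cons_eq hP hD hcard hBp
    have hadmw : Adm op om (w ::ₘ B) := by
      rw [adm_cons_iff hBp] at hadm ⊢
      exact ⟨hw, (hgood c (by simp)).2.trans_lt hadm.2⟩
    have h1 := hq c hadm
    have h2 := hq w hadmw
    have h3 := ih (k+1) (by simp only [Multiset.card_cons] at hk; omega) (hwB ▸ hadmw)
      fun a ha => hgood a (by simp [ha])
    rw [← hE] at h1 h2
    rw [← hwB, h2, pairProd_cons] at h3
    have hS : (B.map fun b => h (b+w)).prod ≠ 0 := by
      refine Multiset.prod_ne_zero fun h0 => ?_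
      obtain ⟨a, ha, h0⟩ := Multiset.mem_map.1 h0
      refine H.ne_zero_of_re (a := a + w) ?_ ?_ h0
      · have := hBp a ha
        simp; linarith
      · rcases Multiset.mem_add.1 ha with ha | ha
        · exact (hgood a (by simp [ha])).1
        · rw [Multiset.eq_of_mem_replicate ha]; exact hww
    rw [h1, pairProd_cons]
    refine mul_left_cancel₀ hS ?_
    linear_combination (B.map fun b => h (b+c)).prod * h3

theorem exists_deep (H : HypH op om h) (hP : (op*om).im ≠ 0) (n : ℕ) (A : Multiset ℂ) :
    ∃ w : ℂ, 0 < w.re ∧ 0 < ((op+om-(w+w))/(op*om)).re ∧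
      Adm op om (Multiset.replicate (2*n+2) w) ∧
      ∀ c ∈ A, 0 < ((op+om-(c+w))/(op*om)).re ∧ (w/(op*om)).re ≤ (c/(op*om)).re := by
  set P := op*om with hPdef
  obtain ⟨M₁, h1, h1'⟩ := exists_lower_bound (fun a => ((op+om-a)/P).re) A
    (((op+om)/P).re/(2*n+2))
  obtain ⟨M, h2, h2'⟩ := exists_lower_bound (fun a => (a/P).re) A M₁
  obtain ⟨w, hw⟩ := exists_ball_subset_wedge hP M 1
  have hw := hw (Metric.mem_ball_self one_pos)
  have h3 : (w/P).re < ((op+om)/P).re/(2*n+2) := hw.2.trans_le (h2.trans h1)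
  rw [lt_div_iff₀ (by positivity)] at h3
  have h4 : 0 < ((op+om)/P).re := by
    rw [hPdef, re_add_div_mul H.pop H.pom]
    exact add_pos (re_inv_pos H.pop) (re_inv_pos H.pom)
  have e : (((2*n+2:ℕ):ℂ)*w/P).re = (w/P).re * (2*n+2) := by
    rw [mul_div_assoc, ← Complex.ofReal_natCast, Complex.re_ofReal_mul]
    push_cast; ring
  refine ⟨w, hw.1, ?_, ⟨fun a ha => by rw [Multiset.eq_of_mem_replicate ha]; exact hw.1, ?_⟩,
    fun c hc => ⟨?_, (hw.2.trans_le (h2' c hc)).le⟩⟩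
  · rw [sub_div, add_div w, Complex.sub_re, Complex.add_re]
    by_cases hs : (w/P).re ≤ 0
    · linarith
    · have : 0 ≤ (w/P).re * n := mul_nonneg (by linarith) (by positivity)
      nlinarith
  · rw [Multiset.sum_replicate, nsmul_eq_mul, sub_div, Complex.sub_re, e]; linarith
  · have e : op + om - (c+w) = (op+om-c) - w := by ring
    rw [e, sub_div _ w, Complex.sub_re]
    linarith [h1' c hc, hw.2]

theorem pairProd_replicate_ne_zero (H : HypH op om h) {w : ℂ} (h1 : 0 < w.re)
    (h2 : 0 < ((op+om-(w+w))/(op*om)).re) (N : ℕ) : pairProd h (Multiset.replicate N w) ≠ 0 := by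
  refine Multiset.prod_ne_zero fun h0 => ?_
  obtain ⟨p, hp, h0⟩ := Multiset.mem_map.1 h0
  rw [Multiset.mem_powersetCard] at hp
  have : p = Multiset.replicate 2 w := Multiset.eq_replicate.2
    ⟨hp.2, fun b hb => Multiset.eq_of_mem_replicate (Multiset.mem_of_le hp.1 hb)⟩
  rw [this] at h0
  refine H.ne_zero_of_re ?_ ?_ h0
  · simp; linarith
  · simpa [two_mul] using h2

/-- The moment determinant times `h(ΣA)` is proportional to the pair product. -/
theorem exists_momDet_eq (H : HypH op om h) (hP : (op*om).im ≠ 0)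
    (hD : (op * starRingEnd ℂ om).im ≠ 0) (n : ℕ) :
    ∃ C, ∀ A : Multiset ℂ, A.card = 2*n+2 → Adm op om A →
      momDet op om h n A * h A.sum = C * pairProd h A := by
  obtain ⟨v, hv1, hv2, hv3, -⟩ := H.exists_deep hP n 0
  set V := Multiset.replicate (2*n+2) v with hV
  refine ⟨momDet op om h n V * h V.sum / pairProd h V, fun A hc hA => ?_⟩
  obtain ⟨w, hw1, hw2, hw3, hw4⟩ := H.exists_deep hP n (A + V)
  have e1 := H.momDet_chain (n := n) hP hD hw1 hw2 (fun _ => rfl) A 0 (by simpa using hc)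
    (by simpa using hA) fun c hc => hw4 c (Multiset.mem_add.2 (.inl hc))
  have e2 := H.momDet_chain (n := n) hP hD hw1 hw2 (fun _ => rfl) V 0
    (by rw [hV, Multiset.card_replicate, add_zero])
    (by rw [Multiset.replicate_zero, add_zero]; exact hv3)
    fun c hc => hw4 c (Multiset.mem_add.2 (.inr hc))
  simp only [Multiset.replicate_zero, add_zero] at e1 e2
  rw [div_mul_eq_mul_div, eq_div_iff (H.pairProd_replicate_ne_zero hv1 hv2 _)]
  refine mul_left_cancel₀ (H.pairProd_replicate_ne_zero hw1 hw2 (2*n+2)) ?_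
  linear_combination pairProd h V * e1 - pairProd h A * e2

end HypH

end

section

open Filter Topology

theorem eventually_norm_le_symm {X : Type*} [TopologicalSpace X] {F : X → ℝ → ℂ} {x₀ : X}
    (h : ∀ y : ℝ, |y| ≤ 1 → ContinuousAt (fun p : X × ℝ => F p.1 p.2) (x₀, y)) :
    ∃ C, ∀ᶠ x in 𝓝 x₀, ∀ y : ℝ, |y| ≤ 1 → ‖F x y‖ ≤ C := by
  obtain ⟨C, hC⟩ := eventually_norm_le_Icc (F := F) (x₀ := x₀)
    fun y hy => h y (abs_le.2 ⟨by linarith [hy.1], hy.2⟩)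
  obtain ⟨D, hD⟩ := eventually_norm_le_Icc (F := fun x y => F x (-y)) (x₀ := x₀) fun y hy => by
    refine ContinuousAt.comp (g := fun p : X × ℝ => F p.1 p.2) (f := fun p : X × ℝ => (p.1, -p.2))
      (h (-y) (by rw [abs_neg]; exact abs_le.2 ⟨by linarith [hy.1], hy.2⟩)) (by fun_prop)
  refine ⟨max C D, ?_⟩
  filter_upwards [hC, hD] with x h1 h2 y hy
  rw [abs_le] at hy
  rcases le_total 0 y with h0 | h0
  · exact (h1 y ⟨h0, hy.2⟩).trans (le_max_left _ _)
  · have := h2 (-y) ⟨by linarith, by linarith⟩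
    rw [neg_neg] at this
    exact this.trans (le_max_right _ _)

theorem ExpBound.of_outside {X : Type*} [TopologicalSpace X] {F : X → ℝ → ℂ} {x₀ : X} {c : ℝ}
    (hF : ∀ δ : ℝ, 0 < δ → ∃ C : ℝ, ∀ᶠ i in 𝓝 x₀, ∀ x : ℝ, 1 ≤ |x| →
      ‖F i x‖ ≤ C * Real.exp ((c+δ) * |x|))
    (h : ∀ y : ℝ, |y| ≤ 1 → ContinuousAt (fun p : X × ℝ => F p.1 p.2) (x₀, y)) :
    ExpBound (𝓝 x₀) F c := by
  intro δ hδ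
  obtain ⟨C, hC⟩ := hF δ hδ
  obtain ⟨D, hD⟩ := eventually_norm_le_symm h
  refine ⟨max C (|D| * Real.exp |c+δ|), ?_⟩
  filter_upwards [hC, hD] with i h1 h2 x
  rcases le_total 1 |x| with h0 | h0
  · refine (h1 x h0).trans ?_
    gcongr
    exact le_max_left _ _
  · calc ‖F i x‖ ≤ |D| * 1 := by rw [mul_one]; exact (h2 x h0).trans (le_abs_self _)
      _ ≤ |D| * (Real.exp |c+δ| * Real.exp ((c+δ) * |x|)) := by
        gcongr
        rw [← Real.exp_add]
        apply Real.one_le_exp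
        have h3 := neg_abs_le (c+δ)
        have h4 := abs_nonneg x
        nlinarith [abs_nonneg (c+δ)]
      _ ≤ _ := by
        rw [← mul_assoc]
        gcongr
        exact le_max_right _ _

theorem abs_le_exp_mul_abs {δ : ℝ} (hδ : 0 < δ) (x : ℝ) :
    |x| ≤ 1/δ * Real.exp (δ * |x|) := by
  have := Real.add_one_le_exp (δ * |x|)
  rw [div_mul_eq_mul_div, le_div_iff₀ hδ]
  linarith

theorem ExpBound.id {ι : Type*} {l : Filter ι} : ExpBound l (fun _ x => (x:ℂ)) 0 := by
  intro δ hδ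
  refine ⟨1/δ, Eventually.of_forall fun i x => ?_⟩
  rw [Complex.norm_real, Real.norm_eq_abs, zero_add]
  exact abs_le_exp_mul_abs hδ x

theorem expBound_sinhc {X : Type*} [TopologicalSpace X] (x₀ : X) {α : ℂ} (hα : α ≠ 0) :
    ExpBound (𝓝 x₀) (fun _ x => sinhc (α * x)) |α.re| := by
  refine ExpBound.of_outside (fun δ hδ => ?_) fun y _ => ?_
  · refine ⟨1/‖α‖, Eventually.of_forall fun _ x hx => ?_⟩
    have hx0 : (x:ℂ) ≠ 0 := by
      rintro h0
      rw [Complex.ofReal_eq_zero.1 h0, abs_zero] at hx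
      linarith
    have h1 : sinhc (α*x) = Complex.sinh (α*x)/(α*x) := by
      rw [eq_div_iff (mul_ne_zero hα hx0), mul_comm, mul_sinhc]
    have h2 := norm_sinh_le (α*x)
    rw [Complex.re_mul_ofReal, abs_mul] at h2
    have hαp := norm_pos_iff.2 hα
    rw [h1, norm_div, norm_mul, Complex.norm_real, Real.norm_eq_abs, div_mul_eq_mul_div, one_mul]
    gcongr
    · refine h2.trans (Real.exp_le_exp.2 ?_)
      nlinarith
    · nlinarith
  · exact ContinuousAt.comp (g := sinhc) (f := fun p : X × ℝ => α * (p.2:ℂ))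
      continuous_sinhc.continuousAt (by fun_prop)

theorem sinh_abs_re_le_norm (z : ℂ) : Real.sinh |z.re| ≤ ‖Complex.sinh z‖ := by
  rcases abs_choice z.re with h | h
  · rw [h]; exact sinh_re_le_norm z
  · rw [h]
    simpa [Complex.sinh_neg] using sinh_re_le_norm (-z)

theorem continuousAt_inv_sinhc {α β : ℂ} (hα : 0 < α.re) (y : ℝ) :
    ContinuousAt (fun p : ℝ × ℝ => 1/sinhc (α*p.2 + β*p.1)) (0, y) := by
  refine ContinuousAt.div continuousAt_const ?_ ?_
  · exact ContinuousAt.comp (g := sinhc) (f := fun p : ℝ × ℝ => α*(p.2:ℂ) + β*(p.1:ℂ))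
      continuous_sinhc.continuousAt (by fun_prop)
  · simpa using sinhc_mul_ne_zero hα y

theorem expBound_inv_sinhc {α β : ℂ} (hα : 0 < α.re) :
    ExpBound (𝓝 (0:ℝ)) (fun ε x => 1/sinhc (α*x + β*ε)) (-α.re) := by
  refine ExpBound.of_outside (fun δ hδ => ?_) fun y _ => continuousAt_inv_sinhc hα y
  have hc0 := one_sub_exp_pos (half_pos hα)
  set c₀ := (1 - Real.exp (-2*(α.re/2)))/2 with hc₀
  refine ⟨(‖α‖+1)*(1/δ)*Real.exp 1/c₀, ?_⟩
  have hsm : ∀ᶠ ε : ℝ in 𝓝 0, ‖β*ε‖ < min 1 (α.re/2) := by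
    have : ContinuousAt (fun ε : ℝ => ‖β*ε‖) 0 := by fun_prop
    exact this.eventually_lt_const (by simpa using hα)
  filter_upwards [hsm] with ε hε x hx
  rw [lt_min_iff] at hε
  have h1 := (Complex.abs_re_le_norm (β*ε)).trans_lt hε.1
  have h2 := (Complex.abs_re_le_norm (β*ε)).trans_lt hε.2
  set z := α*x + β*ε with hz
  have hre : z.re = α.re * x + (β*ε).re := by rw [hz, Complex.add_re, Complex.re_mul_ofReal]
  have h3 : α.re * |x| - |(β*ε).re| ≤ |z.re| := by
    rw [hre, ← abs_of_pos hα, ← abs_mul, abs_of_pos hα]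
    have := abs_sub_abs_le_abs_sub (α.re * x) (-(β*ε).re)
    rwa [abs_neg, sub_neg_eq_add] at this
  have h4 : α.re/2 ≤ |z.re| := by nlinarith
  have h5 := (exp_le_sinh h4).trans (sinh_abs_re_le_norm z)
  have h6 : Real.exp (α.re * |x| - 1) ≤ Real.exp |z.re| := Real.exp_le_exp.2 (by linarith)
  have hs : Complex.sinh z ≠ 0 := norm_pos_iff.1 (lt_of_lt_of_le (by positivity) h5)
  have hsc : 1/sinhc z = z/Complex.sinh z := by
    rw [div_eq_div_iff (sinhc_ne_zero hs) hs, one_mul, mul_sinhc]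
  have h7 : ‖z‖ ≤ (‖α‖+1) * |x| := by
    calc ‖z‖ ≤ ‖α*x‖ + ‖β*ε‖ := norm_add_le _ _
      _ ≤ ‖α‖ * |x| + 1 := by
        rw [norm_mul, Complex.norm_real, Real.norm_eq_abs]; linarith [hε.1]
      _ ≤ _ := by linarith
  rw [hsc, norm_div]
  calc ‖z‖/‖Complex.sinh z‖ ≤ ((‖α‖+1) * |x|)/(c₀ * Real.exp (α.re * |x| - 1)) := by
        gcongr
        exact (mul_le_mul_of_nonneg_left h6 hc0.le).trans h5
    _ ≤ ((‖α‖+1) * (1/δ * Real.exp (δ * |x|)))/(c₀ * Real.exp (α.re * |x| - 1)) := by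
        gcongr
        exact abs_le_exp_mul_abs hδ x
    _ = _ := by
      rw [show (-α.re+δ) * |x| = δ * |x| + -(α.re * |x|) by ring, Real.exp_add, Real.exp_sub,
        Real.exp_neg]
      field_simp

theorem tendsto_div_one_add_sq_cobounded :
    Tendsto (fun y : ℝ => y/(1+y^2)) atTop (𝓝 0) := by
  refine squeeze_zero' (g := fun y : ℝ => y⁻¹) ?_ ?_ tendsto_inv_atTop_zero
  · filter_upwards [eventually_gt_atTop 0] with y hy
    positivity
  · filter_upwards [eventually_gt_atTop 0] with y hy
    rw [div_le_iff₀ (by positivity)]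
    field_simp
    linarith

theorem integrable_sq_div : Integrable (fun y : ℝ => y^2/(1+y^2)^2) := by
  refine integrable_inv_one_add_sq.mono' ?_ (Eventually.of_forall fun y => ?_)
  · exact (Continuous.div (by fun_prop) (by fun_prop) fun y => by positivity).aestronglyMeasurable
  · rw [Real.norm_eq_abs, abs_of_nonneg (by positivity), div_le_iff₀ (by positivity)]
    field_simp
    nlinarith [sq_nonneg y]

theorem integral_sq_div : ∫ y : ℝ, y^2/(1+y^2)^2 = Real.pi/2 := by
  have hd : ∀ y : ℝ, HasDerivAt (fun y => (Real.arctan y - y/(1+y^2))/2) (y^2/(1+y^2)^2) y := by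
    intro y
    have h0 : 1 + y^2 ≠ 0 := by positivity
    have h1 : HasDerivAt (fun y : ℝ => 1 + y^2) (2*y) y := by
      simpa using (hasDerivAt_pow 2 y).const_add 1
    refine (((Real.hasDerivAt_arctan y).sub ((hasDerivAt_id y).div h1 h0)).div_const 2).congr_deriv ?_
    simp only [_root_.id]
    field_simp
    ring
  have ht : Tendsto (fun y : ℝ => (Real.arctan y - y/(1+y^2))/2) atTop (𝓝 (Real.pi/4)) := by
    have := ((Real.tendsto_arctan_atTop.mono_right nhdsWithin_le_nhds).sub
      tendsto_div_one_add_sq_cobounded).div_const 2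
    convert this using 2; ring
  have hb : Tendsto (fun y : ℝ => (Real.arctan y - y/(1+y^2))/2) atBot (𝓝 (-(Real.pi/4))) := by
    have := (ht.comp tendsto_neg_atBot_atTop).neg
    refine this.congr fun y => ?_
    simp only [Function.comp_apply, Real.arctan_neg]
    ring
  rw [integral_of_hasDerivAt_of_tendsto hd integrable_sq_div hb ht]
  ring

section Pinch

variable {R F : ℝ → ℝ → ℂ} {c : ℝ} {m : ℕ}

theorem tendsto_pinch_regular (hm : 1 ≤ m) (hR : ExpBound (𝓝 0) R c) (hc : c < 0)
    (hRc : ∀ x : ℝ, ContinuousAt (fun p : ℝ × ℝ => R p.1 p.2) (0, x))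
    (hFc : ∀ᶠ ε in 𝓝[>] (0:ℝ), Continuous (F ε))
    (hF : ∀ᶠ ε in 𝓝[>] (0:ℝ), ∀ x : ℝ, F ε x = (x^(2*m+2)/(ε^2+x^2)^2 : ℝ) * R ε x) :
    Tendsto (fun ε => ∫ x, F ε x) (𝓝[>] 0) (𝓝 (∫ x : ℝ, (x:ℂ)^(2*m-2) * R 0 x)) := by
  have hb : ExpBound (𝓝[>] 0) F c := by
    have h1 : ExpBound (𝓝[>] (0:ℝ)) (fun ε x => (x:ℂ)^(2*m-2) * R ε x) c := by
      have := (ExpBound.id.pow (2*m-2)).mul (hR.comp (φ := fun ε => ε) (l' := 𝓝[>] (0:ℝ))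
        nhdsWithin_le_nhds)
      simpa using this
    refine h1.of_norm_le ?_
    filter_upwards [hF] with ε h2 x
    rw [h2, norm_mul, norm_mul, norm_pow, Complex.norm_real, Complex.norm_real]
    gcongr
    rw [norm_div, norm_pow, norm_pow, Real.norm_eq_abs, Real.norm_eq_abs]
    rcases eq_or_ne x 0 with rfl | hx
    · simp
    have : 0 < ε^2+x^2 := by positivity
    rw [abs_of_pos this, div_le_iff₀ (by positivity)]
    have e : |x|^(2*m+2) = |x|^(2*m-2) * (x^2)^2 := by
      rw [← sq_abs x, ← pow_mul, ← pow_add]; congr 1; omega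
    rw [e]
    gcongr
    nlinarith [sq_nonneg ε]
  refine tendsto_integral_of_expBound hb hc (hFc.mono fun _ h => h.aestronglyMeasurable) ?_
  filter_upwards [compl_mem_ae_iff.2 (measure_singleton (0:ℝ))] with x hx
  have hx : x ≠ 0 := hx
  have h1 : ContinuousAt (fun ε : ℝ => ((x^(2*m+2)/(ε^2+x^2)^2 : ℝ):ℂ) * R ε x) 0 := by
    refine ContinuousAt.mul ?_ ?_
    · refine Complex.continuous_ofReal.continuousAt.comp ?_
      exact ContinuousAt.div (by fun_prop) (by fun_prop) (by positivity)
    · exact ContinuousAt.comp (g := fun p : ℝ × ℝ => R p.1 p.2) (f := fun ε : ℝ => (ε, x))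
        (hRc x) (by fun_prop)
  have h2 := h1.tendsto.mono_left (nhdsWithin_le_nhds (s := Ioi (0:ℝ)))
  have e : ((x^(2*m+2)/(0^2+x^2)^2 : ℝ):ℂ) * R 0 x = (x:ℂ)^(2*m-2) * R 0 x := by
    have : (2*m+2) = (2*m-2)+4 := by omega
    rw [this, pow_add]
    have hx' : (x:ℂ) ≠ 0 := by exact_mod_cast hx
    push_cast
    field_simp
    ring
  rw [e] at h2
  refine h2.congr' ?_
  filter_upwards [hF] with ε h3 using (h3 x).symm

theorem tendsto_pinch_singular (hR : ExpBound (𝓝 0) R c) (hc : c < 0)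
    (hRc : ContinuousAt (fun p : ℝ × ℝ => R p.1 p.2) (0, 0))
    (hFc : ∀ᶠ ε in 𝓝[>] (0:ℝ), Continuous (F ε))
    (hF : ∀ᶠ ε in 𝓝[>] (0:ℝ), ∀ x : ℝ, F ε x = (x^2/(ε^2+x^2)^2 : ℝ) * R ε x) :
    Tendsto (fun ε : ℝ => ε * ∫ x, F ε x) (𝓝[>] 0) (𝓝 (Real.pi/2 * R 0 0)) := by
  obtain ⟨C, hC⟩ := hR (-c) (by linarith)
  have hC' : ∀ᶠ ε in 𝓝[>] (0:ℝ), ∀ x, ‖R ε x‖ ≤ C := by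
    refine (hC.filter_mono nhdsWithin_le_nhds).mono fun ε h x => ?_
    simpa using h x
  have hpos : ∀ᶠ ε in 𝓝[>] (0:ℝ), 0 < ε := eventually_mem_nhdsWithin
  have hlim : Tendsto (fun ε : ℝ => ∫ y : ℝ, ((y^2/(1+y^2)^2 : ℝ):ℂ) * R ε (ε*y)) (𝓝[>] 0)
      (𝓝 (∫ y : ℝ, ((y^2/(1+y^2)^2 : ℝ):ℂ) * R 0 0)) := by
    refine tendsto_integral_filter_of_dominated_convergence
      (fun y => y^2/(1+y^2)^2 * C) ?_ ?_ (integrable_sq_div.mul_const C) ?_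
    · filter_upwards [hFc, hF, hpos] with ε h1 h2 h3
      have : (fun y : ℝ => ((y^2/(1+y^2)^2 : ℝ):ℂ) * R ε (ε*y)) =
          fun y => (ε:ℂ)^2 * F ε (ε*y) := by
        ext y
        rw [h2]
        have h3' : (ε:ℂ) ≠ 0 := by exact_mod_cast h3.ne'
        have e : ε^2+(ε*y)^2 = ε^2*(1+y^2) := by ring
        rw [e]
        push_cast
        field_simp
      rw [this]
      exact (continuous_const.mul (h1.comp (by fun_prop))).aestronglyMeasurable
    · filter_upwards [hC'] with ε h1
      refine Eventually.of_forall fun y => ?_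
      rw [norm_mul, Complex.norm_real, Real.norm_eq_abs, abs_of_nonneg (by positivity)]
      gcongr
      exact h1 _
    · refine Eventually.of_forall fun y => Tendsto.const_mul _ ?_
      have : Tendsto (fun ε : ℝ => (ε, ε*y)) (𝓝[>] 0) (𝓝 ((0:ℝ),(0:ℝ))) := by
        have h1 : ContinuousAt (fun ε : ℝ => (ε, ε*y)) 0 := by fun_prop
        have h2 := h1.tendsto
        simp only [zero_mul] at h2
        exact h2.mono_left nhdsWithin_le_nhds
      exact Tendsto.comp (g := fun p : ℝ × ℝ => R p.1 p.2) hRc.tendsto this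
  have hint : ∫ y : ℝ, ((y^2/(1+y^2)^2 : ℝ):ℂ) = ((Real.pi/2 : ℝ):ℂ) := by
    rw [← integral_sq_div]; exact integral_ofReal
  rw [integral_mul_const, hint] at hlim
  push_cast at hlim
  refine hlim.congr' ?_
  filter_upwards [hF, hpos] with ε h2 h3
  have h3' : (ε:ℂ) ≠ 0 := by exact_mod_cast h3.ne'
  have e1 := Measure.integral_comp_mul_left (F ε) ε
  have e2 : (fun y : ℝ => ((y:ℂ)^2/(1+(y:ℂ)^2)^2) * R ε (ε*y)) =
      fun y => (ε:ℂ)^2 * F ε (ε*y) := by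
    ext y
    rw [h2]
    have e : ε^2+(ε*y)^2 = ε^2*(1+y^2) := by ring
    rw [e]
    push_cast
    field_simp
  rw [e2, integral_const_mul, e1, abs_of_pos (inv_pos.2 h3), Complex.real_smul]
  push_cast
  field_simp

end Pinch

end

section

open Filter Topology

theorem sinhc_neg (z : ℂ) : sinhc (-z) = sinhc z := by
  rcases eq_or_ne z 0 with rfl | hz
  · simp
  · refine mul_left_cancel₀ hz ?_
    have := mul_sinhc (-z)
    rw [Complex.sinh_neg] at this
    rw [mul_sinhc]
    linear_combination -this

theorem sin_eq_mul_sinhc (z : ℂ) : Complex.sin z = z * sinhc (Complex.I*z) := by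
  have := mul_sinhc (Complex.I*z)
  rw [mul_comm Complex.I z, Complex.sinh_mul_I] at this
  rw [mul_comm Complex.I z]
  linear_combination Complex.I*this + (Complex.sin z - z*sinhc (z*Complex.I))*Complex.I_sq

/-- The regularised limit of `(ε²+x²) h(ε-ix) h(ε+ix)`. -/
def pinchKer (op om : ℂ) (h : ℂ → ℂ) (ε x : ℝ) : ℂ :=
  h (om + ε - Complex.I*x) * h (op + ε + Complex.I*x) * (op*om/(4*Real.pi^2)) *
    (1/sinhc (Real.pi/op*x + Complex.I*Real.pi/op*ε) *
      (1/sinhc (Real.pi/om*x + -Complex.I*Real.pi/om*ε)))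

/-- The entire factor of `coshVar q x - 2 = x² · coshRem q x`. -/
def coshRem (q x : ℂ) : ℂ := 4*(Real.pi/q)^2 * sinhc (Real.pi/q*x)^2

/-- The entire factor of `sinhDens op om x = x² · sinhRem op om x`. -/
def sinhRem (op om x : ℂ) : ℂ :=
  16*Real.pi^2/(op*om) * (sinhc (2*Real.pi/op*x) * sinhc (2*Real.pi/om*x))

/-- The regularised moment integrand with two pinching parameters. -/
def pinchRem (op om : ℂ) (h : ℂ → ℂ) (A : Multiset ℂ) (i j : ℕ) (ε x : ℝ) : ℂ :=
  coshRem op x^i * coshRem om x^j * sinhRem op om x * pinchKer op om h ε x^2 * hypWt h A x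

theorem coshVar_sub_two (q x : ℂ) : coshVar q x - 2 = x^2 * coshRem q x := by
  have h1 : 2*Real.pi/q*x = 2*(Real.pi/q*x) := by ring
  have h2 := mul_sinhc (Real.pi/q*x)
  rw [coshVar, coshRem, h1, Complex.cosh_two_mul, Complex.cosh_sq, ← h2]
  ring

theorem sinhDens_eq_sq_mul (op om x : ℂ) : sinhDens op om x = x^2 * sinhRem op om x := by
  rw [sinhDens, sinhRem, ← mul_sinhc, ← mul_sinhc]
  simp only [div_eq_mul_inv, mul_inv]
  ring

namespace HypH

variable {op om : ℂ} {h : ℂ → ℂ}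

theorem sinhc_sin_ne_zero {op w : ℂ} (h0 : 0 < w.re) (h1 : w.re < op.re) :
    sinhc (Complex.I*(Real.pi*w/op)) ≠ 0 := by
  intro hs
  have hop := ne_zero_of_re_pos' (h0.trans h1)
  have h2 := sin_eq_mul_sinhc (Real.pi*w/op)
  rw [hs, mul_zero, Complex.sin_eq_zero_iff] at h2
  obtain ⟨k, hk⟩ := h2
  have hpi : (Real.pi:ℂ) ≠ 0 := by exact_mod_cast Real.pi_ne_zero
  have h3 : w = k*op := by
    field_simp at hk
    linear_combination hk
  have h4 : w.re = k*op.re := by rw [h3]; simp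
  rw [h4] at h0 h1
  have hop' : 0 < op.re := by
    by_contra hh
    have := (Complex.re_le_norm op)
    nlinarith [h0, h1]
  have h5 : (0:ℝ) < k := by
    by_contra hh; nlinarith
  have h6 : (k:ℝ) < 1 := by
    by_contra hh; nlinarith
  have h7 : 0 < k := by exact_mod_cast h5
  have h8 : k < 1 := by exact_mod_cast h6
  omega

theorem mul_apply_eq (H : HypH op om h) {w : ℂ} (h0 : 0 < w.re) (h1 : w.re < op.re) :
    w * h w = op/(2*Real.pi) * h (w+om) * (1/sinhc (Complex.I*(Real.pi*w/op))) := by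
  have hop := ne_zero_of_re_pos' H.pop
  have hpi : (Real.pi:ℂ) ≠ 0 := by exact_mod_cast Real.pi_ne_zero
  have := sinhc_sin_ne_zero h0 h1
  rw [H.shm w h0, sin_eq_mul_sinhc]
  generalize sinhc (Complex.I*(Real.pi*w/op)) = S at this
  field_simp

theorem pinchKer_eq (H : HypH op om h) {ε : ℝ} (h0 : 0 < ε) (h1 : ε < op.re) (h2 : ε < om.re)
    (x : ℝ) : ((ε^2+x^2 : ℝ):ℂ) * (h (ε - Complex.I*x) * h (ε + Complex.I*x)) =
      pinchKer op om h ε x := by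
  have e1 := H.mul_apply_eq (w := ε - Complex.I*x) (by simpa using h0) (by simpa using h1)
  have e2 := H.swap.mul_apply_eq (w := ε + Complex.I*x) (by simpa using h0) (by simpa using h2)
  have e3 : Complex.I*(Real.pi*(ε - Complex.I*x)/op) =
      Real.pi/op*x + Complex.I*Real.pi/op*ε := by
    ring_nf; rw [Complex.I_sq]; ring
  have e4 : Complex.I*(Real.pi*(ε + Complex.I*x)/om) =
      -(Real.pi/om*x + -Complex.I*Real.pi/om*ε) := by
    ring_nf; rw [Complex.I_sq]; ring
  rw [e3] at e1
  rw [e4, sinhc_neg] at e2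
  have e5 : ((ε^2+x^2 : ℝ):ℂ) = (ε - Complex.I*x) * (ε + Complex.I*x) := by
    push_cast; linear_combination (x:ℂ)^2 * Complex.I_sq
  have e6 : (ε - Complex.I*x) + om = om + ε - Complex.I*x := by ring
  have e7 : (ε + Complex.I*x) + op = op + ε + Complex.I*x := by ring
  rw [e6] at e1
  rw [e7] at e2
  rw [e5]
  calc _ = ((ε - Complex.I*x) * h (ε - Complex.I*x)) * ((ε + Complex.I*x) * h (ε + Complex.I*x)) := by
        ring
    _ = _ := by rw [e1, e2, pinchKer]; ring

theorem momKer_pinch (H : HypH op om h) {ε : ℝ} (h0 : 0 < ε) (h1 : ε < op.re) (h2 : ε < om.re)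
    (A : Multiset ℂ) (i j : ℕ) (x : ℝ) :
    momKer op om 2 2 i j (hypWt h (ε ::ₘ ε ::ₘ A)) x =
      (x^(2*(i+j)+2)/(ε^2+x^2)^2 : ℝ) * pinchRem op om h A i j ε x := by
  have hp : (0:ℝ) < ε^2+x^2 := by positivity
  have hp' : ((ε^2+x^2 : ℝ):ℂ) ≠ 0 := by exact_mod_cast hp.ne'
  rw [momKer, hypWt_cons, hypWt_cons, coshVar_sub_two, coshVar_sub_two, sinhDens_eq_sq_mul,
    pinchRem, ← H.pinchKer_eq h0 h1 h2]
  have e : ((x^(2*(i+j)+2)/(ε^2+x^2)^2 : ℝ):ℂ) = (x:ℂ)^(2*(i+j)+2)/((ε^2+x^2 : ℝ):ℂ)^2 := by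
    push_cast; ring
  rw [e]
  generalize ((ε^2+x^2 : ℝ):ℂ) = D at hp'
  field_simp
  ring

theorem expBound_pinchKer (H : HypH op om h) :
    ExpBound (𝓝 (0:ℝ)) (pinchKer op om h) (-Real.pi*((1/op).re+(1/om).re)) := by
  have key : ∀ q : ℂ, (Real.pi/q : ℂ).re = Real.pi*(1/q).re := by
    intro q
    rw [← Complex.re_ofReal_mul]; congr 1; ring
  have hp : ∀ q : ℂ, 0 < q.re → 0 < (Real.pi/q : ℂ).re := by
    intro q hq
    rw [key]
    have := re_inv_pos hq
    positivity
  have t : ∀ q : ℂ, Tendsto (fun ε : ℝ => q + ε) (𝓝 0) (𝓝 q) := by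
    intro q
    have : Continuous (fun ε : ℝ => q + ε) := by fun_prop
    simpa using this.tendsto 0
  have h1 := H.expBound (t om) (t op) H.pom H.pop
  have h2 := ExpBound.const (l := 𝓝 (0:ℝ)) (tendsto_const_nhds (x := op*om/(4*(Real.pi:ℂ)^2)))
  have h3 := expBound_inv_sinhc (β := Complex.I*Real.pi/op) (hp op H.pop)
  have h4 := expBound_inv_sinhc (β := -Complex.I*Real.pi/om) (hp om H.pom)
  refine ((h1.mul h2).mul (h3.mul h4)).mono (le_of_eq ?_)
  have : op+om-om-op = 0 := by ring
  rw [this, key, key]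
  simp
  ring

theorem continuousAt_pinchKer (H : HypH op om h) (x : ℝ) :
    ContinuousAt (fun p : ℝ × ℝ => pinchKer op om h p.1 p.2) (0, x) := by
  have hp : ∀ q : ℂ, 0 < q.re → 0 < (Real.pi/q : ℂ).re := by
    intro q hq
    have e : (Real.pi/q : ℂ) = (Real.pi:ℂ)*(1/q) := by ring
    rw [e, Complex.re_ofReal_mul]
    have := re_inv_pos hq
    positivity
  unfold pinchKer
  refine ((ContinuousAt.mul ?_ ?_).mul continuousAt_const).mul
    ((continuousAt_inv_sinhc (hp op H.pop) x).mul (continuousAt_inv_sinhc (hp om H.pom) x))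
  · exact ContinuousAt.comp (g := h) (f := fun p : ℝ × ℝ => om + (p.1:ℂ) - Complex.I*(p.2:ℂ))
      (H.continuousAt (by simpa using H.pom)) (by fun_prop)
  · exact ContinuousAt.comp (g := h) (f := fun p : ℝ × ℝ => op + (p.1:ℂ) + Complex.I*(p.2:ℂ))
      (H.continuousAt (by simpa using H.pop)) (by fun_prop)

theorem continuousAt_pinchRem (H : HypH op om h) {A : Multiset ℂ} (hA : ∀ a ∈ A, 0 < a.re)
    (i j : ℕ) (x : ℝ) :
    ContinuousAt (fun p : ℝ × ℝ => pinchRem op om h A i j p.1 p.2) (0, x) := by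
  unfold pinchRem coshRem sinhRem
  have hs : ∀ α : ℂ, ContinuousAt (fun p : ℝ × ℝ => sinhc (α*(p.2:ℂ))) (0, x) := fun α =>
    ContinuousAt.comp (g := sinhc) (f := fun p : ℝ × ℝ => α*(p.2:ℂ))
      continuous_sinhc.continuousAt (by fun_prop)
  refine ((((ContinuousAt.pow ?_ _).mul (ContinuousAt.pow ?_ _)).mul ?_).mul
    ((H.continuousAt_pinchKer x).pow 2)).mul ?_
  · exact continuousAt_const.mul ((hs _).pow 2)
  · exact continuousAt_const.mul ((hs _).pow 2)
  · exact continuousAt_const.mul ((hs _).mul (hs _))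
  · exact ContinuousAt.comp (g := fun x : ℝ => hypWt h A x) (f := fun p : ℝ × ℝ => p.2)
      (H.continuous_hypWt hA).continuousAt continuousAt_snd

theorem expBound_pinchRem (H : HypH op om h) {A : Multiset ℂ} (hA : ∀ a ∈ A, 0 < a.re)
    (i j : ℕ) :
    ExpBound (𝓝 (0:ℝ)) (pinchRem op om h A i j)
      (2*Real.pi*((i+1)*(1/op).re + (j+1)*(1/om).re) +
        ((0 ::ₘ 0 ::ₘ A).map fun a => -Real.pi * ((op+om-a-a)/(op*om)).re).sum) := by
  have key : ∀ q : ℂ, 0 < q.re → |(Real.pi/q : ℂ).re| = Real.pi*(1/q).re := by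
    intro q hq
    have e : (Real.pi/q : ℂ) = (Real.pi:ℂ)*(1/q) := by ring
    rw [e, Complex.re_ofReal_mul, abs_of_pos]
    have := re_inv_pos hq
    positivity
  have hpi : (Real.pi:ℂ) ≠ 0 := by exact_mod_cast Real.pi_ne_zero
  have hc : ∀ q : ℂ, 0 < q.re → ExpBound (𝓝 (0:ℝ)) (fun _ x => coshRem q x)
      (2*(Real.pi*(1/q).re)) := by
    intro q hq
    have h1 := (expBound_sinhc (0:ℝ) (α := Real.pi/q)
      (div_ne_zero hpi (ne_zero_of_re_pos' hq))).pow 2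
    rw [key q hq] at h1
    simpa [coshRem] using
      (ExpBound.const (l := 𝓝 (0:ℝ)) (tendsto_const_nhds (x := 4*(Real.pi/q)^2))).mul h1
  have h2pi : ∀ q : ℂ, 0 < q.re → (2*Real.pi/q : ℂ) ≠ 0 := fun q hq =>
    div_ne_zero (mul_ne_zero two_ne_zero hpi) (ne_zero_of_re_pos' hq)
  have hs := (ExpBound.const (l := 𝓝 (0:ℝ))
      (tendsto_const_nhds (x := 16*(Real.pi:ℂ)^2/(op*om)))).mul
    ((expBound_sinhc (0:ℝ) (h2pi op H.pop)).mul (expBound_sinhc (0:ℝ) (h2pi om H.pom)))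
  rw [abs_two_pi_div_re H.pop, abs_two_pi_div_re H.pom] at hs
  refine ((((((hc op H.pop).pow i).mul ((hc om H.pom).pow j)).mul hs).mul
    (H.expBound_pinchKer.pow 2)).mul (H.expBound_hypWt _ hA)).mono (le_of_eq ?_)
  simp only [Multiset.map_cons, Multiset.sum_cons, sub_zero, re_add_div_mul H.pop H.pom]
  push_cast
  ring

theorem pow_mul_pinchRem_zero (H : HypH op om h) (A : Multiset ℂ) (i j : ℕ) (x : ℝ) :
    (x:ℂ)^(2*((i+1)+(j+1))-2) * pinchRem op om h A (i+1) (j+1) 0 x =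
      momKer op om 2 2 i j (hypWt h A) x := by
  have hop := ne_zero_of_re_pos' H.pop
  have hom := ne_zero_of_re_pos' H.pom
  have hpi : (Real.pi:ℂ) ≠ 0 := by exact_mod_cast Real.pi_ne_zero
  have hs : ∀ q : ℂ, 0 < q.re → sinhc (Real.pi/q*x) ≠ 0 := by
    intro q hq
    refine sinhc_mul_ne_zero ?_ x
    have e : (Real.pi/q : ℂ) = (Real.pi:ℂ)*(1/q) := by ring
    rw [e, Complex.re_ofReal_mul]
    have := re_inv_pos hq
    positivity
  have h1 := hs op H.pop
  have h2 := hs om H.pom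
  have hr := H.refl (om - Complex.I*x) (by simpa using H.pom) (by simpa using H.pop)
  have e0 : op+om-(om-Complex.I*x) = op + Complex.I*x := by ring
  rw [e0] at hr
  have hk : coshRem op x * coshRem om x * pinchKer op om h 0 x^2 = 1 := by
    simp only [pinchKer, coshRem, Complex.ofReal_zero, mul_zero, add_zero, hr]
    generalize sinhc (Real.pi/op*x) = S at h1
    generalize sinhc (Real.pi/om*x) = T at h2
    field_simp
  rw [momKer, coshVar_sub_two, coshVar_sub_two, sinhDens_eq_sq_mul, pinchRem]
  have e : 2*((i+1)+(j+1))-2 = 2*i+2*j+2 := by omega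
  rw [e]
  linear_combination (x:ℂ)^(2*i+2*j+2) * coshRem op x^i * coshRem om x^j * sinhRem op om x *
    hypWt h A x * hk

theorem pinchRem_zero_zero (H : HypH op om h) (A : Multiset ℂ) :
    pinchRem op om h A 0 0 0 0 = op*om/Real.pi^2 * (A.map fun a => h a).prod^2 := by
  have hop := ne_zero_of_re_pos' H.pop
  have hom := ne_zero_of_re_pos' H.pom
  have hpi : (Real.pi:ℂ) ≠ 0 := by exact_mod_cast Real.pi_ne_zero
  have hr := H.refl om H.pom (by linarith [H.pop])
  have e0 : op+om-om = op := by ring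
  rw [e0] at hr
  simp only [pinchRem, sinhRem, pinchKer, hypWt, Complex.ofReal_zero, mul_zero, add_zero,
    sub_zero, sinhc_zero, hr, Multiset.prod_map_mul]
  field_simp
  norm_num

end HypH

end

section

open Filter Topology

namespace HypH

variable {op om : ℂ} {h : ℂ → ℂ}

theorem tendsto_mul_momDet_pinch (H : HypH op om h) {A : Multiset ℂ} {n : ℕ}
    (hA : Adm op om A) (hc : A.card = 2*n+2) :
    Tendsto (fun ε : ℝ => ε * momDet op om h (n+1) ((ε:ℂ) ::ₘ (ε:ℂ) ::ₘ A)) (𝓝[>] 0)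
      (𝓝 (op*om/(2*Real.pi) * (A.map fun a => h a).prod^2 * momDet op om h n A)) := by
  have hpos : ∀ᶠ ε in 𝓝[>] (0:ℝ), 0 < ε := eventually_mem_nhdsWithin
  have hlt : ∀ r : ℝ, 0 < r → ∀ᶠ ε in 𝓝[>] (0:ℝ), ε < r := fun r hr =>
    (eventually_lt_nhds hr).filter_mono nhdsWithin_le_nhds
  have hneg : ∀ i j : Fin (n+1), 2*Real.pi*(((i:ℕ)+1)*(1/op).re + ((j:ℕ)+1)*(1/om).re) +
      ((0 ::ₘ 0 ::ₘ A).map fun a => -Real.pi * ((op+om-a-a)/(op*om)).re).sum < 0 := fun i j =>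
    momKer_exponent_neg (n := n+1) H.pop H.pom (by simp [hc]; ring) (by simpa using hA.2) i.2 j.2
  set F : Fin (n+1) → Fin (n+1) → ℝ → ℝ → ℂ := fun i j ε x =>
    momKer op om 2 2 i j (hypWt h ((ε:ℂ) ::ₘ (ε:ℂ) ::ₘ A)) x with hFdef
  have hFc : ∀ i j, ∀ᶠ ε in 𝓝[>] (0:ℝ), Continuous (F i j ε) := by
    intro i j
    filter_upwards [hpos] with ε hε
    refine continuous_momKer_ofReal _ _ (H.continuous_hypWt fun a ha => ?_)
    simp only [Multiset.mem_cons] at ha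
    rcases ha with rfl | rfl | ha
    · simpa using hε
    · simpa using hε
    · exact hA.1 a ha
  have hF : ∀ i j, ∀ᶠ ε in 𝓝[>] (0:ℝ), ∀ x : ℝ, F i j ε x =
      (x^(2*((i:ℕ)+(j:ℕ))+2)/(ε^2+x^2)^2 : ℝ) * pinchRem op om h A i j ε x := by
    intro i j
    filter_upwards [hpos, hlt _ H.pop, hlt _ H.pom] with ε h0 h1 h2 x
    exact H.momKer_pinch h0 h1 h2 A i j x
  have hreg : ∀ i j : Fin (n+1), 1 ≤ (i:ℕ)+(j:ℕ) → Tendsto (fun ε => ∫ x, F i j ε x) (𝓝[>] 0)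
      (𝓝 (∫ x : ℝ, (x:ℂ)^(2*((i:ℕ)+(j:ℕ))-2) * pinchRem op om h A i j 0 x)) := fun i j hij =>
    tendsto_pinch_regular hij (H.expBound_pinchRem hA.1 i j) (hneg i j)
      (H.continuousAt_pinchRem hA.1 i j) (hFc i j) (hF i j)
  have hsing : Tendsto (fun ε : ℝ => ε * ∫ x, F 0 0 ε x) (𝓝[>] 0)
      (𝓝 (Real.pi/2 * pinchRem op om h A 0 0 0 0)) :=
    tendsto_pinch_singular (H.expBound_pinchRem hA.1 0 0) (by simpa using hneg 0 0)
      (H.continuousAt_pinchRem hA.1 0 0 0) (hFc 0 0) (by simpa using hF 0 0)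
  have hε0 : Tendsto (fun ε : ℝ => (ε:ℂ)) (𝓝[>] 0) (𝓝 0) := by
    have := (Complex.continuous_ofReal.tendsto 0).mono_left (nhdsWithin_le_nhds (s := Ioi (0:ℝ)))
    simpa using this
  set L : Matrix (Fin (n+1)) (Fin (n+1)) ℂ := Matrix.of fun i j =>
    Fin.cases (Fin.cases (Real.pi/2 * pinchRem op om h A 0 0 0 0) (fun _ => 0) j)
      (fun i' => ∫ x : ℝ, (x:ℂ)^(2*((i'.succ:ℕ)+(j:ℕ))-2) * pinchRem op om h A i'.succ j 0 x) i
    with hL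
  have hM : Tendsto (fun ε : ℝ => (Matrix.of fun i j : Fin (n+1) =>
      (Fin.cons (ε:ℂ) (fun _ => 1) : Fin (n+1) → ℂ) i * ∫ x, F i j ε x)) (𝓝[>] 0) (𝓝 L) := by
    refine tendsto_pi_nhds.2 fun i => tendsto_pi_nhds.2 fun j => ?_
    simp only [Matrix.of_apply, hL]
    induction i using Fin.cases with
    | zero =>
      induction j using Fin.cases with
      | zero => simpa using hsing
      | succ j => simpa using hε0.mul (hreg 0 j.succ (by simp))
    | succ i =>
      simpa using hreg i.succ j (by simp; omega)
  have hdet := ((Continuous.matrix_det (continuous_id (X := Matrix (Fin (n+1)) (Fin (n+1)) ℂ))).tendsto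
    L).comp hM
  have hLdet : L.det = op*om/(2*Real.pi) * (A.map fun a => h a).prod^2 * momDet op om h n A := by
    rw [Matrix.det_succ_row_zero, Fin.sum_univ_succ]
    have h0 : ∀ j : Fin n, L 0 j.succ = 0 := fun j => rfl
    simp only [h0, mul_zero, zero_mul, Finset.sum_const_zero, add_zero]
    have h00 : L 0 0 = Real.pi/2 * pinchRem op om h A 0 0 0 0 := rfl
    rw [h00, H.pinchRem_zero_zero, H.momDet_eq hA hc 2 2]
    have hpi : (Real.pi:ℂ) ≠ 0 := by exact_mod_cast Real.pi_ne_zero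
    have : L.submatrix Fin.succ (Fin.succAbove 0) =
        Matrix.of fun i k : Fin n => ∫ x : ℝ, momKer op om 2 2 i k (hypWt h A) x := by
      ext i k
      simp only [hL, Matrix.submatrix_apply, Matrix.of_apply, Fin.cases_succ, Fin.val_succ,
        Fin.zero_succAbove, H.pow_mul_pinchRem_zero]
    rw [this]
    simp only [Fin.val_zero, pow_zero, one_mul]
    field_simp
  simp only [id, hLdet] at hdet
  refine hdet.congr' ?_
  have hadm : ∀ᶠ ε : ℝ in 𝓝[>] (0:ℝ), 0 < ((op+om-((ε:ℂ) ::ₘ (ε:ℂ) ::ₘ A).sum)/(op*om)).re := by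
    have : ContinuousAt (fun ε : ℝ => ((op+om-((ε:ℂ) + ((ε:ℂ) + A.sum)))/(op*om)).re) 0 := by
      fun_prop
    simpa using (this.eventually_const_lt (by simpa using hA.2)).filter_mono nhdsWithin_le_nhds
  filter_upwards [hpos, hadm] with ε hε ha
  rw [H.momDet_eq (n := n+1) ⟨fun a ha => ?_, ha⟩ (by simp [hc]; ring) 2 2]
  · simp only [Function.comp]
    have := Matrix.det_mul_column (Fin.cons (ε:ℂ) (fun _ => 1) : Fin (n+1) → ℂ)
      (Matrix.of fun i j => ∫ x, F i j ε x)
    rw [Fin.prod_univ_succ] at this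
    simpa using this
  · simp only [Multiset.mem_cons] at ha
    rcases ha with rfl | rfl | ha
    · simpa using hε
    · simpa using hε
    · exact hA.1 a ha

theorem tendsto_mul_apply_two_mul (H : HypH op om h) :
    Tendsto (fun ε : ℝ => ε * h (ε+ε)) (𝓝[>] 0) (𝓝 ((op*om)^((1:ℂ)/2)/(4*Real.pi))) := by
  have hpos : ∀ᶠ ε in 𝓝[>] (0:ℝ), 0 < ε := eventually_mem_nhdsWithin
  have hlt : ∀ᶠ ε in 𝓝[>] (0:ℝ), ε < op.re/2 :=
    (eventually_lt_nhds (half_pos H.pop)).filter_mono nhdsWithin_le_nhds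
  have hc : ContinuousAt (fun ε : ℝ => op/(4*Real.pi) * h ((ε+ε:ℂ)+om) *
      (1/sinhc (Complex.I*(Real.pi*(ε+ε)/op)))) 0 := by
    refine ContinuousAt.mul (ContinuousAt.mul continuousAt_const ?_) ?_
    · exact ContinuousAt.comp (g := h) (f := fun ε : ℝ => (ε+ε:ℂ)+om)
        (H.continuousAt (by simpa using H.pom)) (by fun_prop)
    · refine ContinuousAt.div continuousAt_const ?_ (by simp [sinhc_zero])
      exact ContinuousAt.comp (g := sinhc) (f := fun ε : ℝ => Complex.I*(Real.pi*(ε+ε:ℂ)/op))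
        continuous_sinhc.continuousAt (by fun_prop)
  have h1 := hc.tendsto.mono_left (nhdsWithin_le_nhds (s := Ioi (0:ℝ)))
  simp only [Complex.ofReal_zero, add_zero, zero_add, mul_zero, zero_div, sinhc_zero, div_one,
    mul_one] at h1
  have e : op/(4*Real.pi) * h om = (op*om)^((1:ℂ)/2)/(4*Real.pi) := by
    rw [← H.resm]; ring
  rw [e] at h1
  refine h1.congr' ?_
  filter_upwards [hpos, hlt] with ε h2 h3
  have := H.mul_apply_eq (w := ε+ε) (by simpa using h2) (by simp; linarith)
  linear_combination -(1/2:ℂ)*this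

theorem tendsto_mul_pairProd_pinch (H : HypH op om h) {A : Multiset ℂ} (hA : ∀ a ∈ A, 0 < a.re) :
    Tendsto (fun ε : ℝ => ε * pairProd h ((ε:ℂ) ::ₘ (ε:ℂ) ::ₘ A)) (𝓝[>] 0)
      (𝓝 ((op*om)^((1:ℂ)/2)/(4*Real.pi) * (A.map fun a => h a).prod^2 * pairProd h A)) := by
  have h1 : Tendsto (fun ε : ℝ => (A.map fun b => h (b+ε)).prod) (𝓝[>] 0)
      (𝓝 (A.map fun a => h a).prod) := by
    refine tendsto_multiset_prod (ι := ℂ) A fun a ha => ?_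
    have : ContinuousAt (fun ε : ℝ => h (a + ε)) 0 :=
      ContinuousAt.comp (g := h) (f := fun ε : ℝ => a + (ε:ℂ))
        (H.continuousAt (by simpa using hA a ha)) (by fun_prop)
    simpa using this.tendsto.mono_left (nhdsWithin_le_nhds (s := Ioi (0:ℝ)))
  have h2 := ((H.tendsto_mul_apply_two_mul.mul (h1.pow 2)).mul_const (pairProd h A))
  refine h2.congr fun ε => ?_
  rw [pairProd_cons, pairProd_cons, Multiset.map_cons, Multiset.prod_cons]
  ring

theorem ne_zero_of_two_mul (H : HypH op om h) {w : ℂ} (h1 : 0 < w.re)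
    (h2 : 0 < ((op+om-(w+w))/(op*om)).re) : h w ≠ 0 := by
  refine H.ne_zero_of_re h1 ?_
  have e : (op+om-w)/(op*om) = ((op+om)/(op*om) + (op+om-(w+w))/(op*om))/2 := by ring
  have h3 := re_inv_pos H.pop
  have h4 := re_inv_pos H.pom
  rw [e, Complex.div_ofNat_re, Complex.add_re, re_add_div_mul H.pop H.pom]
  positivity

theorem momDet_mul_of_im_ne_zero (H : HypH op om h) (hP : (op*om).im ≠ 0)
    (hD : (op * starRingEnd ℂ om).im ≠ 0) (n : ℕ) (A : Multiset ℂ) (hc : A.card = 2*n+2)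
    (hA : Adm op om A) :
    momDet op om h n A * h A.sum = (2*(op*om)^((1:ℂ)/2))^n * pairProd h A := by
  have hop := ne_zero_of_re_pos' H.pop
  have hom := ne_zero_of_re_pos' H.pom
  have hpi : (Real.pi:ℂ) ≠ 0 := by exact_mod_cast Real.pi_ne_zero
  set s := (op*om)^((1:ℂ)/2) with hs
  have hs2 : s^2 = op*om := cpow_half_sq _
  induction n generalizing A with
  | zero =>
    obtain ⟨a, b, rfl⟩ := Multiset.card_eq_two.1 hc
    have e : ({a, b} : Multiset ℂ) = a ::ₘ b ::ₘ 0 := rfl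
    rw [e, pairProd_cons, pairProd_cons]
    simp [momDet, pairProd, add_comm, Multiset.powersetCard_zero_right]
  | succ n ih =>
    obtain ⟨C, hC⟩ := H.exists_momDet_eq hP hD (n+1)
    suffices C = (2*s)^(n+1) by rw [hC A hc hA, this]
    obtain ⟨w, hw1, hw2, hw3, -⟩ := H.exists_deep hP n 0
    set B := Multiset.replicate (2*n+2) w with hB
    have hBc : B.card = 2*n+2 := Multiset.card_replicate _ _
    have hpos : ∀ᶠ ε in 𝓝[>] (0:ℝ), 0 < ε := eventually_mem_nhdsWithin
    have hadm : ∀ᶠ ε : ℝ in 𝓝[>] (0:ℝ), 0 < ((op+om-((ε:ℂ) ::ₘ (ε:ℂ) ::ₘ B).sum)/(op*om)).re := by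
      have : ContinuousAt (fun ε : ℝ => ((op+om-((ε:ℂ) + ((ε:ℂ) + B.sum)))/(op*om)).re) 0 := by
        fun_prop
      simpa using (this.eventually_const_lt (by simpa using hw3.2)).filter_mono nhdsWithin_le_nhds
    have hsum : 0 < B.sum.re := by
      rw [hB, Multiset.sum_replicate, Complex.re_nsmul]
      positivity
    have hh : Tendsto (fun ε : ℝ => h (((ε:ℂ) ::ₘ (ε:ℂ) ::ₘ B).sum)) (𝓝[>] 0) (𝓝 (h B.sum)) := by
      have : ContinuousAt (fun ε : ℝ => h ((ε:ℂ) + ((ε:ℂ) + B.sum))) 0 :=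
        ContinuousAt.comp (g := h) (f := fun ε : ℝ => (ε:ℂ) + ((ε:ℂ) + B.sum))
          (H.continuousAt (by simpa using hsum)) (by fun_prop)
      simpa using this.tendsto.mono_left (nhdsWithin_le_nhds (s := Ioi (0:ℝ)))
    have t1 := (H.tendsto_mul_momDet_pinch hw3 hBc).mul hh
    have t2 := (H.tendsto_mul_pairProd_pinch hw3.1).const_mul C
    have t3 := t1.congr' (f₂ := fun ε : ℝ => C * (ε * pairProd h ((ε:ℂ) ::ₘ (ε:ℂ) ::ₘ B))) (by
      filter_upwards [hpos, hadm] with ε h1 h2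
      have := hC ((ε:ℂ) ::ₘ (ε:ℂ) ::ₘ B) (by simp [hBc]; ring) ⟨fun a ha => by
        simp only [Multiset.mem_cons] at ha
        rcases ha with rfl | rfl | ha
        · simpa using h1
        · simpa using h1
        · exact hw3.1 a ha, h2⟩
      linear_combination (ε:ℂ)*this)
    have key := tendsto_nhds_unique t2 t3
    have h0 : (B.map fun a => h a).prod ≠ 0 := by
      refine Multiset.prod_ne_zero fun h0 => ?_
      obtain ⟨b, hb, h0⟩ := Multiset.mem_map.1 h0
      rw [Multiset.eq_of_mem_replicate hb] at h0
      exact H.ne_zero_of_two_mul hw1 hw2 h0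
    have hPP := H.pairProd_replicate_ne_zero hw1 hw2 (2*n+2)
    have hs0 : s ≠ 0 := fun h => by rw [h] at hs2; simp [hop, hom] at hs2
    have key2 := ih B hBc hw3
    have h3 : s/(4*Real.pi) * (B.map fun a => h a).prod^2 * pairProd h B * (C - (2*s)^(n+1)) = 0 := by
      have e1 : op*om/(2*Real.pi) = 2*s*(s/(4*Real.pi)) := by
        rw [← hs2]; field_simp; norm_num
      rw [e1] at key
      rw [pow_succ]
      linear_combination key + 2*s*(s/(4*Real.pi)) * (B.map fun a => h a).prod^2 * key2
    have h4 : s/(4*Real.pi) * (B.map fun a => h a).prod^2 * pairProd h B ≠ 0 := by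
      refine mul_ne_zero (mul_ne_zero (div_ne_zero hs0 (by simp)) (pow_ne_zero _ h0)) hPP
    exact sub_eq_zero.1 ((mul_eq_zero.1 h3).resolve_left h4)

end HypH

end

section

open Filter Topology

variable {G : ℂ → ℂ → ℂ → ℂ}

theorem continuousAt_hypH_left (hG : IsHypGammaFamily G) {op₀ om a : ℂ} (hop : 0 < op₀.re)
    (hom : 0 < om.re) (ha : 0 < a.re) : ContinuousAt (fun op => hypH G op om a) op₀ :=
  ContinuousAt.comp (g := fun p : ℂ × ℂ => hypH G p.1 om p.2) (f := fun op : ℂ => (op, a))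
    (continuousAt_hypH_joint hG hop hom a ha) (by fun_prop)

theorem expBound_hypH_left (hG : IsHypGammaFamily G) {op₀ om a : ℂ} (hop : 0 < op₀.re)
    (hom : 0 < om.re) (ha : 0 < a.re) :
    ExpBound (𝓝 op₀) (fun op x => hypH G op om (a - Complex.I*x) * hypH G op om (a + Complex.I*x))
      (-Real.pi * ((op₀+om-a-a)/(op₀*om)).re) := by
  intro δ hδ
  obtain ⟨C, hC⟩ := pairBound_of_pos hG hop hom a a ha ha δ hδ
  refine ⟨C, ?_⟩
  have : Tendsto (fun op : ℂ => (op, a, a)) (𝓝 op₀) (𝓝 (op₀, a, a)) :=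
    Continuous.tendsto (f := fun op : ℂ => (op, a, a)) (by fun_prop) op₀
  filter_upwards [this.eventually hC] with op h x
  refine (h x).trans (le_of_eq ?_)
  ring_nf

theorem continuousAt_momDet_left (hG : IsHypGammaFamily G) {op₀ om : ℂ} (hop : 0 < op₀.re)
    (hom : 0 < om.re) {n : ℕ} {A : Multiset ℂ} (hc : A.card = 2*n+2) (hA : Adm op₀ om A) :
    ContinuousAt (fun op => momDet op om (hypH G op om) n A) op₀ := by
  unfold momDet
  refine ContinuousAt.comp (g := Matrix.det)
    (f := fun op => Matrix.of fun i k : Fin n => ∫ x : ℝ, momKer op om 0 0 i k (hypWt (hypH G op om) A) x)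
    (Continuous.matrix_det continuous_id).continuousAt ?_
  refine continuousAt_pi.2 fun i => continuousAt_pi.2 fun k => ?_
  have hb : ExpBound (𝓝 op₀) (fun op x => hypWt (hypH G op om) A x)
      (A.map fun a => -Real.pi * ((op₀+om-a-a)/(op₀*om)).re).sum :=
    ExpBound.multiset_prod A fun a ha => expBound_hypH_left hG hop hom (hA.1 a ha)
  refine tendsto_integral_of_expBound
    (expBound_momKer (op := fun op => op) tendsto_id hop hom 0 0 i k hb)
    (momKer_exponent_neg hop hom hc hA.2 i.2 k.2) ?_ (Eventually.of_forall fun x => ?_)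
  · filter_upwards [Complex.continuous_re.continuousAt.eventually_const_lt hop] with op h1
    exact (continuous_momKer_ofReal _ _
      ((isHypH hG h1 hom).continuous_hypWt hA.1)).aestronglyMeasurable
  · have h0 : op₀ ≠ 0 := ne_zero_of_re_pos' hop
    have hW : ContinuousAt (fun op => hypWt (hypH G op om) A x) op₀ := by
      unfold hypWt
      refine tendsto_multiset_prod (ι := ℂ) A fun a ha => ?_
      exact Tendsto.mul (continuousAt_hypH_left hG hop hom (by simpa using hA.1 a ha))
        (continuousAt_hypH_left hG hop hom (by simpa using hA.1 a ha))
    have hd : ContinuousAt (fun op : ℂ => 2*Real.pi/op*x) op₀ := by fun_prop (disch := assumption)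
    have hC : ContinuousAt (fun op => coshVar op x - 0) op₀ :=
      (ContinuousAt.mul continuousAt_const
        (Complex.continuous_cosh.continuousAt.comp hd)).sub continuousAt_const
    have hS : ContinuousAt (fun op => sinhDens op om x) op₀ :=
      ContinuousAt.mul (ContinuousAt.mul continuousAt_const
        (Complex.continuous_sinh.continuousAt.comp hd)) continuousAt_const
    exact ((hC.pow _).mul continuousAt_const).mul (hS.mul hW)

theorem momDet_mul_sum (hG : IsHypGammaFamily G) {op om : ℂ} (hop : 0 < op.re)
    (hom : 0 < om.re) (hP : (op*om).im ≠ 0) (n : ℕ) (A : Multiset ℂ) (hc : A.card = 2*n+2)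
    (hA : Adm op om A) :
    momDet op om (hypH G op om) n A * hypH G op om A.sum =
      (2*(op*om)^((1:ℂ)/2))^n * pairProd (hypH G op om) A := by
  by_cases hD : (op * starRingEnd ℂ om).im = 0
  swap
  · exact (isHypH hG hop hom).momDet_mul_of_im_ne_zero hP hD n A hc hA
  have hsum : 0 < A.sum.re := by
    obtain ⟨a, ha⟩ := Multiset.card_pos_iff_exists_mem.1 (show 0 < A.card by omega)
    obtain ⟨B, rfl⟩ := Multiset.exists_cons_of_mem ha
    rw [Multiset.sum_cons, Complex.add_re]
    have h1 := hA.1 a ha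
    have h2 := multiset_sum_re_nonneg (A := B) fun b hb => hA.1 b (by simp [hb])
    linarith
  have hop0 := ne_zero_of_re_pos' hop
  have hom0 := ne_zero_of_re_pos' hom
  have h1 : ContinuousAt (fun q => momDet q om (hypH G q om) n A * hypH G q om A.sum) op :=
    (continuousAt_momDet_left hG hop hom hc hA).mul (continuousAt_hypH_left hG hop hom hsum)
  have h2 : ContinuousAt (fun q => (2*(q*om)^((1:ℂ)/2))^n * pairProd (hypH G q om) A) op := by
    refine ContinuousAt.mul (ContinuousAt.pow (continuousAt_const.mul ?_) n) ?_
    · exact ContinuousAt.cpow (by fun_prop) continuousAt_const (mul_mem_slitPlane hop hom)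
    · unfold pairProd
      refine tendsto_multiset_prod (ι := Multiset ℂ) _ fun p hp => ?_
      rw [Multiset.mem_powersetCard] at hp
      refine continuousAt_hypH_left hG hop hom ?_
      obtain ⟨a, b, rfl⟩ := Multiset.card_eq_two.1 hp.2
      have ha := hA.1 a (Multiset.mem_of_le hp.1 (by simp))
      have hb := hA.1 b (Multiset.mem_of_le hp.1 (by simp))
      simpa using add_pos ha hb
  have ht : Tendsto (fun t : ℝ => op + Complex.I*t) (𝓝[>] 0) (𝓝 op) := by
    have : Continuous fun t : ℝ => op + Complex.I*t := by fun_prop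
    simpa using (this.tendsto 0).mono_left (nhdsWithin_le_nhds (s := Ioi (0:ℝ)))
  refine tendsto_nhds_unique (h1.tendsto.comp ht) ((h2.tendsto.comp ht).congr' ?_)
  have e1 : ∀ᶠ q in 𝓝 op, (q*om).im ≠ 0 :=
    (show ContinuousAt (fun q : ℂ => (q*om).im) op by fun_prop).eventually_ne hP
  have e2 : ∀ᶠ q in 𝓝 op, 0 < ((q+om-A.sum)/(q*om)).re := by
    have hm := mul_ne_zero hop0 hom0
    have : ContinuousAt (fun q : ℂ => ((q+om-A.sum)/(q*om)).re) op :=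
      Complex.continuous_re.continuousAt.comp (f := fun q : ℂ => (q+om-A.sum)/(q*om))
        (ContinuousAt.div (by fun_prop) (by fun_prop) hm)
    exact this.eventually_const_lt hA.2
  filter_upwards [ht.eventually e1, ht.eventually e2, eventually_mem_nhdsWithin] with t h3 h4 h5
  have hq : 0 < (op + Complex.I*t).re := by simpa using hop
  refine ((isHypH hG hq hom).momDet_mul_of_im_ne_zero h3 ?_ n A hc ⟨hA.1, h4⟩).symm
  rw [add_mul, Complex.add_im, hD, zero_add]
  have ht0 : (0:ℝ) < t := h5
  have : (Complex.I * t * (starRingEnd ℂ) om).im = t * om.re := by simp [mul_assoc]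
  rw [this]
  positivity

end

section

open Filter Topology

/-- The product `h(t ± i(x+y)) h(t ± i(x-y))`. -/
def pairKer (h : ℂ → ℂ) (t x y : ℂ) : ℂ :=
  h (t - Complex.I*(x+y)) * h (t + Complex.I*(x+y)) *
    (h (t - Complex.I*(x-y)) * h (t + Complex.I*(x-y)))

/-- The product of two Vandermonde determinants in the variables `coshVar`. -/
def vandSq (op om : ℂ) {n : ℕ} (x : Fin n → ℝ) : ℂ :=
  (Matrix.vandermonde fun j => coshVar op (x j)).det *
    (Matrix.vandermonde fun j => coshVar om (x j)).det

/-- The multiset of points `t ± iy_l`. -/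
def pts (t : ℂ) {n : ℕ} (y : Fin n → ℝ) : Multiset ℂ :=
  ∑ l, {t - Complex.I*(y l:ℂ), t + Complex.I*(y l:ℂ)}

/-- The product of `pairKer` over all pairs of distinct indices. -/
def pairProdKer (h : ℂ → ℂ) (t : ℂ) {n : ℕ} (v : Fin n → ℝ) : ℂ :=
  ∏ i, ∏ j ∈ Finset.Ioi i, pairKer h t (v i) (v j)

/-- The integrand of the second type of integral. -/
def koornKer (op om : ℂ) (h : ℂ → ℂ) {n : ℕ} (c : Multiset ℂ) (t : ℂ) (v : Fin n → ℝ) : ℂ :=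
  vandSq op om v * (∏ j, (sinhDens op om (v j) * hypWt h c (v j))) * pairProdKer h t v

/-- The two-block integrand interpolating between two integrals of the second type. -/
def blockKer (op om : ℂ) (h : ℂ → ℂ) {n m : ℕ} (c : Multiset ℂ) (t : ℂ)
    (z : (Fin n → ℝ) × (Fin m → ℝ)) : ℂ :=
  vandSq op om z.1 * (∏ j, (sinhDens op om (z.1 j) * hypWt h c (z.1 j))) *
    (vandSq op om z.2 * ∏ l, sinhDens op om (z.2 l)) * ∏ j, ∏ l, pairKer h (t/2) (z.1 j) (z.2 l)

theorem pairKer_comm (h : ℂ → ℂ) (t x y : ℂ) : pairKer h t x y = pairKer h t y x := by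
  have e1 : t - Complex.I*(x-y) = t + Complex.I*(y-x) := by ring
  have e2 : t + Complex.I*(x-y) = t - Complex.I*(y-x) := by ring
  rw [pairKer, pairKer, add_comm x y, e1, e2, mul_comm (h (t + Complex.I*(y-x)))]

theorem hypWt_add (h : ℂ → ℂ) (A B : Multiset ℂ) (x : ℂ) :
    hypWt h (A+B) x = hypWt h A x * hypWt h B x := by
  simp [hypWt]

theorem hypWt_pts (h : ℂ → ℂ) (t x : ℂ) {n : ℕ} (y : Fin n → ℝ) :
    hypWt h (pts t y) x = ∏ l, pairKer h t x (y l) := by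
  induction n with
  | zero => simp [pts, hypWt]
  | succ n ih =>
    have e : pts t y = {t - Complex.I*(y 0:ℂ), t + Complex.I*(y 0:ℂ)} + pts t (fun l => y l.succ) :=
      Fin.sum_univ_succ _
    rw [e, hypWt_add, ih, Fin.prod_univ_succ]
    congr 1
    simp only [hypWt, pairKer, Multiset.insert_eq_cons, Multiset.map_cons, Multiset.prod_cons,
      Multiset.map_singleton, Multiset.prod_singleton]
    ring_nf

theorem card_pts (t : ℂ) {n : ℕ} (y : Fin n → ℝ) : (pts t y).card = 2*n := by
  simp [pts, mul_comm]

theorem sum_pts (t : ℂ) {n : ℕ} (y : Fin n → ℝ) : (pts t y).sum = n*(2*t) := by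
  induction n with
  | zero => simp [pts]
  | succ n ih =>
    have e : pts t y = {t - Complex.I*(y 0:ℂ), t + Complex.I*(y 0:ℂ)} + pts t (fun l => y l.succ) :=
      Fin.sum_univ_succ _
    rw [e, Multiset.sum_add, ih]
    simp
    ring

theorem re_pos_of_mem_pts {t : ℂ} (ht : 0 < t.re) {n : ℕ} {y : Fin n → ℝ} :
    ∀ a ∈ pts t y, 0 < a.re := by
  intro a ha
  simp only [pts, Multiset.mem_sum, Finset.mem_univ, true_and, Multiset.insert_eq_cons,
    Multiset.mem_cons, Multiset.mem_singleton] at ha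
  obtain ⟨l, rfl | rfl⟩ := ha <;> simpa using ht

theorem pairProd_add (h : ℂ → ℂ) (A B : Multiset ℂ) :
    pairProd h (A+B) = pairProd h A * pairProd h B *
      (A.map fun a => (B.map fun b => h (b+a)).prod).prod := by
  induction A using Multiset.induction_on with
  | empty => simp [pairProd, Multiset.powersetCard_zero_right]
  | cons a A ih =>
    rw [Multiset.cons_add, pairProd_cons, pairProd_cons, ih]
    simp
    ring

theorem pairProd_pts (h : ℂ → ℂ) (t : ℂ) {n : ℕ} (y : Fin n → ℝ) :
    pairProd h (pts (t/2) y) = h t^n * pairProdKer h t y := by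
  induction n with
  | zero => simp [pts, pairProd, Multiset.powersetCard_zero_right, pairProdKer]
  | succ n ih =>
    have e : pts (t/2) y = {t/2 - Complex.I*(y 0:ℂ), t/2 + Complex.I*(y 0:ℂ)} +
        pts (t/2) (fun l => y l.succ) :=
      Fin.sum_univ_succ _
    have e2 : pairProdKer h t y = (∏ l : Fin n, pairKer h t (y 0) (y l.succ)) *
        pairProdKer h t (fun l => y l.succ) := by
      rw [pairProdKer, Fin.prod_univ_succ, Fin.prod_Ioi_zero]
      simp only [Fin.prod_Ioi_succ, pairProdKer]
    rw [e, pairProd_add, ih, e2]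
    have e3 : pairProd h {t/2 - Complex.I*(y 0:ℂ), t/2 + Complex.I*(y 0:ℂ)} = h t := by
      rw [Multiset.insert_eq_cons, pairProd_cons, ← Multiset.cons_zero, pairProd_cons]
      simp [pairProd, Multiset.powersetCard_zero_right]
    have e4 : ∀ (n : ℕ) (y : Fin n → ℝ) (x : ℝ),
        (({t/2 - Complex.I*(x:ℂ), t/2 + Complex.I*(x:ℂ)} : Multiset ℂ).map fun a =>
          ((pts (t/2) y).map fun b => h (b+a)).prod).prod = ∏ l, pairKer h t x (y l) := by
      intro n y x
      induction n with
      | zero => simp [pts]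
      | succ n ih =>
        have e : pts (t/2) y = {t/2 - Complex.I*(y 0:ℂ), t/2 + Complex.I*(y 0:ℂ)} +
            pts (t/2) (fun l => y l.succ) := Fin.sum_univ_succ _
        rw [Fin.prod_univ_succ, ← ih (fun l => y l.succ), e]
        simp only [pairKer, Multiset.insert_eq_cons, Multiset.map_cons, Multiset.prod_cons,
          Multiset.map_singleton, Multiset.prod_singleton, Multiset.map_add, Multiset.prod_add]
        ring_nf
    rw [e3, e4]
    ring

theorem norm_coshVar_le {q : ℂ} (hq : 0 < q.re) (x : ℝ) :
    ‖coshVar q x‖ ≤ 2 * Real.exp (2*Real.pi*(1/q).re * |x|) := by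
  have h1 := norm_cosh_le (2*Real.pi/q*x)
  rw [coshVar, norm_mul, Complex.norm_ofNat]
  have h2 : |(2*Real.pi/q*x : ℂ).re| = 2*Real.pi*(1/q).re * |x| := by
    rw [Complex.re_mul_ofReal, abs_mul, abs_two_pi_div_re hq]
  rw [h2] at h1
  linarith

theorem norm_det_vandermonde_le {q : ℂ} (hq : 0 < q.re) {n : ℕ} (x : Fin n → ℝ) :
    ‖(Matrix.vandermonde fun j => coshVar q (x j)).det‖ ≤
      ∑ σ : Equiv.Perm (Fin n), 2^(n*n) *
        Real.exp (2*Real.pi*(1/q).re * ∑ i : Fin n, (i:ℝ) * |x (σ i)|) := by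
  rw [Matrix.det_apply']
  refine (norm_sum_le _ _).trans (Finset.sum_le_sum fun σ _ => ?_)
  rw [norm_mul]
  have h1 : ‖((Equiv.Perm.sign σ : ℤ):ℂ)‖ = 1 := by
    rcases Int.units_eq_one_or (Equiv.Perm.sign σ) with h | h <;> simp [h]
  rw [h1, one_mul, norm_prod, Finset.mul_sum, Real.exp_sum]
  have h2 : (2:ℝ)^(n*n) = ∏ i : Fin n, 2^n := by simp [pow_mul]
  rw [h2, ← Finset.prod_mul_distrib]
  refine Finset.prod_le_prod (fun i _ => norm_nonneg _) fun i _ => ?_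
  rw [Matrix.vandermonde_apply, norm_pow]
  calc ‖coshVar q (x (σ i))‖^(i:ℕ) ≤ (2 * Real.exp (2*Real.pi*(1/q).re * |x (σ i)|))^(i:ℕ) := by
        gcongr; exact norm_coshVar_le hq _
    _ = 2^(i:ℕ) * Real.exp (2*Real.pi*(1/q).re * ((i:ℕ) * |x (σ i)|)) := by
        rw [mul_pow, ← Real.exp_nat_mul]; congr 2; ring
    _ ≤ _ := by
        gcongr
        · norm_num
        · exact i.2.le

theorem sum_mul_add_sum_mul_le_sum_max {n : ℕ} (x : Fin (n+1) → ℝ) (y : Fin n → ℝ) :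
    ∑ i : Fin (n+1), (i:ℝ) * x i + ∑ l : Fin n, ((l:ℝ)+1) * y l ≤ ∑ i, ∑ l, max (x i) (y l) := by
  have h1 : ∑ i : Fin (n+1), (i:ℝ) * x i =
      ∑ i : Fin (n+1), ∑ l : Fin n, if (l:ℕ) < i then x i else 0 := by
    refine Finset.sum_congr rfl fun i _ => ?_
    rw [← Finset.sum_filter, Finset.sum_const, nsmul_eq_mul]
    congr
    have := Fin.card_filter_val_lt (n := n) (m := i)
    rw [this]
    omega
  have h2 : ∑ l : Fin n, ((l:ℝ)+1) * y l =
      ∑ i : Fin (n+1), ∑ l : Fin n, if (l:ℕ) < i then 0 else y l := by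
    rw [Finset.sum_comm]
    refine Finset.sum_congr rfl fun l _ => ?_
    have e : ∀ i : Fin (n+1), (if (l:ℕ) < i then 0 else y l) = if (i:ℕ) < l+1 then y l else 0 := by
      intro i
      split_ifs <;> first | rfl | omega
    simp only [e]
    rw [← Finset.sum_filter, Finset.sum_const, nsmul_eq_mul]
    have := Fin.card_filter_val_lt (n := n+1) (m := l+1)
    rw [this]
    congr
    rw [min_eq_right (by omega)]
    push_cast
    rfl
  rw [h1, h2, ← Finset.sum_add_distrib]
  refine Finset.sum_le_sum fun i _ => ?_
  rw [← Finset.sum_add_distrib]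
  refine Finset.sum_le_sum fun l _ => ?_
  split_ifs <;> simp

theorem norm_vandermonde_mul_le {q : ℂ} (hq : 0 < q.re) {n : ℕ} : ∃ C : ℝ, 0 ≤ C ∧
    ∀ (x : Fin (n+1) → ℝ) (y : Fin n → ℝ),
      ‖(Matrix.vandermonde fun j => coshVar q (x j)).det‖ *
        ‖(Matrix.vandermonde fun j => coshVar q (y j)).det‖ ≤
      C * Real.exp (2*Real.pi*(1/q).re * (∑ i, ∑ l, max |x i| |y l| - ∑ l, |y l|)) := by
  refine ⟨∑ _σ : Equiv.Perm (Fin (n+1)), ∑ _τ : Equiv.Perm (Fin n), 2^((n+1)*(n+1))*2^(n*n),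
    by positivity, fun x y => ?_⟩
  have ha := re_inv_pos hq
  refine (mul_le_mul (norm_det_vandermonde_le hq x) (norm_det_vandermonde_le hq y)
    (norm_nonneg _) (by positivity)).trans ?_
  rw [Finset.sum_mul_sum, Finset.sum_mul]
  refine Finset.sum_le_sum fun σ _ => ?_
  rw [Finset.sum_mul]
  refine Finset.sum_le_sum fun τ _ => ?_
  rw [mul_mul_mul_comm, ← Real.exp_add, ← mul_add]
  gcongr
  have h1 := sum_mul_add_sum_mul_le_sum_max (fun i => |x (σ i)|) (fun l => |y (τ l)|)
  have h2 : ∑ i, ∑ l, max |x (σ i)| |y (τ l)| = ∑ i, ∑ l, max |x i| |y l| := by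
    rw [Equiv.sum_comp σ (fun i => ∑ l, max |x i| |y (τ l)|)]
    exact Finset.sum_congr rfl fun i _ => Equiv.sum_comp τ (fun l => max |x i| |y l|)
  have h3 : ∑ l, |y (τ l)| = ∑ l, |y l| := Equiv.sum_comp τ (fun l => |y l|)
  rw [h2] at h1
  simp only [add_mul, one_mul, Finset.sum_add_distrib, h3] at h1
  linarith

end

section

open Filter Topology

theorem ExpBound.exists_bound {f : ℝ → ℂ} {c : ℝ} (hf : ExpBound (pure ()) (fun _ => f) c)
    {d : ℝ} (h : c < d) : ∃ C : ℝ, 0 ≤ C ∧ ∀ x, ‖f x‖ ≤ C * Real.exp (d * |x|) := by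
  obtain ⟨C, h0, hC⟩ := hf.exists_pos (sub_pos.2 h)
  refine ⟨C, h0.le, fun x => ?_⟩
  have : ∀ x, ‖f x‖ ≤ C * Real.exp ((c + (d-c)) * |x|) := by simpa using hC
  simpa using this x

theorem abs_add_add_abs_sub (x y : ℝ) : |x+y| + |x-y| = 2 * max |x| |y| := by
  rcases le_total |x| |y| with h | h
  · rw [max_eq_right h]
    rcases le_total 0 y with hy | hy
    · rw [abs_of_nonneg hy] at *
      obtain ⟨h1, h2⟩ := abs_le.1 h
      rw [abs_of_nonneg (by linarith), abs_of_nonpos (by linarith)]; ring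
    · rw [abs_of_nonpos hy] at *
      obtain ⟨h1, h2⟩ := abs_le.1 h
      rw [abs_of_nonpos (by linarith), abs_of_nonneg (by linarith)]; ring
  · rw [max_eq_left h]
    rcases le_total 0 x with hy | hy
    · rw [abs_of_nonneg hy] at *
      obtain ⟨h1, h2⟩ := abs_le.1 h
      rw [abs_of_nonneg (by linarith), abs_of_nonneg (by linarith)]; ring
    · rw [abs_of_nonpos hy] at *
      obtain ⟨h1, h2⟩ := abs_le.1 h
      rw [abs_of_nonpos (by linarith), abs_of_nonpos (by linarith)]; ring

theorem prod_le_pow_mul_exp {ι : Type*} [Fintype ι] {f : ι → ℝ} {C r : ℝ} {g : ι → ℝ}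
    (h0 : ∀ i, 0 ≤ f i) (h : ∀ i, f i ≤ C * Real.exp (r * g i)) :
    ∏ i, f i ≤ C^(Fintype.card ι) * Real.exp (r * ∑ i, g i) := by
  refine (Finset.prod_le_prod (fun i _ => h0 i) fun i _ => h i).trans (le_of_eq ?_)
  rw [Finset.prod_mul_distrib, Finset.prod_const, ← Real.exp_sum, Finset.mul_sum,
    Finset.card_univ]

theorem integrable_exp_neg_mul_sum_abs {r : ℝ} (hr : r < 0) (n : ℕ) :
    Integrable fun x : Fin n → ℝ => Real.exp (r * ∑ j, |x j|) := by
  have := Integrable.fintype_prod (f := fun (_ : Fin n) (x : ℝ) => Real.exp (r * |x|))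
    (μ := fun _ => volume) fun _ => integrable_exp_neg_mul_abs hr
  refine this.congr (Eventually.of_forall fun x => ?_)
  simp only [Finset.mul_sum, Real.exp_sum]

theorem mul_le_exp_of_le {a b K Λ M X Y C₁ C₂ C₃ C₄ C₅ u u' v v' w₃ w₄ w₅ : ℝ}
    (pu : 0 ≤ u) (pu' : 0 ≤ u') (pv : 0 ≤ v) (pv' : 0 ≤ v') (p3 : 0 ≤ w₃) (p4 : 0 ≤ w₄)
    (p5 : 0 ≤ w₅) (h3 : 0 ≤ C₃) (h4 : 0 ≤ C₄) (h5 : 0 ≤ C₅) (h1 : 0 ≤ C₁) (h2 : 0 ≤ C₂)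
    (hK : 0 < K) (hMY : Y ≤ M)
    (b1 : u * u' ≤ C₁ * Real.exp (a*(M-Y))) (b2 : v * v' ≤ C₂ * Real.exp (b*(M-Y)))
    (b3 : w₃ ≤ C₃ * Real.exp (-Λ/2 * X)) (b4 : w₄ ≤ C₄ * Real.exp ((a+b+K/4) * Y))
    (b5 : w₅ ≤ C₅ * Real.exp (2*(-(a+b)/2-K/4) * M)) :
    (u*u')*(v*v')*w₃*w₄*w₅ ≤ C₁*C₂*C₃*C₄*C₅ * (Real.exp (-Λ/2*X) * Real.exp (-K/4*Y)) := by
  calc _ ≤ (C₁ * Real.exp (a*(M-Y))) * (C₂ * Real.exp (b*(M-Y))) *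
        (C₃ * Real.exp (-Λ/2 * X)) * (C₄ * Real.exp ((a+b+K/4) * Y)) *
        (C₅ * Real.exp (2*(-(a+b)/2-K/4) * M)) := by
        have q1 := mul_nonneg pu pu'
        have q2 := mul_nonneg pv pv'
        generalize u * u' = U at *
        generalize v * v' = V at *
        gcongr
    _ = C₁*C₂*C₃*C₄*C₅ * Real.exp (-Λ/2*X + K/4*Y - K/2*M) := by
        have : Real.exp (-Λ/2*X + K/4*Y - K/2*M) = Real.exp (a*(M-Y)) * Real.exp (b*(M-Y)) *
            Real.exp (-Λ/2 * X) * Real.exp ((a+b+K/4) * Y) *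
            Real.exp (2*(-(a+b)/2-K/4) * M) := by
          simp only [← Real.exp_add]
          congr 1; ring
        rw [this]; ring
    _ ≤ _ := by
        rw [← Real.exp_add]
        gcongr
        nlinarith

namespace HypH

variable {op om : ℂ} {h : ℂ → ℂ}

theorem continuous_pair (H : HypH op om h) {a : ℂ} (ha : 0 < a.re) :
    Continuous fun x : ℝ => h (a - Complex.I*x) * h (a + Complex.I*x) := by
  have := H.continuous_hypWt (A := {a}) (by simpa using ha)
  simpa [hypWt] using this

theorem continuous_pairKer (H : HypH op om h) {t : ℂ} (ht : 0 < t.re) :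
    Continuous fun p : ℝ × ℝ => pairKer h t p.1 p.2 := by
  have h1 := (H.continuous_pair ht).comp (continuous_fst.add continuous_snd)
  have h2 := (H.continuous_pair ht).comp (continuous_fst.sub continuous_snd)
  refine (h1.mul h2).congr fun p => ?_
  simp [pairKer]

theorem continuous_sinhDens : Continuous fun x : ℝ => sinhDens op om x := by
  unfold sinhDens
  fun_prop

theorem continuous_vandSq {n : ℕ} : Continuous fun x : Fin n → ℝ => vandSq op om x := by
  have key : ∀ q : ℂ, Continuous fun x : Fin n → ℝ =>
      (Matrix.vandermonde fun j => coshVar q (x j)).det := by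
    intro q
    refine Continuous.matrix_det (continuous_pi fun i => continuous_pi fun j => ?_)
    simp only [Matrix.vandermonde_apply, coshVar]
    fun_prop
  exact (key op).mul (key om)

theorem continuous_blockKer (H : HypH op om h) {c : Multiset ℂ} (hc : ∀ a ∈ c, 0 < a.re)
    {t : ℂ} (ht : 0 < t.re) {n m : ℕ} :
    Continuous fun z : (Fin n → ℝ) × (Fin m → ℝ) => blockKer op om h c t z := by
  have hS := continuous_sinhDens (op := op) (om := om)
  have hW := H.continuous_hypWt hc
  have hP := H.continuous_pairKer (t := t/2) (by simpa using ht)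
  have e1 : ∀ j : Fin n, Continuous fun z : (Fin n → ℝ) × (Fin m → ℝ) => z.1 j := fun j => by fun_prop
  have e2 : ∀ l : Fin m, Continuous fun z : (Fin n → ℝ) × (Fin m → ℝ) => z.2 l := fun l => by fun_prop
  unfold blockKer
  refine Continuous.mul (Continuous.mul (Continuous.mul (continuous_vandSq.comp continuous_fst) ?_)
    (Continuous.mul (continuous_vandSq.comp continuous_snd) ?_)) ?_
  · exact continuous_finsetProd _ fun j _ => (hS.comp (e1 j)).mul (hW.comp (e1 j))
  · exact continuous_finsetProd _ fun l _ => hS.comp (e2 l)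
  · exact continuous_finsetProd _ fun j _ => continuous_finsetProd _ fun l _ =>
      Continuous.comp (g := fun p : ℝ × ℝ => pairKer h (t/2) p.1 p.2)
        (f := fun z : (Fin n → ℝ) × (Fin m → ℝ) => (z.1 j, z.2 l)) hP ((e1 j).prodMk (e2 l))

theorem norm_pairKer_le (H : HypH op om h) {t : ℂ} (ht : 0 < t.re) {r : ℝ}
    (hr : -Real.pi * ((op+om-t-t)/(op*om)).re < r) : ∃ C : ℝ, 0 ≤ C ∧
    ∀ x y : ℝ, ‖pairKer h t x y‖ ≤ C * Real.exp (2*r * max |x| |y|) := by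
  obtain ⟨C, h0, hC⟩ := (H.expBound (l := pure ()) (tendsto_const_nhds (x := t))
    (tendsto_const_nhds (x := t)) ht ht).exists_bound hr
  refine ⟨C*C, by positivity, fun x y => ?_⟩
  have h1 := hC (x+y)
  have h2 := hC (x-y)
  push_cast at h1 h2
  rw [pairKer, norm_mul]
  refine (mul_le_mul h1 h2 (norm_nonneg _) (by positivity)).trans (le_of_eq ?_)
  have : 2*r * max |x| |y| = r * |x+y| + r * |x-y| := by
    rw [← mul_add, abs_add_add_abs_sub]; ring
  rw [this, Real.exp_add]
  ring

set_option maxHeartbeats 400000 in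
theorem integrable_blockKer (H : HypH op om h) {c : Multiset ℂ} (hA : Adm op om c)
    (hc : c.card = 4) {t : ℂ} (ht : 0 < t.re) (htP : (t/(op*om)).re < 0) {n : ℕ} :
    Integrable fun z : (Fin (n+1) → ℝ) × (Fin n → ℝ) => blockKer op om h c t z := by
  set a := 2*Real.pi*(1/op).re with ha
  set b := 2*Real.pi*(1/om).re with hb
  set K := -2*Real.pi*(t/(op*om)).re with hK
  set Λ := 2*Real.pi*((op+om-c.sum)/(op*om)).re with hΛ
  have hK0 : 0 < K := by
    rw [hK]; nlinarith [Real.pi_pos]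
  have hΛ0 : 0 < Λ := by
    have := hA.2
    positivity
  have hsplit := re_add_div_mul H.pop H.pom
  obtain ⟨C₁, h10, h1⟩ := norm_vandermonde_mul_le H.pop (n := n)
  obtain ⟨C₂, h20, h2⟩ := norm_vandermonde_mul_le H.pom (n := n)
  have hS : ExpBound (pure ()) (fun _ x => sinhDens op om x) (a+b) :=
    (expBound_sinhDens (l := pure ()) (tendsto_const_nhds (x := op)) H.pop H.pom).mono
      (le_of_eq (by rw [ha, hb]; ring))
  obtain ⟨C₃, h30, h3⟩ := (hS.mul (H.expBound_hypWt (pure ()) hA.1)).exists_bound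
    (d := -Λ/2) (by
      rw [sum_exponent H.pop H.pom, hc]
      have : Λ = a + b - 2*Real.pi*(c.sum/(op*om)).re := by
        rw [hΛ, sub_div, Complex.sub_re, hsplit]; ring
      push_cast
      have e : a + b = 2*Real.pi*((1/op).re + (1/om).re) := by rw [ha, hb]; ring
      nlinarith)
  obtain ⟨C₄, h40, h4⟩ := hS.exists_bound (d := a+b+K/4) (by linarith)
  obtain ⟨C₅, h50, h5⟩ := H.norm_pairKer_le (t := t/2) (by simpa using ht)
    (r := -(a+b)/2-K/4) (by
      have : op+om-t/2-t/2 = (op+om) - t := by ring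
      rw [this, sub_div, Complex.sub_re, hsplit]
      have e : a + b = 2*Real.pi*((1/op).re + (1/om).re) := by rw [ha, hb]; ring
      nlinarith)
  have hint := ((integrable_exp_neg_mul_sum_abs (r := -Λ/2) (by linarith) (n+1)).mul_prod
    (integrable_exp_neg_mul_sum_abs (r := -K/4) (by linarith) n)).const_mul
      (C₁*C₂*C₃^(n+1)*C₄^n*(C₅^n)^(n+1))
  refine hint.mono' (H.continuous_blockKer hA.1 ht).aestronglyMeasurable
    (Eventually.of_forall fun z => ?_)
  obtain ⟨x, y⟩ := z
  set M := ∑ i, ∑ l, max |x i| |y l| with hM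
  set X := ∑ j, |x j| with hX
  set Y := ∑ l, |y l| with hY
  have hMY : Y ≤ M := by
    refine le_trans ?_ (Finset.single_le_sum (f := fun i => ∑ l, max |x i| |y l|)
      (fun i _ => Finset.sum_nonneg fun l _ => by positivity) (Finset.mem_univ 0))
    exact Finset.sum_le_sum fun l _ => le_max_right _ _
  have b1 := h1 x y
  have b2 := h2 x y
  have b3 : ∏ j, ‖sinhDens op om (x j) * hypWt h c (x j)‖ ≤ C₃^(n+1) * Real.exp (-Λ/2 * X) := by
    simpa using prod_le_pow_mul_exp (fun j => norm_nonneg _) (fun j => h3 (x j))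
  have b4 : ∏ l, ‖sinhDens op om (y l)‖ ≤ C₄^n * Real.exp ((a+b+K/4) * Y) := by
    simpa using prod_le_pow_mul_exp (fun l => norm_nonneg _) (fun l => h4 (y l))
  have b5 : ∏ j, ∏ l, ‖pairKer h (t/2) (x j) (y l)‖ ≤
      (C₅^n)^(n+1) * Real.exp (2*(-(a+b)/2-K/4) * M) := by
    have := prod_le_pow_mul_exp (r := 2*(-(a+b)/2-K/4)) (C := C₅^n)
      (f := fun j => ∏ l, ‖pairKer h (t/2) (x j) (y l)‖) (g := fun j => ∑ l, max |x j| |y l|)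
      (fun j => Finset.prod_nonneg fun l _ => norm_nonneg _) (fun j => by
        simpa using prod_le_pow_mul_exp (fun l => norm_nonneg _) (fun l => h5 (x j) (y l)))
    simpa using this
  have e : ‖blockKer op om h c t (x, y)‖ =
      (‖(Matrix.vandermonde fun j => coshVar op (x j)).det‖ *
        ‖(Matrix.vandermonde fun j => coshVar op (y j)).det‖) *
      (‖(Matrix.vandermonde fun j => coshVar om (x j)).det‖ *
        ‖(Matrix.vandermonde fun j => coshVar om (y j)).det‖) *
      (∏ j, ‖sinhDens op om (x j) * hypWt h c (x j)‖) * (∏ l, ‖sinhDens op om (y l)‖) *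
      ∏ j, ∏ l, ‖pairKer h (t/2) (x j) (y l)‖ := by
    simp only [blockKer, vandSq, norm_mul, norm_prod]
    ring
  rw [e]
  exact mul_le_exp_of_le (norm_nonneg _) (norm_nonneg _) (norm_nonneg _) (norm_nonneg _)
    (Finset.prod_nonneg fun _ _ => norm_nonneg _) (Finset.prod_nonneg fun _ _ => norm_nonneg _)
    (Finset.prod_nonneg fun _ _ => Finset.prod_nonneg fun _ _ => norm_nonneg _)
    (pow_nonneg h30 _) (pow_nonneg h40 _) (pow_nonneg (pow_nonneg h50 _) _) h10 h20 hK0 hMY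
    b1 b2 b3 b4 b5

end HypH

end

section

open Filter Topology

theorem prod_map_prod_pts (h : ℂ → ℂ) (c : Multiset ℂ) (t : ℂ) {n : ℕ} (y : Fin n → ℝ) :
    (c.map fun a => ((pts t y).map fun b => h (b+a)).prod).prod =
      ∏ l, hypWt h (c.map fun a => a + t) (y l) := by
  have key : ∀ a : ℂ, ((pts t y).map fun b => h (b+a)).prod =
      ∏ l, h (a + t - Complex.I*(y l:ℂ)) * h (a + t + Complex.I*(y l:ℂ)) := by
    intro a
    rw [pts, ← Multiset.coe_mapAddMonoidHom, map_sum, Multiset.prod_sum]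
    simp only [Multiset.coe_mapAddMonoidHom]
    refine Finset.prod_congr rfl fun l _ => ?_
    simp only [Multiset.insert_eq_cons, Multiset.map_cons, Multiset.map_singleton,
      Multiset.prod_cons, Multiset.prod_singleton]
    congr 2 <;> ring
  simp only [key, hypWt, Multiset.map_map, Function.comp_def]
  exact Multiset.prod_map_prod_map c Finset.univ.val

theorem sum_map_add_const (c : Multiset ℂ) (t : ℂ) :
    (c.map fun a => a + t).sum = c.sum + c.card * t := by
  simp [Multiset.sum_map_add]

/-- The evaluation of all moment determinants. -/
def EvalMomDet (op om : ℂ) (h : ℂ → ℂ) : Prop :=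
  ∀ (n : ℕ) (A : Multiset ℂ), A.card = 2*n+2 → Adm op om A →
    momDet op om h n A * h A.sum = (2*(op*om)^((1:ℂ)/2))^n * pairProd h A

theorem multiset_sum_re_pos {A : Multiset ℂ} (hA : ∀ a ∈ A, 0 < a.re) (h0 : A ≠ 0) :
    0 < A.sum.re := by
  obtain ⟨a, B, rfl⟩ : ∃ a B, A = a ::ₘ B := by
    obtain ⟨a, ha⟩ := Multiset.exists_mem_of_ne_zero h0
    exact ⟨a, Multiset.exists_cons_of_mem ha⟩
  rw [Multiset.sum_cons, Complex.add_re]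
  have := multiset_sum_re_nonneg (A := B) fun b hb => hA b (by simp [hb])
  have := hA a (by simp)
  linarith

namespace HypH

variable {op om : ℂ} {h : ℂ → ℂ}

theorem integral_vandSq (H : HypH op om h) (hM : EvalMomDet op om h) {n : ℕ} {A : Multiset ℂ}
    (hA : Adm op om A) (hc : A.card = 2*n+2) :
    ∫ x : Fin n → ℝ, vandSq op om x * ∏ j, (sinhDens op om (x j) * hypWt h A (x j)) =
      n.factorial * (2*(op*om)^((1:ℂ)/2))^n * pairProd h A / h A.sum := by
  have h0 : h A.sum ≠ 0 := H.ne_zero_of_re (multiset_sum_re_pos hA.1 (by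
    rintro rfl; simp at hc)) hA.2
  rw [eq_div_iff h0, mul_assoc (n.factorial : ℂ), ← hM n A hc hA, ← mul_assoc]
  congr 1
  exact (H.andreief hA hc 0 0).2

theorem pairProd_add_pts (h : ℂ → ℂ) (c : Multiset ℂ) (t : ℂ) {m : ℕ} (y : Fin m → ℝ) :
    pairProd h (c + pts (t/2) y) = pairProd h c * h t^m *
      (pairProdKer h t y * ∏ l, hypWt h (c.map fun a => a + t/2) (y l)) := by
  rw [pairProd_add, pairProd_pts, prod_map_prod_pts]
  ring

theorem _root_.Adm.add_pts {c : Multiset ℂ} (hA : Adm op om c) {t : ℂ} (ht : 0 < t.re)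
    (htP : (t/(op*om)).re < 0) {m : ℕ} (y : Fin m → ℝ) : Adm op om (c + pts (t/2) y) := by
  refine ⟨fun a ha => ?_, ?_⟩
  · rcases Multiset.mem_add.1 ha with h1 | h1
    · exact hA.1 a h1
    · exact re_pos_of_mem_pts (by simpa using ht) a h1
  · rw [Multiset.sum_add, sum_pts]
    have e : (op+om-(c.sum + m*(2*(t/2))))/(op*om) = (op+om-c.sum)/(op*om) - (m:ℝ)*(t/(op*om)) := by
      push_cast; ring
    rw [e, Complex.sub_re, Complex.re_ofReal_mul]
    have : (m:ℝ)*(t/(op*om)).re ≤ 0 := mul_nonpos_of_nonneg_of_nonpos (by positivity) htP.le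
    linarith [hA.2]

theorem adm_zero (H : HypH op om h) : Adm op om 0 := by
  refine ⟨by simp, ?_⟩
  rw [Multiset.sum_zero, sub_zero, re_add_div_mul H.pop H.pom]
  exact add_pos (re_inv_pos H.pop) (re_inv_pos H.pom)

theorem _root_.Adm.map_add {c : Multiset ℂ} (hA : Adm op om c) {t : ℂ} (ht : 0 < t.re)
    (htP : (t/(op*om)).re < 0) : Adm op om (c.map fun a => a + t) := by
  refine ⟨fun a ha => ?_, ?_⟩
  · obtain ⟨b, hb, rfl⟩ := Multiset.mem_map.1 ha
    simpa using add_pos (hA.1 b hb) ht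
  · rw [sum_map_add_const]
    have e : (op+om-(c.sum + c.card*t))/(op*om) =
        (op+om-c.sum)/(op*om) - (c.card:ℝ)*(t/(op*om)) := by
      push_cast; ring
    rw [e, Complex.sub_re, Complex.re_ofReal_mul]
    have : (c.card:ℝ)*(t/(op*om)).re ≤ 0 := mul_nonpos_of_nonneg_of_nonpos (by positivity) htP.le
    linarith [hA.2]

theorem integral_blockKer_left (H : HypH op om h) (hM : EvalMomDet op om h) {c : Multiset ℂ}
    (hA : Adm op om c) (hc : c.card = 4) {t : ℂ} (ht : 0 < t.re) (htP : (t/(op*om)).re < 0) {m : ℕ}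
    (y : Fin m → ℝ) :
    ∫ x : Fin (m+1) → ℝ, blockKer op om h c t (x, y) =
      (m+1).factorial * (2*(op*om)^((1:ℂ)/2))^(m+1) * (pairProd h c * h t^m) / h (c.sum + m*t) *
        koornKer op om h (c.map fun a => a + t/2) t y := by
  have e : ∀ x : Fin (m+1) → ℝ, blockKer op om h c t (x, y) =
      (vandSq op om y * ∏ l, sinhDens op om (y l)) * (vandSq op om x *
        ∏ j, (sinhDens op om (x j) * hypWt h (c + pts (t/2) y) (x j))) := by
    intro x
    simp only [blockKer, hypWt_add, hypWt_pts, Finset.prod_mul_distrib]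
    ring
  have hcard : (c + pts (t/2) y).card = 2*(m+1)+2 := by
    rw [Multiset.card_add, card_pts, hc]; ring
  have hs : (c + pts (t/2) y).sum = c.sum + m*t := by
    rw [Multiset.sum_add, sum_pts]; ring
  simp only [e]
  rw [integral_const_mul, H.integral_vandSq hM (hA.add_pts ht htP y) hcard, hs,
    pairProd_add_pts, koornKer, Finset.prod_mul_distrib]
  ring

theorem integral_blockKer_right (H : HypH op om h) (hM : EvalMomDet op om h) {c : Multiset ℂ}
    {t : ℂ} (ht : 0 < t.re) (htP : (t/(op*om)).re < 0) {m : ℕ} (x : Fin (m+1) → ℝ) :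
    ∫ y : Fin m → ℝ, blockKer op om h c t (x, y) =
      m.factorial * (2*(op*om)^((1:ℂ)/2))^m * h t^(m+1) / h ((m+1)*t) *
        koornKer op om h c t x := by
  have e : ∀ y : Fin m → ℝ, blockKer op om h c t (x, y) =
      (vandSq op om x * ∏ j, (sinhDens op om (x j) * hypWt h c (x j))) * (vandSq op om y *
        ∏ l, (sinhDens op om (y l) * hypWt h (pts (t/2) x) (y l))) := by
    intro y
    simp only [blockKer, hypWt_pts, Finset.prod_mul_distrib]
    rw [Finset.prod_comm]
    simp only [pairKer_comm h (t/2) (y _)]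
    ring
  have hcard : (pts (t/2) x).card = 2*m+2 := by rw [card_pts]; ring
  have hs : (pts (t/2) x).sum = (m+1)*t := by rw [sum_pts]; push_cast; ring
  have hadm : Adm op om (pts (t/2) x) := by simpa using H.adm_zero.add_pts ht htP x
  simp only [e]
  rw [integral_const_mul, H.integral_vandSq hM hadm hcard, hs, pairProd_pts, koornKer]
  ring

theorem ne_zero_nat_mul (H : HypH op om h) {c : Multiset ℂ} (hA : Adm op om c) {t : ℂ}
    (ht : 0 < t.re) (htP : (t/(op*om)).re < 0) {m : ℕ} (h0 : c ≠ 0 ∨ m ≠ 0) :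
    h (c.sum + m*t) ≠ 0 := by
  refine H.ne_zero_of_re ?_ ?_
  · have h1 := multiset_sum_re_nonneg (A := c) hA.1
    have e : (c.sum + m*t).re = c.sum.re + m*t.re := by
      rw [Complex.add_re, ← Complex.ofReal_natCast, Complex.re_ofReal_mul]
    rw [e]
    rcases h0 with h0 | h0
    · have := multiset_sum_re_pos hA.1 h0
      positivity
    · have : (0:ℝ) < m := by exact_mod_cast Nat.pos_of_ne_zero h0
      positivity
  · have e : (op+om-(c.sum + m*t))/(op*om) = (op+om-c.sum)/(op*om) - (m:ℝ)*(t/(op*om)) := by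
      push_cast; ring
    rw [e, Complex.sub_re, Complex.re_ofReal_mul]
    have : (m:ℝ)*(t/(op*om)).re ≤ 0 := mul_nonpos_of_nonneg_of_nonpos (by positivity) htP.le
    linarith [hA.2]

theorem integral_koornKer_succ (H : HypH op om h) (hM : EvalMomDet op om h) {c : Multiset ℂ}
    (hA : Adm op om c) (hc : c.card = 4) {t : ℂ} (ht : 0 < t.re) (htP : (t/(op*om)).re < 0)
    (m : ℕ) :
    Integrable (fun x : Fin (m+1) → ℝ => koornKer op om h c t x) ∧
      ∫ x : Fin (m+1) → ℝ, koornKer op om h c t x =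
        2*(op*om)^((1:ℂ)/2) * (m+1) * h ((m+1)*t) / (h t * h (c.sum + m*t)) * pairProd h c *
          ∫ y : Fin m → ℝ, koornKer op om h (c.map fun a => a + t/2) t y := by
  have hint := H.integrable_blockKer hA hc ht htP (n := m)
  have n1 : h t ≠ 0 := by
    simpa using H.ne_zero_nat_mul H.adm_zero ht htP (m := 1) (Or.inr one_ne_zero)
  have n2 : h ((m+1)*t) ≠ 0 := by
    simpa using H.ne_zero_nat_mul H.adm_zero ht htP (m := m+1) (Or.inr m.succ_ne_zero)
  have n3 : h (c.sum + m*t) ≠ 0 := H.ne_zero_nat_mul hA ht htP (Or.inl (by rintro rfl; simp at hc))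
  have hs : (op*om)^((1:ℂ)/2) ≠ 0 := by
    intro h0
    have := cpow_half_sq (op*om)
    rw [h0] at this
    exact mul_ne_zero (ne_zero_of_re_pos' H.pop) (ne_zero_of_re_pos' H.pom) (by simpa using this.symm)
  have hf : ((m.factorial : ℕ) : ℂ) ≠ 0 := by exact_mod_cast m.factorial_ne_zero
  have hK : (m.factorial : ℂ) * (2*(op*om)^((1:ℂ)/2))^m * h t^(m+1) / h ((m+1)*t) ≠ 0 :=
    div_ne_zero (mul_ne_zero (mul_ne_zero hf (pow_ne_zero _ (mul_ne_zero two_ne_zero hs)))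
      (pow_ne_zero _ n1)) n2
  have hR : ∀ x : Fin (m+1) → ℝ, ∫ y : Fin m → ℝ, blockKer op om h c t (x, y) = _ :=
    H.integral_blockKer_right hM ht htP
  have hL : ∀ y : Fin m → ℝ, ∫ x : Fin (m+1) → ℝ, blockKer op om h c t (x, y) = _ :=
    H.integral_blockKer_left hM hA hc ht htP
  have i1 := integral_prod _ hint
  have i2 := integral_prod_symm _ hint
  have i3 : Integrable fun x : Fin (m+1) → ℝ => ∫ y : Fin m → ℝ, blockKer op om h c t (x, y) :=
    hint.integral_prod_left
  simp only [hR, hL, integral_const_mul] at i1 i2 i3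
  refine ⟨?_, ?_⟩
  · have := i3.const_mul ((m.factorial : ℂ) * (2*(op*om)^((1:ℂ)/2))^m * h t^(m+1) / h ((m+1)*t))⁻¹
    refine this.congr (Eventually.of_forall fun x => ?_)
    simp only []
    rw [← mul_assoc, inv_mul_cancel₀ hK, one_mul]
  · rw [i1] at i2
    refine mul_left_cancel₀ hK (i2.trans ?_)
    generalize ∫ y : Fin m → ℝ, koornKer op om h (c.map fun a => a + t/2) t y = J
    generalize (op*om)^((1:ℂ)/2) = s
    rw [Nat.factorial_succ]
    push_cast
    field_simp
    ring

theorem integral_koornKer (H : HypH op om h) (hM : EvalMomDet op om h) {t : ℂ} (ht : 0 < t.re)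
    (htP : (t/(op*om)).re < 0) (n : ℕ) {c : Multiset ℂ} (hA : Adm op om c) (hc : c.card = 4) :
    ∫ x : Fin n → ℝ, koornKer op om h c t x =
      2^n * (n.factorial : ℂ) * ((op*om)^((1:ℂ)/2))^n * ∏ j ∈ Finset.range n,
        (h (((n-j:ℕ):ℂ)*t) / (h t * h (c.sum + ((n+j-1:ℕ):ℂ)*t)) *
          pairProd h (c.map fun a => a + j*(t/2))) := by
  induction n generalizing c with
  | zero => simp [koornKer, vandSq, pairProdKer, Measure.real, volume_pi]
  | succ n ih =>
    have htP' : ((t/2)/(op*om)).re < 0 := by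
      have e : (t/2)/(op*om) = ((1/2:ℝ):ℂ)*(t/(op*om)) := by push_cast; ring
      rw [e, Complex.re_ofReal_mul]; linarith
    rw [(H.integral_koornKer_succ hM hA hc ht htP n).2,
      ih (hA.map_add (by simpa using ht) htP') (by simpa using hc),
      Finset.prod_range_succ', Nat.factorial_succ]
    have e : ∀ j ∈ Finset.range n, h (((n-j:ℕ):ℂ)*t) /
        (h t * h ((c.map fun a => a + t/2).sum + ((n+j-1:ℕ):ℂ)*t)) *
          pairProd h ((c.map fun a => a + t/2).map fun a => a + j*(t/2)) =
        h (((n+1-(j+1):ℕ):ℂ)*t) / (h t * h (c.sum + ((n+1+(j+1)-1:ℕ):ℂ)*t)) *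
          pairProd h (c.map fun a => a + ((j+1:ℕ):ℂ)*(t/2)) := by
      intro j hj
      have hj' := Finset.mem_range.1 hj
      have e1 : n+1-(j+1) = n-j := by omega
      have e2 : n+1+(j+1)-1 = (n+j-1)+2 := by omega
      rw [e1, e2, sum_map_add_const, hc, Multiset.map_map]
      congr 4
      · push_cast; ring
      · funext a
        simp only [Function.comp_apply]
        push_cast; ring
    rw [Finset.prod_congr rfl e]
    simp only [Nat.sub_zero, Nat.add_sub_cancel, Nat.cast_zero, zero_mul, add_zero,
      Multiset.map_id']
    push_cast
    ring

end HypH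

end

section

open Filter Topology

variable {G : ℂ → ℂ → ℂ → ℂ}

theorem hypH_mul_sub_eq_one (hG : IsHypGammaFamily G) {op om : ℂ} (hop : 0 < op.re)
    (hom : 0 < om.re) (a : ℂ) (h0 : 0 < a.re) :
    hypH G op om a ≠ 0 → hypH G op om a * hypH G op om (op+om-a) = 1 := by
  revert a
  refine strip_induction hom (W := op.re + om.re) (by linarith)
    (fun a h0 h1 _ => hypH_refl hG hop hom h0 h1) fun a h0 ih hne => ?_
  have hop0 := ne_zero_of_re_pos' hop
  rw [hypH_add_om hG hop hom h0] at hne ⊢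
  have hs : Complex.sin (Real.pi * a / op) ≠ 0 := fun h => hne (by simp [h])
  have hh : hypH G op om a ≠ 0 := fun h => hne (by simp [h])
  have e1 : Complex.cosh (Real.pi * (Complex.I * (op/2 - a)) / op) =
      Complex.sin (Real.pi * a / op) := by
    have : (Real.pi * (Complex.I * (op/2 - a)) / op : ℂ) =
        (Real.pi/2 - Real.pi*a/op) * Complex.I := by
      field_simp
    rw [this, Complex.cosh_mul_I, Complex.cos_pi_div_two_sub]
  have h1 := (hG op om hop hom).funEqm (Complex.I * (op/2 - a)) (by rwa [e1])
  rw [e1] at h1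
  have e2 : Complex.I * (op/2 - a) + Complex.I * om/2 =
      Complex.I * (op + om - a - (op+om)/2) := by ring
  have e3 : Complex.I * (op/2 - a) - Complex.I * om/2 =
      Complex.I * (op + om - (a+om) - (op+om)/2) := by ring
  rw [e2, e3] at h1
  have h2 := ih hh
  unfold hypH at h2 ⊢
  rw [h1] at h2
  linear_combination h2

theorem apply_eq_inv_hypH (hG : IsHypGammaFamily G) {op om : ℂ} (hop : 0 < op.re)
    (hom : 0 < om.re) {a z : ℂ} (h0 : 0 < a.re) (hne : hypH G op om a ≠ 0)
    (hz : z = Complex.I * ((op+om)/2 - a)) : G op om z = (hypH G op om a)⁻¹ := by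
  have := hypH_mul_sub_eq_one hG hop hom a h0 hne
  rw [← eq_inv_of_mul_eq_one_right this, hypH, hz]
  congr 1
  ring

theorem apply_eq_hypH {op om a z : ℂ} (hz : z = Complex.I * (a - (op+om)/2)) :
    G op om z = hypH G op om a := by
  rw [hypH, hz]

theorem ae_apply_notMem_of_countable {E : Type*} [NormedAddCommGroup E] [NormedSpace ℝ E]
    [MeasurableSpace E] [BorelSpace E] [FiniteDimensional ℝ E] (μ : Measure E)
    [μ.IsAddHaarMeasure] {l : E →ₗ[ℝ] ℝ} (hl : l ≠ 0) {Z : Set ℝ} (hZ : Z.Countable) :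
    ∀ᵐ v ∂μ, l v ∉ Z := by
  have hsurj := LinearMap.surjective hl
  refine (MeasureTheory.ae_comp_linearMap_mem_iff l μ volume hsurj
    hZ.measurableSet.compl).2 ?_
  exact (measure_eq_zero_iff_ae_notMem).1 (hZ.measure_zero volume)

theorem two_cosh_sub_two_cosh (a b : ℂ) :
    2 * Complex.cosh a - 2 * Complex.cosh b =
      4 * Complex.sinh ((a+b)/2) * Complex.sinh ((a-b)/2) := by
  have ha : a = (a+b)/2 + (a-b)/2 := by ring
  have hb : b = (a+b)/2 - (a-b)/2 := by ring
  have h1 := Complex.cosh_add ((a+b)/2) ((a-b)/2)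
  have h2 := Complex.cosh_sub ((a+b)/2) ((a-b)/2)
  rw [← ha] at h1
  rw [← hb] at h2
  rw [h1, h2]
  ring

namespace HypH

variable {op om : ℂ} {h : ℂ → ℂ}

theorem countable_zeros_line (H : HypH op om h) {b : ℂ} (hb : 0 < b.re) :
    {u : ℝ | h (b + Complex.I*u) = 0}.Countable := by
  have hinj : Function.Injective fun u : ℝ => b + Complex.I*(u:ℂ) := by
    intro u v huv
    have := mul_left_cancel₀ Complex.I_ne_zero (add_left_cancel huv)
    exact_mod_cast this
  refine (H.countable_zeros.preimage hinj).mono fun u hu => ?_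
  exact And.intro (by simpa using hb) hu

theorem sinh_density_pair (H : HypH op om h) (x y : ℝ) :
    h (op+om - Complex.I*(x+y)) * h (op+om + Complex.I*(x+y)) *
      (h (op+om - Complex.I*(x-y)) * h (op+om + Complex.I*(x-y))) =
    (coshVar op y - coshVar op x) * (coshVar om y - coshVar om x) := by
  have h1 := H.four_sinh_mul_sinh ((x+y)/2)
  have h2 := H.four_sinh_mul_sinh ((x-y)/2)
  have e : ∀ u : ℂ, 2*Complex.I*(u/2) = Complex.I*u := fun u => by ring
  push_cast at h1 h2
  rw [e] at h1 h2
  rw [h1, h2]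
  have e2 : ∀ q : ℂ, coshVar q y - coshVar q x =
      -(4 * Complex.sinh (2*Real.pi*((x+y)/2)/q) * Complex.sinh (2*Real.pi*((x-y)/2)/q)) := by
    intro q
    rw [coshVar, coshVar, ← neg_sub, two_cosh_sub_two_cosh]
    congr 3 <;> ring_nf
  rw [e2, e2]
  ring

theorem sinhDens_eq (H : HypH op om h) (x : ℝ) :
    h (op+om - 2*Complex.I*x) * h (op+om+2*Complex.I*x) = sinhDens op om x := by
  rw [H.four_sinh_mul_sinh, sinhDens]
  congr 2
  · congr 1; ring_nf
  · ring_nf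

end HypH

theorem vandSq_eq (op om : ℂ) {n : ℕ} (x : Fin n → ℝ) :
    vandSq op om x = ∏ i, ∏ j ∈ Finset.Ioi i,
      ((coshVar op (x j) - coshVar op (x i)) * (coshVar om (x j) - coshVar om (x i))) := by
  simp only [vandSq, Matrix.det_vandermonde, Finset.prod_mul_distrib]

theorem bcLong_eq {n : ℕ} (f : ℝ → ℂ) (v : Fin n → ℝ) :
    bcLong f v = ∏ i, ∏ j ∈ Finset.Ioi i,
      (f (v i + v j) * f (-(v i + v j)) * f (v i - v j) * f (v j - v i)) := by
  rw [bcLong, Finset.prod_filter, Fintype.prod_prod_type]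
  refine Finset.prod_congr rfl fun i _ => ?_
  rw [← Finset.prod_filter]
  congr 1
  ext j
  simp

/-- The four parameters whose product of gamma functions collapses to one by duplication. -/
def dupParams (op om k : ℂ) : Multiset ℂ :=
  {k/2, k/2+op/2, k/2+om/2, k/2+(op+om)/2}

theorem hypWt_dupParams (hG : IsHypGammaFamily G) {op om : ℂ} (hop : 0 < op.re) (hom : 0 < om.re)
    {k : ℂ} (hk : 0 < k.re) (x : ℝ) :
    hypWt (hypH G op om) (dupParams op om k) x =
      hypH G op om (k - Complex.I*(2*x:ℝ)) * hypH G op om (k + Complex.I*(2*x:ℝ)) := by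
  rw [hypH_dup hG hop hom (k - Complex.I*(2*x:ℝ)) (by simpa using hk),
    hypH_dup hG hop hom (k + Complex.I*(2*x:ℝ)) (by simpa using hk)]
  have e1 : (k - Complex.I*(2*x:ℝ))/2 = k/2 - Complex.I*x := by push_cast; ring
  have e2 : (k + Complex.I*(2*x:ℝ))/2 = k/2 + Complex.I*x := by push_cast; ring
  rw [e1, e2]
  simp only [hypWt, dupParams, Multiset.insert_eq_cons, Multiset.map_cons, Multiset.map_singleton,
    Multiset.prod_cons, Multiset.prod_singleton, sub_add_eq_add_sub, add_right_comm _ (Complex.I*_)]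
  ring

theorem ae_integrand_eq (hG : IsHypGammaFamily G) {op om : ℂ} (hop : 0 < op.re) (hom : 0 < om.re)
    {k t : ℂ} (hk : 0 < k.re) (ht : 0 < t.re) (n : ℕ) :
    ∀ᵐ v : Fin n → ℝ, koornKer op om (hypH G op om) (dupParams op om k) t v =
      bcShort (fun x => G op om (2*(x:ℂ) + Complex.I*(op+om)/2) /
          G op om (2*(x:ℂ) + Complex.I*(-k+(op+om)/2))) v *
        bcLong (fun x => G op om ((x:ℂ) + Complex.I*(op+om)/2) /
          G op om ((x:ℂ) + Complex.I*(-t+(op+om)/2))) v := by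
  have H := isHypH hG hop hom
  have hnum : ∀ u : ℂ, G op om (u + Complex.I*(op+om)/2) = hypH G op om (op+om - Complex.I*u) :=
    fun u => apply_eq_hypH (by linear_combination u * Complex.I_sq)
  have hden : ∀ (b u : ℂ), 0 < (b + Complex.I*u).re → hypH G op om (b + Complex.I*u) ≠ 0 →
      G op om (u + Complex.I*(-b+(op+om)/2)) = (hypH G op om (b + Complex.I*u))⁻¹ :=
    fun b u h0 h1 => apply_eq_inv_hypH hG hop hom h0 h1 (by linear_combination u * Complex.I_sq)
  have hae : ∀ {b : ℂ}, 0 < b.re → ∀ {l : (Fin n → ℝ) →ₗ[ℝ] ℝ}, l ≠ 0 →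
      ∀ᵐ v : Fin n → ℝ, hypH G op om (b + Complex.I*(l v:ℝ)) ≠ 0 := fun hb l hl =>
    ae_apply_notMem_of_countable volume hl (H.countable_zeros_line hb)
  let p : Fin n → ((Fin n → ℝ) →ₗ[ℝ] ℝ) := fun i => LinearMap.proj i
  have hp : ∀ (i : Fin n) (r : ℝ), r ≠ 0 → r • p i ≠ 0 := by
    intro i r hr h0
    have := congrArg (fun l => l (Pi.single i 1)) h0
    simp [p] at this
    exact hr this
  have hpp : ∀ (i j : Fin n) (r r' : ℝ), i ≠ j → r ≠ 0 → r • p i + r' • p j ≠ 0 := by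
    intro i j r r' hij hr h0
    have := congrArg (fun l => l (Pi.single i 1)) h0
    simp [p, hij.symm] at this
    exact hr this
  have a1 : ∀ᵐ v : Fin n → ℝ, ∀ i, hypH G op om (k + Complex.I*((2*v i:ℝ):ℂ)) ≠ 0 ∧
      hypH G op om (k - Complex.I*((2*v i:ℝ):ℂ)) ≠ 0 := by
    rw [ae_all_iff]
    intro i
    filter_upwards [hae hk (hp i 2 (by norm_num)), hae hk (hp i (-2) (by norm_num))] with v h1 h2
    refine ⟨by simpa [p] using h1, by simpa [p, sub_eq_add_neg] using h2⟩
  have a2 : ∀ᵐ v : Fin n → ℝ, ∀ i j, i < j → (hypH G op om (t + Complex.I*((v i:ℂ)+v j)) ≠ 0 ∧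
      hypH G op om (t - Complex.I*((v i:ℂ)+v j)) ≠ 0) ∧
      (hypH G op om (t + Complex.I*((v i:ℂ)-v j)) ≠ 0 ∧
      hypH G op om (t - Complex.I*((v i:ℂ)-v j)) ≠ 0) := by
    simp only [ae_all_iff]
    intro i j hij
    filter_upwards [hae ht (hpp i j 1 1 hij.ne (by norm_num)),
      hae ht (hpp i j (-1) (-1) hij.ne (by norm_num)),
      hae ht (hpp i j 1 (-1) hij.ne (by norm_num)),
      hae ht (hpp i j (-1) 1 hij.ne (by norm_num))] with v h1 h2 h3 h4
    simp only [LinearMap.add_apply, LinearMap.smul_apply, p, LinearMap.proj_apply, smul_eq_mul,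
      Complex.ofReal_add, Complex.ofReal_mul, Complex.ofReal_neg, Complex.ofReal_one] at h1 h2 h3 h4
    refine ⟨⟨?_, ?_⟩, ?_, ?_⟩
    · convert h1 using 2; ring
    · convert h2 using 2; ring
    · convert h3 using 2; ring
    · convert h4 using 2; ring
  filter_upwards [a1, a2] with v b1 b2
  have hre : ∀ (b : ℂ) (u : ℝ), (b + Complex.I*(u:ℂ)).re = b.re := fun b u => by simp
  rw [koornKer, vandSq_eq, pairProdKer, bcLong_eq, mul_right_comm, ← Finset.prod_mul_distrib,
    mul_comm, bcShort]
  congr 1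
  · refine Finset.prod_congr rfl fun j _ => ?_
    obtain ⟨c1, c2⟩ := b1 j
    have d1 := hden k ((2*v j:ℝ):ℂ) (by rw [hre]; exact hk) c1
    have d2 := hden k ((-(2*v j):ℝ):ℂ) (by rw [hre]; exact hk) (by
      simpa [sub_eq_add_neg] using c2)
    have e1 : ((2*v j:ℝ):ℂ) = 2*(v j:ℂ) := by push_cast; ring
    have e2 : ((-(2*v j):ℝ):ℂ) = 2*((-v j:ℝ):ℂ) := by push_cast; ring
    rw [e1] at d1
    rw [e2] at d2
    rw [d1, d2, hnum, hnum, div_inv_eq_mul, div_inv_eq_mul, hypWt_dupParams hG hop hom hk,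
      ← H.sinhDens_eq]
    have f1 : k - Complex.I*((2*v j:ℝ):ℂ) = k + Complex.I*(2*((-v j:ℝ):ℂ)) := by push_cast; ring
    have f2 : op + om - 2*Complex.I*(v j) = op + om - Complex.I*(2*(v j:ℂ)) := by ring
    have f3 : op + om + 2*Complex.I*(v j) = op + om - Complex.I*(2*((-v j:ℝ):ℂ)) := by
      push_cast; ring
    rw [f1, e1, f2, f3]
    ring
  · refine Finset.prod_congr rfl fun i _ => ?_
    rw [← Finset.prod_mul_distrib]
    refine Finset.prod_congr rfl fun j hj => ?_
    obtain ⟨⟨c1, c2⟩, c3, c4⟩ := b2 i j (Finset.mem_Ioi.1 hj)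
    have g1 : ((-(v i + v j) : ℝ):ℂ) = -((v i:ℂ)+v j) := by push_cast; ring
    have g2 : ((v j - v i : ℝ):ℂ) = -((v i:ℂ)-v j) := by push_cast; ring
    have hre2 : ∀ (u : ℂ), u.im = 0 → 0 < (t + Complex.I*u).re := fun u hu => by simp [hu, ht]
    rw [g1, g2, Complex.ofReal_add, Complex.ofReal_sub,
      hden t ((v i:ℂ)+v j) (hre2 _ (by simp)) c1,
      hden t (-((v i:ℂ)+v j)) (hre2 _ (by simp)) (by
        rw [mul_neg, ← sub_eq_add_neg]; exact c2),
      hden t ((v i:ℂ)-v j) (hre2 _ (by simp)) c3,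
      hden t (-((v i:ℂ)-v j)) (hre2 _ (by simp)) (by
        rw [mul_neg, ← sub_eq_add_neg]; exact c4)]
    simp only [hnum, div_inv_eq_mul]
    rw [← H.sinh_density_pair, pairKer]
    simp only [mul_neg, sub_neg_eq_add, ← sub_eq_add_neg]
    ring

end

section

open Filter Topology

variable {G : ℂ → ℂ → ℂ → ℂ}

theorem pairProd_four (h : ℂ → ℂ) (a b c d : ℂ) :
    pairProd h {a, b, c, d} = h (a+b) * h (a+c) * h (a+d) * h (b+c) * h (b+d) * h (c+d) := by
  have h1 : pairProd h {d} = 1 := by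
    simp [pairProd, Multiset.powersetCard_eq_empty]
  simp only [Multiset.insert_eq_cons, pairProd_cons, h1, Multiset.map_cons,
    Multiset.map_singleton, Multiset.prod_cons, Multiset.prod_singleton]
  rw [add_comm b a, add_comm c a, add_comm d a, add_comm c b, add_comm d b, add_comm d c]
  ring

theorem prod_filter_lt_four (f : Fin 4 → Fin 4 → ℂ) :
    ∏ p ∈ Finset.univ.filter (fun p : Fin 4 × Fin 4 => p.1 < p.2), f p.1 p.2 =
      f 0 1 * f 0 2 * f 0 3 * f 1 2 * f 1 3 * f 2 3 := by
  rw [Finset.prod_filter, Fintype.prod_prod_type]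
  simp [Fin.prod_univ_four, -mul_eq_mul_right_iff, -mul_eq_mul_left_iff]
  ring

theorem adm_dupParams {op om k : ℂ} (hop : 0 < op.re) (hom : 0 < om.re) (hk : 0 < k.re)
    (hkP : (k/(op*om)).re < 0) : Adm op om (dupParams op om k) := by
  refine ⟨?_, ?_⟩
  · simp only [dupParams, Multiset.insert_eq_cons, Multiset.mem_cons, Multiset.mem_singleton]
    have e : ∀ z : ℂ, (z/2).re = z.re/2 := fun z => by simp
    rintro a (rfl | rfl | rfl | rfl) <;> simp only [Complex.add_re, e] <;> linarith
  · have e : (op+om-(dupParams op om k).sum)/(op*om) = -((2:ℝ)*(k/(op*om))) := by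
      simp only [dupParams, Multiset.insert_eq_cons, Multiset.sum_cons, Multiset.sum_singleton]
      push_cast; ring
    rw [e, Complex.neg_re, Complex.re_ofReal_mul]
    linarith

theorem NBC_eq (hG : IsHypGammaFamily G) {op om k t : ℂ} (hop : 0 < op.re) (hom : 0 < om.re)
    (hk : 0 < k.re) (hkP : (k/(op*om)).re < 0) (ht : 0 < t.re) (htP : (t/(op*om)).re < 0) (n : ℕ) :
    NBC G n op om ![-k/2, -k/2-op/2, -k/2-om/2, -k/2-(op+om)/2] (-t) =
      2^n * (n.factorial : ℂ) * ((op*om)^((1:ℂ)/2))^n * ∏ j ∈ Finset.range n,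
        (hypH G op om (((n-j:ℕ):ℂ)*t) /
          (hypH G op om t * hypH G op om ((dupParams op om k).sum + ((n+j-1:ℕ):ℂ)*t)) *
          pairProd (hypH G op om) ((dupParams op om k).map fun a => a + j*(t/2))) := by
  have H := isHypH hG hop hom
  have hA := adm_dupParams hop hom hk hkP
  have hop0 := ne_zero_of_re_pos' hop
  have hom0 := ne_zero_of_re_pos' hom
  have hsum : (dupParams op om k).sum = 2*k+op+om := by
    simp only [dupParams, Multiset.insert_eq_cons, Multiset.sum_cons, Multiset.sum_singleton]
    ring
  set h := hypH G op om with hh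
  have inv : ∀ {a z : ℂ}, 0 < a.re → h a ≠ 0 → z = Complex.I*((op+om)/2 - a) →
      G op om z = (h a)⁻¹ := fun h0 h1 h2 => apply_eq_inv_hypH hG hop hom h0 h1 h2
  have nz : ∀ m : ℕ, m ≠ 0 → h (m*t) ≠ 0 := fun m hm => by
    simpa using H.ne_zero_nat_mul H.adm_zero ht htP (m := m) (Or.inr hm)
  have nzs : ∀ m : ℕ, h ((dupParams op om k).sum + m*t) ≠ 0 := fun m =>
    H.ne_zero_nat_mul hA ht htP (Or.inl (by simp [dupParams]))
  have pre : ∀ m : ℕ, 0 ≤ (m*t).re ∧ ((m*t)/(op*om)).re ≤ 0 := fun m => by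
    have e : (m*t)/(op*om) = (m:ℝ)*(t/(op*om)) := by push_cast; ring
    rw [e, ← Complex.ofReal_natCast, Complex.re_ofReal_mul, Complex.re_ofReal_mul]
    exact ⟨by positivity, mul_nonpos_of_nonneg_of_nonpos (by positivity) htP.le⟩
  have i1 := re_inv_pos hop
  have i2 := re_inv_pos hom
  have pair : ∀ (j : ℕ) (r r' : ℝ), 0 ≤ r → r ≤ 2 → 0 ≤ r' → r' ≤ 2 → ∀ z : ℂ,
      z = Complex.I*((op+om)/2 + j*(-t) - (k + r*(op/2) + r'*(om/2))) →
      G op om z = (h (k + r*(op/2) + r'*(om/2) + j*t))⁻¹ := by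
    intro j r r' h0 h2 h0' h2' z hz
    obtain ⟨p1, p2⟩ := pre j
    have hre : 0 < (k + r*(op/2) + r'*(om/2) + j*t).re := by
      have e : ∀ z : ℂ, (z/2).re = z.re/2 := fun z => by simp
      simp only [Complex.add_re, Complex.re_ofReal_mul, e] at p1 ⊢
      positivity
    refine inv hre (H.ne_zero_of_re hre ?_) (by rw [hz]; ring)
    have e : (op+om-(k + r*(op/2) + r'*(om/2) + j*t))/(op*om) =
        ((1-r/2:ℝ):ℂ)*(1/om) + ((1-r'/2:ℝ):ℂ)*(1/op) - k/(op*om) - (j*t)/(op*om) := by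
      push_cast; field_simp; ring
    rw [e]
    simp only [Complex.sub_re, Complex.add_re, Complex.re_ofReal_mul]
    have q1 : 0 ≤ (1-r/2)*(1/om).re := mul_nonneg (by linarith) i2.le
    have q2 : 0 ≤ (1-r'/2)*(1/op).re := mul_nonneg (by linarith) i1.le
    linarith
  have hrefl : ∏ j ∈ Finset.range n, (h (((n-j:ℕ):ℂ)*t) /
      (h t * h ((dupParams op om k).sum + ((n+j-1:ℕ):ℂ)*t)) *
        pairProd h ((dupParams op om k).map fun a => a + j*(t/2))) =
      ∏ j ∈ Finset.range n, (h (((j+1:ℕ):ℂ)*t) /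
        (h t * h ((dupParams op om k).sum + ((2*n-2-j:ℕ):ℂ)*t)) *
          pairProd h ((dupParams op om k).map fun a => a + j*(t/2))) := by
    rw [Finset.prod_mul_distrib, Finset.prod_mul_distrib, ← Finset.prod_range_reflect
      (fun j : ℕ => h (((n-j:ℕ):ℂ)*t) /
        (h t * h ((dupParams op om k).sum + ((n+j-1:ℕ):ℂ)*t)))]
    congr 1
    refine Finset.prod_congr rfl fun j hj => ?_
    have hj' := Finset.mem_range.1 hj
    have e1 : n - (n-1-j) = j+1 := by omega
    have e2 : n + (n-1-j) - 1 = 2*n-2-j := by omega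
    rw [e1, e2]
  rw [NBC, hrefl]
  congr 1
  refine Finset.prod_congr rfl fun j hj => ?_
  have hj' := Finset.mem_range.1 hj
  have e3 : ((2*n-2-j : ℕ):ℂ) = 2*(n:ℂ) - j - 2 := by
    have : 2*n-2-j + (j+2) = 2*n := by omega
    have := congrArg (fun m : ℕ => (m:ℂ)) this
    push_cast at this
    linear_combination this
  have hsre := multiset_sum_re_pos hA.1 (by simp [dupParams])
  have g1 : G op om (Complex.I*((op+om)/2 + -t)) = (h t)⁻¹ :=
    inv ht (by simpa using nz 1 one_ne_zero) (by ring)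
  have g2 : G op om (Complex.I*((op+om)/2 + ((j:ℂ)+1)*(-t))) = (h (((j+1:ℕ):ℂ)*t))⁻¹ :=
    inv (by
      rw [← Complex.ofReal_natCast, Complex.re_ofReal_mul]; positivity) (nz _ j.succ_ne_zero)
      (by push_cast; ring)
  have g3 := inv (z := Complex.I*((op+om)/2 + (2*(n:ℂ) - (j:ℂ) - 2)*(-t) +
      (-k/2 + (-k/2-op/2) + (-k/2-om/2) + (-k/2-(op+om)/2)))) (by
      rw [Complex.add_re]; exact add_pos_of_pos_of_nonneg hsre (pre (2*n-2-j)).1) (nzs (2*n-2-j)) (by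
      rw [e3, hsum]; ring)
  rw [prod_filter_lt_four (fun p q => G op om (Complex.I*((op+om)/2 + (j:ℂ)*(-t) +
    (![-k/2, -k/2-op/2, -k/2-om/2, -k/2-(op+om)/2] : Fin 4 → ℂ) p +
    (![-k/2, -k/2-op/2, -k/2-om/2, -k/2-(op+om)/2] : Fin 4 → ℂ) q)))]
  have hv : ∀ a b c d : ℂ, (![a, b, c, d] : Fin 4 → ℂ) 0 = a ∧ (![a, b, c, d] : Fin 4 → ℂ) 1 = b ∧
      (![a, b, c, d] : Fin 4 → ℂ) 2 = c ∧ (![a, b, c, d] : Fin 4 → ℂ) 3 = d := fun a b c d =>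
    ⟨rfl, rfl, rfl, rfl⟩
  obtain ⟨v0, v1, v2, v3⟩ := hv (-k/2) (-k/2-op/2) (-k/2-om/2) (-k/2-(op+om)/2)
  rw [v0, v1, v2, v3, g1, g2, g3,
    pair j 1 0 (by norm_num) (by norm_num) (by norm_num) (by norm_num) _ (by push_cast; ring),
    pair j 0 1 (by norm_num) (by norm_num) (by norm_num) (by norm_num)
      (Complex.I * ((op+om)/2 + j*(-t) + -k/2 + (-k/2-om/2))) (by push_cast; ring),
    pair j 1 1 (by norm_num) (by norm_num) (by norm_num) (by norm_num)
      (Complex.I * ((op+om)/2 + j*(-t) + -k/2 + (-k/2-(op+om)/2))) (by push_cast; ring),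
    pair j 1 1 (by norm_num) (by norm_num) (by norm_num) (by norm_num)
      (Complex.I * ((op+om)/2 + j*(-t) + (-k/2-op/2) + (-k/2-om/2))) (by push_cast; ring),
    pair j 2 1 (by norm_num) (by norm_num) (by norm_num) (by norm_num)
      (Complex.I * ((op+om)/2 + j*(-t) + (-k/2-op/2) + (-k/2-(op+om)/2))) (by push_cast; ring),
    pair j 1 2 (by norm_num) (by norm_num) (by norm_num) (by norm_num)
      (Complex.I * ((op+om)/2 + j*(-t) + (-k/2-om/2) + (-k/2-(op+om)/2))) (by push_cast; ring)]
  have hm : ((dupParams op om k).map fun a => a + j*(t/2)) =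
      {k/2 + j*(t/2), k/2+op/2 + j*(t/2), k/2+om/2 + j*(t/2), k/2+(op+om)/2 + j*(t/2)} := by
    simp [dupParams]
  rw [hm, pairProd_four]
  have f1 : k/2 + j*(t/2) + (k/2+op/2 + j*(t/2)) = k + (1:ℝ)*(op/2) + (0:ℝ)*(om/2) + j*t := by
    push_cast; ring
  have f2 : k/2 + j*(t/2) + (k/2+om/2 + j*(t/2)) = k + (0:ℝ)*(op/2) + (1:ℝ)*(om/2) + j*t := by
    push_cast; ring
  have f3 : k/2 + j*(t/2) + (k/2+(op+om)/2 + j*(t/2)) =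
      k + (1:ℝ)*(op/2) + (1:ℝ)*(om/2) + j*t := by
    push_cast; ring
  have f4 : k/2+op/2 + j*(t/2) + (k/2+om/2 + j*(t/2)) =
      k + (1:ℝ)*(op/2) + (1:ℝ)*(om/2) + j*t := by
    push_cast; ring
  have f5 : k/2+op/2 + j*(t/2) + (k/2+(op+om)/2 + j*(t/2)) =
      k + (2:ℝ)*(op/2) + (1:ℝ)*(om/2) + j*t := by
    push_cast; ring
  have f6 : k/2+om/2 + j*(t/2) + (k/2+(op+om)/2 + j*(t/2)) =
      k + (1:ℝ)*(op/2) + (2:ℝ)*(om/2) + j*t := by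
    push_cast; ring
  rw [f1, f2, f3, f4, f5, f6]
  simp only [div_eq_mul_inv, mul_inv, inv_inv]
  ring

theorem evalMomDet_hypH (hG : IsHypGammaFamily G) {op om : ℂ} (hop : 0 < op.re) (hom : 0 < om.re)
    (hP : (op*om).im ≠ 0) : EvalMomDet op om (hypH G op om) := fun n A hc hA =>
  momDet_mul_sum hG hop hom hP n A hc hA

end

/-- **Generalized Cherednik–Macdonald identity for `Σ` of type `C_n`, case (i)**:
the integral equals `N_BC(ω₊,ω₋; γ = (k_l/2, k_l/2-ω₊/2, k_l/2-ω₋/2, k_l/2-ω), κ = k_s)`. -/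
theorem generalized_CM_Cn_case_i (n : ℕ) (hn : 2 ≤ n)
    (G : ℂ → ℂ → ℂ → ℂ)
    (hG : ∀ a b : ℂ, 0 < a.re → 0 < b.re → IsHypGamma a b (G a b))
    (op om ks kl : ℂ) (hop : 0 < op.re) (hom : 0 < om.re) (him : (op*om).im < 0)
    (hks1 : ks.re < 0) (hks2 : ∃ w : ℂ, 0 < w.re ∧ ks = op*om*w)
    (hkl1 : kl.re < 0) (hkl2 : ∃ w : ℂ, 0 < w.re ∧ kl = op*om*w) :
    Integrable (fun v : Fin n → ℝ =>
      bcShort (fun x => G op om (2*(x:ℂ) + Complex.I*(op+om)/2) /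
          G op om (2*(x:ℂ) + Complex.I*(kl+(op+om)/2))) v *
        bcLong (fun x => G op om ((x:ℂ) + Complex.I*(op+om)/2) /
          G op om ((x:ℂ) + Complex.I*(ks+(op+om)/2))) v) ∧
    ∫ v : Fin n → ℝ,
        (bcShort (fun x => G op om (2*(x:ℂ) + Complex.I*(op+om)/2) /
            G op om (2*(x:ℂ) + Complex.I*(kl+(op+om)/2))) v *
          bcLong (fun x => G op om ((x:ℂ) + Complex.I*(op+om)/2) /
            G op om ((x:ℂ) + Complex.I*(ks+(op+om)/2))) v) =
      NBC G n op om ![kl/2, kl/2-op/2, kl/2-om/2, kl/2-(op+om)/2] ks := by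
  obtain ⟨k, rfl⟩ : ∃ k, kl = -k := ⟨-kl, (neg_neg kl).symm⟩
  obtain ⟨t, rfl⟩ : ∃ t, ks = -t := ⟨-ks, (neg_neg ks).symm⟩
  have hP0 : op*om ≠ 0 := mul_ne_zero (ne_zero_of_re_pos' hop) (ne_zero_of_re_pos' hom)
  have key : ∀ {a : ℂ}, (∃ w : ℂ, 0 < w.re ∧ -a = op*om*w) → (a/(op*om)).re < 0 := by
    rintro a ⟨w, hw, e⟩
    have : a/(op*om) = -w := by
      rw [div_eq_iff hP0]; linear_combination -e
    rw [this, Complex.neg_re]; linarith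
  have hk : 0 < k.re := by simpa using hkl1
  have ht : 0 < t.re := by simpa using hks1
  have hA := adm_dupParams hop hom hk (key hkl2)
  have hc : (dupParams op om k).card = 4 := by simp [dupParams]
  have hM := evalMomDet_hypH hG hop hom him.ne
  have H := isHypH hG hop hom
  have hae := ae_integrand_eq hG hop hom hk ht n
  obtain ⟨m, rfl⟩ : ∃ m, n = m+1 := ⟨n-1, by omega⟩
  refine ⟨(H.integral_koornKer_succ hM hA hc ht (key hks2) m).1.congr hae, ?_⟩
  rw [← integral_congr_ae hae, H.integral_koornKer hM ht (key hks2) (m+1) hA hc,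
    NBC_eq hG hop hom hk (key hkl2) ht (key hks2)]

end
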